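/- arXiv:math-ph/0609079 — 3 statements merged into one kernel-verified Lean document; each statement's English description precedes it below -/
import Mathlib

section
/- The algebraic tensor product H(ℝᵐ;ℝᵐ) ⊗ H(ℝⁿ;ℝⁿ) is dense in H(ℝ^{m+n};ℝ^{m+n}): for every f ∈ H(ℝ^{m+n};ℝ^{m+n}), every k > 0, N ∈ ℕ and ε > 0, there exist finitely many functions g₁,…,g_p ∈ H(ℝᵐ;ℝᵐ) and h₁,…,h_p ∈ H(ℝⁿ;ℝⁿ) such that sup_{(ξ,η)∈ℝ^{m+n}, |α|≤N} e^{k(|ξ|₁+|η|₁)} |D^α( f(ξ,η) − Σᵢ gᵢ(ξ)hᵢ(η) )| < ε. -/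
open MeasureTheory Complex Filter Topology

noncomputable section

/-- Partial derivative in the `i`-th coordinate direction. -/
def pd {n : ℕ} (i : Fin n) (f : (Fin n → ℝ) → ℂ) : (Fin n → ℝ) → ℂ :=
  fun x => fderiv ℝ f x (Pi.single i 1)

/-- Multi-index derivative `D^α`. -/
def Dm {n : ℕ} (α : Fin n → ℕ) (f : (Fin n → ℝ) → ℂ) : (Fin n → ℝ) → ℂ :=
  (List.finRange n).foldr (fun i g => (pd i)^[α i] g) f

/-- Order `|α|` of a multi-index. -/
def mOrd {n : ℕ} (α : Fin n → ℕ) : ℕ := ∑ i, α i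

/-- Supporting function `h_K(ξ) = sup_{x ∈ K} ⟨ξ,x⟩` of a set `K`. -/
def hSupp {n : ℕ} (K : Set (Fin n → ℝ)) (ξ : Fin n → ℝ) : ℝ :=
  sSup ((fun x => ∑ i, ξ i * x i) '' K)

/-- The ℓ¹ norm `|ξ|₁ = ∑ i |ξ i|`. -/
def n1 {n : ℕ} (ξ : Fin n → ℝ) : ℝ := ∑ i, |ξ i|

/-- Membership in `H(ℝⁿ;ℝⁿ)`: smooth, with `e^{k|ξ|₁} D^α f(ξ)` bounded for every
`k > 0` and every multi-index `α`. -/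
def memHRn {n : ℕ} (f : (Fin n → ℝ) → ℂ) : Prop :=
  ContDiff ℝ (⊤ : ℕ∞) f ∧ ∀ k : ℝ, 0 < k → ∀ α : Fin n → ℕ,
    ∃ M : ℝ, ∀ ξ, Real.exp (k * n1 ξ) * ‖Dm α f ξ‖ ≤ M

open scoped Convolution

section Basic

variable {n : ℕ}

theorem Dm_induction (R : ((Fin n → ℝ) → ℂ) → ((Fin n → ℝ) → ℂ) → ((Fin n → ℝ) → ℂ) → Prop)
    (hR : ∀ i f g h, R f g h → R (pd i f) (pd i g) (pd i h)) (α : Fin n → ℕ)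
    {f g h : (Fin n → ℝ) → ℂ} (hfgh : R f g h) : R (Dm α f) (Dm α g) (Dm α h) := by
  unfold Dm
  induction List.finRange n with
  | nil => exact hfgh
  | cons i l ih =>
    simp only [List.foldr_cons]
    induction α i with
    | zero => exact ih
    | succ k ihk =>
      simp only [Function.iterate_succ_apply']
      exact hR i _ _ _ ihk

theorem Dm_zero (f : (Fin n → ℝ) → ℂ) : Dm 0 f = f := by
  unfold Dm
  induction List.finRange n with
  | nil => rfl
  | cons i l ih => simp

theorem ContDiff.pd {f : (Fin n → ℝ) → ℂ} (hf : ContDiff ℝ (⊤ : ℕ∞) f) (i : Fin n) :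
    ContDiff ℝ (⊤ : ℕ∞) (pd i f) :=
  (hf.fderiv_right (by simp)).clm_apply contDiff_const

theorem ContDiff.Dm {f : (Fin n → ℝ) → ℂ} (hf : ContDiff ℝ (⊤ : ℕ∞) f) (α : Fin n → ℕ) :
    ContDiff ℝ (⊤ : ℕ∞) (Dm α f) :=
  Dm_induction (fun f _ _ => ContDiff ℝ (⊤ : ℕ∞) f) (fun i _ _ _ h => h.pd i) α (g := f) (h := f) hf

theorem support_Dm_subset {f : (Fin n → ℝ) → ℂ} {K : Set (Fin n → ℝ)} (hK : IsClosed K)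
    (hf : Function.support f ⊆ K) (α : Fin n → ℕ) : Function.support (Dm α f) ⊆ K := by
  have := Dm_induction (fun f _ _ => tsupport f ⊆ K)
    (fun i f _ _ h => (tsupport_fderiv_apply_subset ℝ (Pi.single i 1)).trans h) α (g := f) (h := f)
    (closure_minimal hf hK)
  exact (subset_tsupport _).trans this

theorem HasCompactSupport.Dm {f : (Fin n → ℝ) → ℂ} (hf : HasCompactSupport f) (α : Fin n → ℕ) :
    HasCompactSupport (Dm α f) :=
  .of_support_subset_isCompact hf (support_Dm_subset (isClosed_tsupport _) (subset_tsupport f) α)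

theorem Dm_sub {f g : (Fin n → ℝ) → ℂ} (hf : ContDiff ℝ (⊤ : ℕ∞) f) (hg : ContDiff ℝ (⊤ : ℕ∞) g)
    (α : Fin n → ℕ) : Dm α (fun x => f x - g x) = fun x => Dm α f x - Dm α g x := by
  refine (Dm_induction (fun f g h => ContDiff ℝ (⊤ : ℕ∞) f ∧ ContDiff ℝ (⊤ : ℕ∞) g ∧
    h = fun x => f x - g x) ?_ α ⟨hf, hg, rfl⟩).2.2
  rintro i f g _ ⟨hf, hg, rfl⟩
  refine ⟨hf.pd i, hg.pd i, funext fun x => ?_⟩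
  simp only [pd]
  rw [fderiv_fun_sub (hf.differentiable (by simp) x) (hg.differentiable (by simp) x)]
  rfl

theorem Dm_sum_mul_translate {ι : Type*} (s : Finset ι) (c : ι → ℂ) (a : ι → Fin n → ℝ)
    {ρ : (Fin n → ℝ) → ℂ} (hρ : ContDiff ℝ (⊤ : ℕ∞) ρ) (α : Fin n → ℕ) :
    Dm α (fun x => ∑ j ∈ s, c j * ρ (x - a j)) = fun x => ∑ j ∈ s, c j * Dm α ρ (x - a j) := by
  refine (Dm_induction (fun ρ g _ => ContDiff ℝ (⊤ : ℕ∞) ρ ∧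
    g = fun x => ∑ j ∈ s, c j * ρ (x - a j)) ?_ α (h := ρ) ⟨hρ, rfl⟩).2
  rintro i ρ _ _ ⟨hρ, rfl⟩
  refine ⟨hρ.pd i, funext fun x => ?_⟩
  have hd := hρ.differentiable (by simp)
  have hd' : ∀ j, DifferentiableAt ℝ (fun x => ρ (x - a j)) x := fun j =>
    (hd _).comp x (differentiableAt_id.sub_const _)
  simp only [pd]
  rw [fderiv_fun_sum fun j _ => (hd' j).const_mul _]
  simp only [FunLike.coe_sum, Finset.sum_apply]
  refine Finset.sum_congr rfl fun j _ => ?_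
  rw [fderiv_const_mul (hd' j), fderiv_comp_sub]
  rfl

/-- Convolution of complex-valued functions on `ℝⁿ`. -/
def conv (f ρ : (Fin n → ℝ) → ℂ) : (Fin n → ℝ) → ℂ := fun x => ∫ w, f w * ρ (x - w)

theorem hasCompactSupport_comp_sub {ρ : (Fin n → ℝ) → ℂ} (hρ : HasCompactSupport ρ)
    (x : Fin n → ℝ) : HasCompactSupport fun w => ρ (x - w) :=
  hρ.comp_homeomorph (Homeomorph.subLeft x)

theorem integrable_mul_comp_sub {f ρ : (Fin n → ℝ) → ℂ} (hf : Continuous f) (hρ : Continuous ρ)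
    (hρc : HasCompactSupport ρ) (x : Fin n → ℝ) : Integrable fun w => f w * ρ (x - w) :=
  Continuous.integrable_of_hasCompactSupport (by fun_prop)
    (hasCompactSupport_comp_sub hρc x).mul_left

theorem pd_conv {f ρ : (Fin n → ℝ) → ℂ} (hf : Continuous f) (hρ : ContDiff ℝ (⊤ : ℕ∞) ρ)
    (hρc : HasCompactSupport ρ) (i : Fin n) : pd i (conv f ρ) = conv f (pd i ρ) := by
  have hconv : conv f ρ = (f ⋆[ContinuousLinearMap.mul ℝ ℂ, volume] ρ) := rfl
  ext x
  have h1 : ContDiff ℝ 1 ρ := hρ.of_le (by exact_mod_cast le_top)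
  rw [hconv]
  simp only [pd]
  rw [(hρc.hasFDerivAt_convolution_right (ContinuousLinearMap.mul ℝ ℂ)
    hf.locallyIntegrable h1 x).fderiv,
    convolution_precompR_apply _ hf.locallyIntegrable (hρc.fderiv ℝ) (h1.continuous_fderiv (by simp))]
  rfl

theorem conv_pd {f ρ : (Fin n → ℝ) → ℂ} (hf : ContDiff ℝ (⊤ : ℕ∞) f)
    (hρ : ContDiff ℝ (⊤ : ℕ∞) ρ) (hρc : HasCompactSupport ρ) (i : Fin n) :
    conv f (pd i ρ) = conv (pd i f) ρ := by
  ext x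
  have hd := hρ.differentiable (by simp)
  have hpd : ∀ w, fderiv ℝ (fun w => ρ (x - w)) w (Pi.single i 1) = -pd i ρ (x - w) := fun w => by
    have h : HasFDerivAt (fun w => ρ (x - w)) _ w :=
      (hd (x - w)).hasFDerivAt.comp w ((hasFDerivAt_id w).const_sub x)
    rw [h.fderiv]
    simp [pd]
  have hpc : HasCompactSupport (pd i ρ) := hρc.fderiv_apply ℝ _
  have key := integral_mul_fderiv_eq_neg_fderiv_mul_of_integrable (μ := volume)
    (f := f) (g := fun w => ρ (x - w)) (v := Pi.single i 1)
    (integrable_mul_comp_sub (hf.pd i).continuous hρ.continuous hρc x)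
    (by
      simp only [hpd, mul_neg]
      exact (integrable_mul_comp_sub hf.continuous (hρ.pd i).continuous hpc x).neg)
    (integrable_mul_comp_sub hf.continuous hρ.continuous hρc x)
    (fun w _ => hf.differentiable (by simp) w)
    (fun w _ => (hd _).comp w (differentiableAt_id.const_sub x))
  simp only [hpd, mul_neg, integral_neg, neg_inj] at key
  exact key

theorem Dm_conv_right {f ρ : (Fin n → ℝ) → ℂ} (hf : Continuous f) (hρ : ContDiff ℝ (⊤ : ℕ∞) ρ)
    (hρc : HasCompactSupport ρ) (α : Fin n → ℕ) : Dm α (conv f ρ) = conv f (Dm α ρ) := by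
  refine (Dm_induction (fun ρ g _ => ContDiff ℝ (⊤ : ℕ∞) ρ ∧ HasCompactSupport ρ ∧
    g = conv f ρ) ?_ α (h := ρ) ⟨hρ, hρc, rfl⟩).2.2
  rintro i ρ _ _ ⟨hρ, hρc, rfl⟩
  exact ⟨hρ.pd i, hρc.fderiv_apply ℝ _, pd_conv hf hρ hρc i⟩

theorem Dm_conv_left {f ρ : (Fin n → ℝ) → ℂ} (hf : ContDiff ℝ (⊤ : ℕ∞) f)
    (hρ : ContDiff ℝ (⊤ : ℕ∞) ρ) (hρc : HasCompactSupport ρ) (α : Fin n → ℕ) :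
    Dm α (conv f ρ) = conv (Dm α f) ρ := by
  refine (Dm_induction (fun f g _ => ContDiff ℝ (⊤ : ℕ∞) f ∧ g = conv f ρ) ?_ α (h := ρ)
    ⟨hf, rfl⟩).2
  rintro i f _ _ ⟨hf, rfl⟩
  exact ⟨hf.pd i, (pd_conv hf.continuous hρ hρc i).trans (conv_pd hf hρ hρc i)⟩

theorem continuous_n1 : Continuous (n1 : (Fin n → ℝ) → ℝ) := by
  unfold n1
  fun_prop

theorem norm_le_n1 (x : Fin n → ℝ) : ‖x‖ ≤ n1 x :=
  (pi_norm_le_iff_of_nonneg (Finset.sum_nonneg fun _ _ => abs_nonneg _)).2 fun i =>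
    Finset.single_le_sum (f := fun i => |x i|) (fun _ _ => abs_nonneg _) (Finset.mem_univ i)

theorem n1_le_add (x y : Fin n → ℝ) : n1 x ≤ n1 y + n * ‖x - y‖ := by
  have : n * ‖x - y‖ = ∑ _i : Fin n, ‖x - y‖ := by simp
  rw [this]
  unfold n1
  rw [← Finset.sum_add_distrib]
  refine Finset.sum_le_sum fun i _ => ?_
  have h1 : |x i - y i| ≤ ‖x - y‖ := norm_le_pi_norm (x - y) i
  have h2 := abs_sub_abs_le_abs_sub (x i) (y i)
  linarith

theorem abs_n1_sub_le (x y : Fin n → ℝ) : |n1 x - n1 y| ≤ n * ‖x - y‖ := by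
  have h1 := n1_le_add x y
  have h2 := n1_le_add y x
  rw [norm_sub_rev y x] at h2
  rw [abs_le]
  constructor <;> linarith

theorem integrable_exp_neg_n1 : Integrable fun x : Fin n → ℝ => Real.exp (-n1 x) := by
  have h := (integrable_one_add_norm (E := Fin n → ℝ) (μ := volume) (r := (n + 1 : ℕ))
    (by simp)).const_mul ((n + 1).factorial * Real.exp 1)
  refine h.mono' (Real.continuous_exp.comp continuous_n1.neg).aestronglyMeasurable
    (.of_forall fun x => ?_)
  have h1 := Real.pow_div_factorial_le_exp (1 + ‖x‖) (by positivity) (n + 1)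
  rw [div_le_iff₀ (by positivity)] at h1
  rw [Real.norm_of_nonneg (Real.exp_pos _).le, Real.rpow_neg (by positivity), Real.rpow_natCast,
    ← div_eq_mul_inv, le_div_iff₀ (by positivity)]
  have h2 := norm_le_n1 x
  calc Real.exp (-n1 x) * (1 + ‖x‖) ^ (n + 1)
      ≤ Real.exp (-‖x‖) * (Real.exp (1 + ‖x‖) * (n + 1).factorial) := by gcongr
    _ = _ := by rw [← mul_assoc, ← Real.exp_add]; ring_nf

theorem memHRn.integrable_exp_mul {f : (Fin n → ℝ) → ℂ} (hf : memHRn f) {k : ℝ} (hk : 0 < k) :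
    Integrable fun x => Real.exp (k * n1 x) * ‖f x‖ := by
  obtain ⟨M, hM⟩ := hf.2 (k + 1) (by linarith) 0
  rw [Dm_zero] at hM
  refine (integrable_exp_neg_n1.const_mul M).mono'
    ((Real.continuous_exp.comp (continuous_n1.const_mul k)).mul
      hf.1.continuous.norm).aestronglyMeasurable (.of_forall fun x => ?_)
  rw [Real.norm_of_nonneg (by positivity)]
  calc Real.exp (k * n1 x) * ‖f x‖
      = Real.exp ((k + 1) * n1 x) * ‖f x‖ * Real.exp (-n1 x) := by
        rw [mul_right_comm, ← Real.exp_add]; ring_nf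
    _ ≤ _ := by gcongr; exact hM x

theorem memHRn.integrable {f : (Fin n → ℝ) → ℂ} (hf : memHRn f) : Integrable f := by
  refine (hf.integrable_exp_mul one_pos).mono' hf.1.continuous.aestronglyMeasurable
    (.of_forall fun x => ?_)
  have : 1 ≤ Real.exp (1 * n1 x) := Real.one_le_exp (by
    have := (norm_nonneg x).trans (norm_le_n1 x); linarith)
  nlinarith [norm_nonneg (f x)]

theorem memHRn_of_hasCompactSupport {f : (Fin n → ℝ) → ℂ} (hf : ContDiff ℝ (⊤ : ℕ∞) f)
    (hfc : HasCompactSupport f) : memHRn f := by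
  refine ⟨hf, fun k _ α => ?_⟩
  have hc : Continuous fun x => (Real.exp (k * n1 x) : ℂ) * Dm α f x :=
    (Complex.continuous_ofReal.comp (Real.continuous_exp.comp (continuous_n1.const_mul k))).mul
      (hf.Dm α).continuous
  obtain ⟨M, hM⟩ := hc.bounded_above_of_compact_support (hfc.Dm α).mul_left
  refine ⟨M, fun x => ?_⟩
  have := hM x
  rwa [norm_mul, Complex.norm_real, Real.norm_of_nonneg (Real.exp_pos _).le] at this

theorem exists_dist_lt_exp_mul_norm_sub_le {u : (Fin n → ℝ) → ℂ} (hu : Continuous u) {k M : ℝ}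
    (hk : 0 < k) (hM : ∀ x, Real.exp ((k + 1) * n1 x) * ‖u x‖ ≤ M) {ε : ℝ} (hε : 0 < ε) :
    ∃ δ > 0, ∀ x w, dist w x < δ → Real.exp (k * n1 x) * ‖u w - u x‖ ≤ ε := by
  set v : (Fin n → ℝ) → ℂ := fun x => Real.exp (k * n1 x) * u x with hv
  have hvn : ∀ x, ‖v x‖ = Real.exp (k * n1 x) * ‖u x‖ := fun x => by
    rw [hv, norm_mul, Complex.norm_real, Real.norm_of_nonneg (Real.exp_pos _).le]
  have hM0 : 0 ≤ M := le_trans (by positivity) (hM 0)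
  have hvM' : ∀ x, ‖v x‖ ≤ M * Real.exp (-‖x‖) := fun x => by
    calc ‖v x‖ = Real.exp ((k + 1) * n1 x) * ‖u x‖ * Real.exp (-n1 x) := by
          rw [hvn, mul_right_comm, ← Real.exp_add]; ring_nf
      _ ≤ M * Real.exp (-‖x‖) := by
          have := norm_le_n1 x
          gcongr
          exact hM x
  have hvM : ∀ x, ‖v x‖ ≤ M := fun x => (hvM' x).trans
    (mul_le_of_le_one_right hM0 (Real.exp_le_one_iff.2 (by simp)))
  have hvc : Continuous v :=
    (Complex.continuous_ofReal.comp (Real.continuous_exp.comp (continuous_n1.const_mul k))).mul hu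
  have hv0 : Tendsto v (cocompact _) (𝓝 0) := by
    refine squeeze_zero_norm hvM' ?_
    rw [← mul_zero M]
    exact ((Real.tendsto_exp_neg_atTop_nhds_zero).comp (tendsto_norm_cocompact_atTop)).const_mul M
  obtain ⟨δ₁, hδ₁, h₁⟩ := Metric.uniformContinuous_iff.1
    (hvc.uniformContinuous_of_tendsto_cocompact hv0) (ε / 2) (by positivity)
  obtain ⟨τ, hτ, h₂⟩ := Metric.continuousAt_iff.1 (Real.continuous_exp.continuousAt (x := 0))
    (ε / (2 * (M + 1))) (by positivity)
  refine ⟨min δ₁ (τ / (k * n + 1)), by positivity, fun x w hw => ?_⟩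
  have hw1 := h₁ (hw.trans_le (min_le_left _ _))
  have hw2 := hw.trans_le (min_le_right _ _)
  rw [lt_div_iff₀ (by positivity), dist_eq_norm] at hw2
  rw [dist_eq_norm] at hw1
  set t := k * (n1 x - n1 w) with ht
  have ht' : dist t 0 < τ := by
    rw [Real.dist_0_eq_abs, ht, abs_mul, abs_of_pos hk]
    have := mul_le_mul_of_nonneg_left (abs_n1_sub_le x w) hk.le
    rw [norm_sub_rev] at this
    nlinarith [norm_nonneg (w - x)]
  have h₃ := h₂ ht'
  rw [Real.exp_zero, Real.dist_eq] at h₃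
  have hdec : (Real.exp (k * n1 x) : ℂ) * (u w - u x) =
      ((Real.exp t - 1 : ℝ) : ℂ) * v w + (v w - v x) := by
    have : Real.exp (k * n1 x) = Real.exp t * Real.exp (k * n1 w) := by
      rw [← Real.exp_add, ht]; ring_nf
    simp only [hv]
    rw [this]
    push_cast
    ring
  calc Real.exp (k * n1 x) * ‖u w - u x‖
      = ‖(Real.exp (k * n1 x) : ℂ) * (u w - u x)‖ := by
        rw [norm_mul, Complex.norm_real, Real.norm_of_nonneg (Real.exp_pos _).le]
    _ ≤ |Real.exp t - 1| * ‖v w‖ + ‖v w - v x‖ := by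
        rw [hdec]
        refine (norm_add_le _ _).trans_eq ?_
        rw [norm_mul, Complex.norm_real, Real.norm_eq_abs]
    _ ≤ ε / (2 * (M + 1)) * (M + 1) + ε / 2 := by
        gcongr
        linarith [hvM w]
    _ = ε := by field_simp; ring

theorem exists_smooth_mollifier {δ : ℝ} (hδ : 0 < δ) :
    ∃ b : ℝ → ℝ, ContDiff ℝ (⊤ : ℕ∞) b ∧ (∀ t, 0 ≤ b t) ∧ ∫ t, b t = 1 ∧
      ∀ t, δ < |t| → b t = 0 := by
  let φ : ContDiffBump (0 : ℝ) := ⟨δ / 2, δ, by positivity, by linarith⟩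
  refine ⟨φ.normed volume, φ.contDiff_normed, φ.nonneg_normed, φ.integral_normed, fun t ht => ?_⟩
  have : t ∉ Function.support (φ.normed volume) := by
    rw [φ.support_normed_eq]
    simpa using ht.le
  simpa using this

/-- The `n`-fold tensor power of a function on the real line. -/
def tensorPower (n : ℕ) (b : ℝ → ℝ) : (Fin n → ℝ) → ℂ := fun x => ∏ i, (b (x i) : ℂ)

theorem tensorPower_add_sub {m n : ℕ} (b : ℝ → ℝ) (x a : Fin (m + n) → ℝ) :
    tensorPower (m + n) b (x - a) =
      tensorPower m b ((fun j => x (Fin.castAdd n j)) - fun j => a (Fin.castAdd n j)) *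
        tensorPower n b ((fun j => x (Fin.natAdd m j)) - fun j => a (Fin.natAdd m j)) := by
  simp only [tensorPower, Pi.sub_apply, Fin.prod_univ_add]

theorem contDiff_tensorPower {b : ℝ → ℝ} (hb : ContDiff ℝ (⊤ : ℕ∞) b) :
    ContDiff ℝ (⊤ : ℕ∞) (tensorPower n b) :=
  contDiff_prod fun i _ => Complex.ofRealCLM.contDiff.comp (hb.comp (contDiff_apply ℝ ℝ i))

theorem support_tensorPower_subset {b : ℝ → ℝ} {δ : ℝ} (hδ : 0 ≤ δ)
    (hb : ∀ t, δ < |t| → b t = 0) :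
    Function.support (tensorPower n b) ⊆ Metric.closedBall 0 δ := by
  intro x hx
  rw [mem_closedBall_zero_iff, pi_norm_le_iff_of_nonneg hδ]
  intro i
  by_contra! h
  exact hx (Finset.prod_eq_zero (Finset.mem_univ i) (by simp [hb _ h]))

theorem hasCompactSupport_tensorPower {b : ℝ → ℝ} {δ : ℝ} (hδ : 0 ≤ δ)
    (hb : ∀ t, δ < |t| → b t = 0) : HasCompactSupport (tensorPower n b) :=
  .of_support_subset_isCompact (isCompact_closedBall 0 δ) (support_tensorPower_subset hδ hb)

theorem integral_tensorPower {b : ℝ → ℝ} (hb : ∫ t, b t = 1) : ∫ x, tensorPower n b x = 1 := by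
  simp only [tensorPower]
  rw [integral_fintype_prod_volume_eq_prod (fun _ t => (b t : ℂ)), integral_complex_ofReal, hb]
  simp

theorem integral_norm_tensorPower {b : ℝ → ℝ} (hb : ∫ t, b t = 1) (hb0 : ∀ t, 0 ≤ b t) :
    ∫ x, ‖tensorPower n b x‖ = 1 := by
  have : ∀ x : Fin n → ℝ, ‖tensorPower n b x‖ = ∏ i, b (x i) := fun x => by
    simp [tensorPower, norm_prod, abs_of_nonneg (hb0 _)]
  simp only [this]
  rw [integral_fintype_prod_volume_eq_prod (fun _ t => b t), hb]
  simp

theorem norm_conv_sub_le {u ρ : (Fin n → ℝ) → ℂ} (hu : Continuous u) (hρ : Continuous ρ)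
    {δ E : ℝ} (hρs : Function.support ρ ⊆ Metric.closedBall 0 δ) (hρ1 : ∫ x, ρ x = 1)
    (hρn : ∫ x, ‖ρ x‖ = 1) (x : Fin n → ℝ) (hE : ∀ w, dist w x ≤ δ → ‖u w - u x‖ ≤ E) :
    ‖conv u ρ x - u x‖ ≤ E := by
  have hρc : HasCompactSupport ρ := .of_support_subset_isCompact (isCompact_closedBall 0 δ) hρs
  have h1 : Integrable fun w => u x * ρ (x - w) := integrable_mul_comp_sub continuous_const hρ hρc x
  have h2 : Integrable fun w => E * ‖ρ (x - w)‖ :=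
    ((hρ.integrable_of_hasCompactSupport hρc).norm.comp_sub_left x).const_mul E
  have h3 : conv u ρ x - u x = ∫ w, (u w - u x) * ρ (x - w) := by
    simp only [sub_mul]
    rw [integral_sub (integrable_mul_comp_sub hu hρ hρc x) h1, integral_const_mul,
      integral_sub_left_eq_self ρ volume x, hρ1, mul_one]
    rfl
  have h4 : ∫ w, E * ‖ρ (x - w)‖ = E := by
    rw [integral_const_mul, integral_sub_left_eq_self (fun y => ‖ρ y‖) volume x, hρn, mul_one]
  rw [h3]
  refine (norm_integral_le_of_norm_le h2 (.of_forall fun w => ?_)).trans_eq h4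
  rw [norm_mul]
  by_cases hw : ρ (x - w) = 0
  · simp [hw]
  · gcongr
    refine hE w ?_
    simpa [dist_eq_norm, norm_sub_rev] using hρs hw

/-- The index of the cube of side `1 / q` containing `w`. -/
def cubeIndex (q : ℕ) (w : Fin n → ℝ) : Fin n → ℤ := fun i => ⌊q * w i⌋

/-- The corner of the cube of side `1 / q` with index `z`. -/
def cubeCorner (q : ℕ) (z : Fin n → ℤ) : Fin n → ℝ := fun i => z i / q

/-- The indices whose coordinates are bounded by `q ^ 2`. -/
def cubeIndices (n q : ℕ) : Finset (Fin n → ℤ) :=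
  Fintype.piFinset fun _ => Finset.Icc (-(q ^ 2 : ℤ)) (q ^ 2)

theorem norm_sub_cubeCorner_le {q : ℕ} (hq : 0 < q) (w : Fin n → ℝ) :
    ‖w - cubeCorner q (cubeIndex q w)‖ ≤ 1 / q := by
  rw [pi_norm_le_iff_of_nonneg (by positivity)]
  intro i
  have hq' : (0 : ℝ) < q := by exact_mod_cast hq
  have h1 := Int.floor_le (q * w i)
  have h2 := (Int.lt_floor_add_one (q * w i)).le
  have h3 : w i - (⌊q * w i⌋ : ℝ) / q = (q * w i - ⌊q * w i⌋) / q := by field_simp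
  simp only [Pi.sub_apply, cubeCorner, cubeIndex]
  rw [h3, Real.norm_of_nonneg (by apply div_nonneg <;> linarith)]
  gcongr
  linarith

theorem le_n1_of_cubeIndex_notMem {q : ℕ} (hq : 0 < q) {w : Fin n → ℝ}
    (hw : cubeIndex q w ∉ cubeIndices n q) : q ≤ n1 w := by
  simp only [cubeIndices, Fintype.mem_piFinset, Finset.mem_Icc, not_forall] at hw
  obtain ⟨i, hi⟩ := hw
  have hq' : (0 : ℝ) < q := by exact_mod_cast hq
  refine le_trans ?_ ((norm_le_pi_norm w i).trans (norm_le_n1 w))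
  rw [Real.norm_eq_abs, le_abs]
  simp only [cubeIndex, not_and_or, not_le] at hi
  rcases hi with hi | hi
  · rw [Int.floor_lt] at hi
    push_cast at hi
    right
    nlinarith
  · have := (Int.cast_lt (R := ℝ)).2 hi
    have h2 := Int.floor_le (q * w i)
    push_cast at this
    left
    nlinarith

open Classical in
theorem eventually_exp_mul_norm_sub_le {β : (Fin n → ℝ) → ℂ} (hβ : Continuous β)
    (hβs : Function.support β ⊆ Metric.closedBall 0 1) {k : ℝ} (hk : 0 < k) {η : ℝ} (hη : 0 < η) :
    ∀ᶠ q : ℕ in atTop, ∀ x w, Real.exp (k * n1 x) * ‖β (x - w) -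
      (if cubeIndex q w ∈ cubeIndices n q then β (x - cubeCorner q (cubeIndex q w)) else 0)‖ ≤
        η * Real.exp ((k + 1) * n1 w) := by
  have hβc : HasCompactSupport β := .of_support_subset_isCompact (isCompact_closedBall 0 1) hβs
  have hβ0 : ∀ y, 1 < ‖y‖ → β y = 0 := fun y hy => by
    by_contra h
    have := hβs h
    rw [mem_closedBall_zero_iff] at this
    linarith
  obtain ⟨B, hB⟩ := hβ.bounded_above_of_compact_support hβc
  obtain ⟨δ, hδ, hunif⟩ := Metric.uniformContinuous_iff.1
    (hβ.uniformContinuous_of_tendsto_cocompact hβc.is_zero_at_infty)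
    (η * Real.exp (-(k * (n * 2)))) (by positivity)
  have hlim : Tendsto (fun q : ℕ => Real.exp (k * n) * B * Real.exp (-(q : ℝ))) atTop (𝓝 0) := by
    rw [← mul_zero (Real.exp (k * n) * B)]
    exact (Real.tendsto_exp_neg_atTop_nhds_zero.comp tendsto_natCast_atTop_atTop).const_mul _
  filter_upwards [hlim.eventually_le_const hη,
    tendsto_one_div_atTop_nhds_zero_nat.eventually_lt_const hδ, eventually_gt_atTop 0]
    with q hq1 hq2 hq3 x w
  have hw0 : 0 ≤ n1 w := (norm_nonneg w).trans (norm_le_n1 w)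
  have hx := n1_le_add x w
  split_ifs with hmem
  · have hcorner := norm_sub_cubeCorner_le hq3 w
    set c := cubeCorner q (cubeIndex q w)
    by_cases hxw : ‖x - w‖ ≤ 2
    · have h1 : ‖β (x - w) - β (x - c)‖ ≤ η * Real.exp (-(k * (n * 2))) := by
        rw [← dist_eq_norm]
        refine (hunif ?_).le
        rw [dist_sub_left, dist_eq_norm]
        linarith
      calc Real.exp (k * n1 x) * ‖β (x - w) - β (x - c)‖
          ≤ Real.exp (k * (n1 w + n * 2)) * (η * Real.exp (-(k * (n * 2)))) := by
            gcongr
            exact hx.trans (by gcongr)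
        _ = η * Real.exp (k * n1 w) := by
            rw [mul_left_comm, ← Real.exp_add]; ring_nf
        _ ≤ _ := by gcongr; linarith
    · push Not at hxw
      have hq1' : 1 / (q : ℝ) ≤ 1 := by
        rw [div_le_one (by exact_mod_cast hq3)]
        exact_mod_cast hq3
      have h2 : 1 < ‖x - c‖ := by
        have := norm_sub_le_norm_sub_add_norm_sub x c w
        rw [norm_sub_rev c w] at this
        linarith
      rw [hβ0 _ h2, hβ0 _ (by linarith)]
      simp only [sub_self, norm_zero, mul_zero]
      positivity
  · rw [sub_zero]
    have hqw := le_n1_of_cubeIndex_notMem hq3 hmem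
    by_cases hxw : ‖x - w‖ ≤ 1
    · have hB0 : 0 ≤ B := (norm_nonneg _).trans (hB 0)
      calc Real.exp (k * n1 x) * ‖β (x - w)‖
          ≤ Real.exp (k * (n1 w + n * 1)) * B := by
            gcongr
            · exact hx.trans (by gcongr)
            · exact hB _
        _ = Real.exp (k * n) * B * Real.exp (-n1 w) * Real.exp ((k + 1) * n1 w) := by
            rw [mul_assoc _ (Real.exp (-n1 w)), ← Real.exp_add, mul_right_comm, ← Real.exp_add]
            ring_nf
        _ ≤ Real.exp (k * n) * B * Real.exp (-(q : ℝ)) * Real.exp ((k + 1) * n1 w) := by gcongr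
        _ ≤ _ := by gcongr
    · rw [hβ0 _ (by linarith)]
      simp only [norm_zero, mul_zero]
      positivity

theorem measurable_cubeIndex (q : ℕ) : Measurable (cubeIndex q : (Fin n → ℝ) → Fin n → ℤ) :=
  measurable_pi_lambda _ fun i => Int.measurable_floor.comp ((measurable_pi_apply i).const_mul _)

theorem exp_mul_norm_conv_sub_sum_le {f β : (Fin n → ℝ) → ℂ} (hf : Continuous f)
    (hfi : Integrable f) {k η : ℝ} (hfe : Integrable fun w => Real.exp ((k + 1) * n1 w) * ‖f w‖)
    (hβ : Continuous β) (hβc : HasCompactSupport β) {q : ℕ} (x : Fin n → ℝ)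
    (h : ∀ w, Real.exp (k * n1 x) * ‖β (x - w) -
      (if cubeIndex q w ∈ cubeIndices n q then β (x - cubeCorner q (cubeIndex q w)) else 0)‖ ≤
        η * Real.exp ((k + 1) * n1 w)) :
    Real.exp (k * n1 x) * ‖conv f β x - ∑ z ∈ cubeIndices n q,
        (∫ w in cubeIndex q ⁻¹' {z}, f w) * β (x - cubeCorner q z)‖ ≤
      η * ∫ w, Real.exp ((k + 1) * n1 w) * ‖f w‖ := by
  classical
  have hmeas : ∀ z : Fin n → ℤ, MeasurableSet (cubeIndex q ⁻¹' {z}) := fun z =>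
    measurable_cubeIndex q (measurableSet_singleton z)
  set F : (Fin n → ℤ) → (Fin n → ℝ) → ℂ := fun z w =>
    (cubeIndex q ⁻¹' {z}).indicator f w * β (x - cubeCorner q z) with hF
  have hFi : ∀ z, Integrable (F z) := fun z => (hfi.indicator (hmeas z)).mul_const _
  have hsum : ∑ z ∈ cubeIndices n q,
      (∫ w in cubeIndex q ⁻¹' {z}, f w) * β (x - cubeCorner q z) =
      ∫ w, ∑ z ∈ cubeIndices n q, F z w := by
    rw [integral_finsetSum _ fun z _ => hFi z]
    refine Finset.sum_congr rfl fun z _ => ?_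
    rw [hF, integral_mul_const, integral_indicator (hmeas z)]
  have hpt : ∀ w, ∑ z ∈ cubeIndices n q, F z w = f w *
      (if cubeIndex q w ∈ cubeIndices n q then β (x - cubeCorner q (cubeIndex q w)) else 0) := by
    intro w
    simp only [hF, Set.indicator_apply, Set.mem_preimage, Set.mem_singleton_iff, ite_mul, zero_mul]
    rw [Finset.sum_ite_eq]
    split_ifs <;> simp
  rw [hsum, conv, ← integral_sub (integrable_mul_comp_sub hf hβ hβc x)
    (integrable_finsetSum _ fun z _ => hFi z), ← integral_const_mul]
  have hint := norm_integral_le_of_norm_le (hfe.const_mul η)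
    (f := fun w => (Real.exp (k * n1 x) : ℂ) * (f w * β (x - w) - ∑ z ∈ cubeIndices n q, F z w))
    (.of_forall fun w => by
      rw [hpt, ← mul_sub, norm_mul, norm_mul, Complex.norm_real,
        Real.norm_of_nonneg (Real.exp_pos _).le, mul_left_comm, ← mul_assoc η, mul_comm _ ‖f w‖]
      exact mul_le_mul_of_nonneg_left (h w) (norm_nonneg (f w)))
  rwa [integral_const_mul, norm_mul, Complex.norm_real,
    Real.norm_of_nonneg (Real.exp_pos _).le] at hint

theorem finite_setOf_mOrd_le (N : ℕ) : {α : Fin n → ℕ | mOrd α ≤ N}.Finite :=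
  (Set.finite_Iic fun _ => N).subset fun α hα i =>
    (Finset.single_le_sum (f := α) (fun _ _ => Nat.zero_le _) (Finset.mem_univ i)).trans hα

theorem memHRn.exists_dist_le_exp_mul_norm_sub_le {f : (Fin n → ℝ) → ℂ} (hf : memHRn f) {k : ℝ}
    (hk : 0 < k) (N : ℕ) {ε : ℝ} (hε : 0 < ε) :
    ∃ δ > 0, δ ≤ 1 ∧ ∀ α : Fin n → ℕ, mOrd α ≤ N → ∀ x w, dist w x ≤ δ →
      Real.exp (k * n1 x) * ‖Dm α f w - Dm α f x‖ ≤ ε := by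
  have h : ∀ α : Fin n → ℕ, ∀ᶠ δ in 𝓝[>] (0 : ℝ), ∀ x w, dist w x ≤ δ →
      Real.exp (k * n1 x) * ‖Dm α f w - Dm α f x‖ ≤ ε := fun α => by
    obtain ⟨M, hM⟩ := hf.2 (k + 1) (by linarith) α
    obtain ⟨δ, hδ, h⟩ := exists_dist_lt_exp_mul_norm_sub_le (hf.1.Dm α).continuous hk hM hε
    filter_upwards [Ioo_mem_nhdsGT hδ] with r hr x w hw using h x w (hw.trans_lt hr.2)
  obtain ⟨δ, h, hδ⟩ := (((Filter.eventually_all_finite (finite_setOf_mOrd_le N)).2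
    fun α _ => h α).and (Ioc_mem_nhdsGT one_pos)).exists
  exact ⟨δ, hδ.1, hδ.2, h⟩

theorem memHRn.exists_tensorPower_approx {f : (Fin n → ℝ) → ℂ} (hf : memHRn f) {k : ℝ}
    (hk : 0 < k) (N : ℕ) {ε : ℝ} (hε : 0 < ε) :
    ∃ b : ℝ → ℝ, ContDiff ℝ (⊤ : ℕ∞) b ∧ (∀ t, 1 < |t| → b t = 0) ∧
      ∃ (s : Finset (Fin n → ℤ)) (c : (Fin n → ℤ) → ℂ) (a : (Fin n → ℤ) → Fin n → ℝ),
        ∀ α : Fin n → ℕ, mOrd α ≤ N → ∀ x, Real.exp (k * n1 x) *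
          ‖Dm α (fun x => f x - ∑ z ∈ s, c z * tensorPower n b (x - a z)) x‖ < ε := by
  obtain ⟨δ, hδ, hδ1, hfδ⟩ := hf.exists_dist_le_exp_mul_norm_sub_le hk N (half_pos (half_pos hε))
  obtain ⟨b, hb, hb0, hb1, hbδ⟩ := exists_smooth_mollifier hδ
  have hbone : ∀ t, 1 < |t| → b t = 0 := fun t ht => hbδ t (hδ1.trans_lt ht)
  set ρ := tensorPower n b
  have hρ : ContDiff ℝ (⊤ : ℕ∞) ρ := contDiff_tensorPower hb
  have hρc : HasCompactSupport ρ := hasCompactSupport_tensorPower hδ.le hbδ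
  set A := ∫ w, Real.exp ((k + 1) * n1 w) * ‖f w‖
  have hA : 0 ≤ A := integral_nonneg fun w => by positivity
  obtain ⟨q, hq⟩ := ((Filter.eventually_all_finite (finite_setOf_mOrd_le (n := n) N)).2 fun α _ =>
    eventually_exp_mul_norm_sub_le (hρ.Dm α).continuous
      (support_Dm_subset Metric.isClosed_closedBall (support_tensorPower_subset zero_le_one hbone) α)
      hk (η := ε / 2 / (A + 1)) (by positivity)).exists
  refine ⟨b, hb, hbone, cubeIndices n q, fun z => ∫ w in cubeIndex q ⁻¹' {z}, f w, cubeCorner q,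
    fun α hα x => ?_⟩
  have h1 : Real.exp (k * n1 x) * ‖conv (Dm α f) ρ x - Dm α f x‖ ≤ ε / 2 / 2 := by
    rw [mul_comm, ← le_div_iff₀ (Real.exp_pos _)]
    refine norm_conv_sub_le (hf.1.Dm α).continuous hρ.continuous
      (support_tensorPower_subset hδ.le hbδ) (integral_tensorPower hb1)
      (integral_norm_tensorPower hb1 hb0) x fun w hw => ?_
    rw [le_div_iff₀ (Real.exp_pos _), mul_comm]
    exact hfδ α hα x w hw
  have h2 := exp_mul_norm_conv_sub_sum_le hf.1.continuous hf.integrable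
    (hf.integrable_exp_mul (by linarith)) (hρ.Dm α).continuous (hρc.Dm α) x (hq α hα x)
  rw [← Dm_conv_right hf.1.continuous hρ hρc, Dm_conv_left hf.1 hρ hρc] at h2
  have h3 : ε / 2 / (A + 1) * A ≤ ε / 2 := by
    rw [div_mul_eq_mul_div, div_le_iff₀ (by positivity)]
    nlinarith
  have hsum : ContDiff ℝ (⊤ : ℕ∞) fun x => ∑ z ∈ cubeIndices n q,
      (∫ w in cubeIndex q ⁻¹' {z}, f w) * ρ (x - cubeCorner q z) :=
    ContDiff.sum fun z _ => contDiff_const.mul (hρ.comp (contDiff_id.sub contDiff_const))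
  rw [Dm_sub hf.1 hsum, Dm_sum_mul_translate _ _ _ hρ]
  set S := ∑ z ∈ cubeIndices n q, (∫ w in cubeIndex q ⁻¹' {z}, f w) * Dm α ρ (x - cubeCorner q z)
  have h4 := norm_sub_le_norm_sub_add_norm_sub (Dm α f x) (conv (Dm α f) ρ x) S
  rw [norm_sub_rev (Dm α f x) (conv (Dm α f) ρ x)] at h4
  have h5 := mul_le_mul_of_nonneg_left h4 (Real.exp_pos (k * n1 x)).le
  rw [mul_add] at h5
  change _ ≤ _ * A at h2
  change Real.exp (k * n1 x) * ‖Dm α f x - S‖ < ε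
  linarith

theorem memHRn_const_mul_tensorPower_sub {b : ℝ → ℝ} (hb : ContDiff ℝ (⊤ : ℕ∞) b)
    (hb1 : ∀ t, 1 < |t| → b t = 0) (c : ℂ) (a : Fin n → ℝ) :
    memHRn fun x => c * tensorPower n b (x - a) :=
  memHRn_of_hasCompactSupport
    (contDiff_const.mul ((contDiff_tensorPower hb).comp (contDiff_id.sub contDiff_const)))
    (((hasCompactSupport_tensorPower zero_le_one hb1).comp_homeomorph
      (Homeomorph.subRight a)).mul_left (f := fun _ => c))

end Basic

/-- The algebraic tensor product `H(ℝᵐ;ℝᵐ) ⊗ H(ℝⁿ;ℝⁿ)` is dense in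
`H(ℝ^{m+n};ℝ^{m+n})`.  A point `ζ ∈ ℝ^{m+n}` splits as `ξ = ζ ∘ castAdd` and
`η = ζ ∘ natAdd`, and `|ζ|₁ = |ξ|₁ + |η|₁`. -/
theorem stmt_2 {m n : ℕ} (f : (Fin (m + n) → ℝ) → ℂ) (hf : memHRn f)
    (k : ℝ) (hk : 0 < k) (N : ℕ) (ε : ℝ) (hε : 0 < ε) :
    ∃ (p : ℕ) (g : Fin p → (Fin m → ℝ) → ℂ) (h : Fin p → (Fin n → ℝ) → ℂ),
      (∀ i, memHRn (g i)) ∧ (∀ i, memHRn (h i)) ∧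
      ∀ (α : Fin (m + n) → ℕ), mOrd α ≤ N → ∀ ζ : Fin (m + n) → ℝ,
        Real.exp (k * n1 ζ) *
          ‖Dm α (fun ζ' => f ζ' - ∑ i, g i (fun j => ζ' (Fin.castAdd n j)) *
              h i (fun j => ζ' (Fin.natAdd m j))) ζ‖ < ε := by
  obtain ⟨b, hb, hb1, s, c, a, h⟩ := hf.exists_tensorPower_approx hk N hε
  let e := s.equivFin.symm
  refine ⟨s.card, fun i x => c (e i) * tensorPower m b (x - fun j => a (e i) (Fin.castAdd n j)),
    fun i y => 1 * tensorPower n b (y - fun j => a (e i) (Fin.natAdd m j)),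
    fun i => memHRn_const_mul_tensorPower_sub hb hb1 _ _,
    fun i => memHRn_const_mul_tensorPower_sub hb hb1 _ _, fun α hα ζ => ?_⟩
  have hsum : ∀ x, ∑ z ∈ s, c z * tensorPower (m + n) b (x - a z) = ∑ i,
      c (e i) * tensorPower m b ((fun j => x (Fin.castAdd n j)) - fun j => a (e i) (Fin.castAdd n j)) *
        (1 * tensorPower n b ((fun j => x (Fin.natAdd m j)) - fun j => a (e i) (Fin.natAdd m j))) :=
    fun x => by
      rw [← Finset.sum_coe_sort s, ← e.sum_comp]
      refine Finset.sum_congr rfl fun i _ => ?_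
      rw [tensorPower_add_sub, one_mul, mul_assoc]
  simpa only [hsum] using h α hα ζ
end
end

section
/- For every ψ ∈ 𝔥(T(ℝⁿ)) — i.e., ψ is entire and for every k > 0 and N ∈ ℕ, sup_{|Im z|≤k} (1+|z|)^N |ψ(z)| < ∞ — the function f(ξ) = (2π)^{−n} ∫_{ℝⁿ} ψ(x) e^{i⟨ξ,x⟩} dx belongs to H(ℝⁿ;ℝⁿ): f is smooth and for every k > 0 and every multi-index α, sup_{ξ∈ℝⁿ} e^{k|ξ|₁} |D^α f(ξ)| < ∞. Moreover ℱ applied to f recovers ψ on the reals: ∫_{ℝⁿ} f(ξ) e^{−i⟨ξ,x⟩} dξ = ψ(x) for all x ∈ ℝⁿ. -/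
open MeasureTheory Complex Filter Topology

noncomputable section

/-- The vector of imaginary parts of `z ∈ ℂⁿ`. -/
def imv {n : ℕ} (z : Fin n → ℂ) : Fin n → ℝ := fun i => (z i).im

/-- Euclidean norm `|z|` on `ℂⁿ`. -/
def cnorm {n : ℕ} (z : Fin n → ℂ) : ℝ := Real.sqrt (∑ i, ‖z i‖ ^ 2)

/-- Membership in `𝔥(T(ℝⁿ))`: entire and rapidly decreasing in every horizontal strip. -/
def memFrakRn {n : ℕ} (ψ : (Fin n → ℂ) → ℂ) : Prop :=
  Differentiable ℂ ψ ∧ ∀ k : ℝ, 0 < k → ∀ N : ℕ, ∃ M : ℝ,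
    ∀ z : Fin n → ℂ, (∀ i, |(z i).im| ≤ k) → (1 + cnorm z) ^ N * ‖ψ z‖ ≤ M

/-- Entire functions on `ℂⁿ` rapidly decreasing in every horizontal strip, measured in the
sup norm. -/
def StripDecay {n : ℕ} (ψ : (Fin n → ℂ) → ℂ) : Prop :=
  Differentiable ℂ ψ ∧ ∀ k : ℝ, 0 < k → ∀ N : ℕ, ∃ M : ℝ,
    ∀ z : Fin n → ℂ, (∀ i, |(z i).im| ≤ k) → (1 + ‖z‖) ^ N * ‖ψ z‖ ≤ M

/-- The unnormalised inverse Fourier transform `ξ ↦ ∫ ψ(x) e^{i⟨ξ,x⟩} dx`. -/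
def realFT {n : ℕ} (ψ : (Fin n → ℂ) → ℂ) (ξ : Fin n → ℝ) : ℂ :=
  ∫ x : Fin n → ℝ,
    ψ (fun i => (x i : ℂ)) * Complex.exp (Complex.I * ∑ i, (ξ i : ℂ) * (x i : ℂ))

lemma norm_le_cnorm {n : ℕ} (z : Fin n → ℂ) : ‖z‖ ≤ cnorm z := by
  refine (pi_norm_le_iff_of_nonneg (Real.sqrt_nonneg _)).2 fun i => ?_
  refine Real.le_sqrt_of_sq_le ?_
  exact Finset.single_le_sum (f := fun i => ‖z i‖ ^ 2) (fun _ _ => by positivity)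
    (Finset.mem_univ i)

lemma norm_ofReal_pi {n : ℕ} (x : Fin n → ℝ) : ‖(fun i => (x i : ℂ))‖ = ‖x‖ := by
  simp [Pi.norm_def]

lemma memFrakRn.stripDecay {n : ℕ} {ψ : (Fin n → ℂ) → ℂ} (h : memFrakRn ψ) : StripDecay ψ := by
  refine ⟨h.1, fun k hk N => ?_⟩
  obtain ⟨M, hM⟩ := h.2 k hk N
  refine ⟨M, fun z hz => le_trans ?_ (hM z hz)⟩
  have := norm_le_cnorm z
  gcongr

namespace StripDecay

variable {n : ℕ} {ψ : (Fin n → ℂ) → ℂ}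

lemma mul_of_bound (h : StripDecay ψ) {g : (Fin n → ℂ) → ℂ} (hg : Differentiable ℂ g)
    (hb : ∀ k : ℝ, 0 < k → ∃ (C : ℝ) (m : ℕ), 0 ≤ C ∧
      ∀ z : Fin n → ℂ, (∀ i, |(z i).im| ≤ k) → ‖g z‖ ≤ C * (1 + ‖z‖) ^ m) :
    StripDecay (fun z => ψ z * g z) := by
  refine ⟨h.1.mul hg, fun k hk N => ?_⟩
  obtain ⟨C, m, hC, hCm⟩ := hb k hk
  obtain ⟨M, hM⟩ := h.2 k hk (N + m)
  refine ⟨C * M, fun z hz => ?_⟩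
  calc (1 + ‖z‖) ^ N * ‖ψ z * g z‖
      ≤ (1 + ‖z‖) ^ N * (‖ψ z‖ * (C * (1 + ‖z‖) ^ m)) := by
        rw [norm_mul]; gcongr; exact hCm z hz
    _ = C * ((1 + ‖z‖) ^ (N + m) * ‖ψ z‖) := by ring
    _ ≤ C * M := by gcongr; exact hM z hz

lemma mul_const (h : StripDecay ψ) (c : ℂ) : StripDecay (fun z => ψ z * c) :=
  h.mul_of_bound (differentiable_const c) fun _ _ => ⟨‖c‖, 0, norm_nonneg _, fun _ _ => by simp⟩

lemma mul_coord (h : StripDecay ψ) (i : Fin n) : StripDecay (fun z => ψ z * (I * z i)) := by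
  refine h.mul_of_bound (by fun_prop) fun _ _ => ⟨1, 1, zero_le_one, fun z _ => ?_⟩
  have := norm_le_pi_norm z i
  simp only [norm_mul, norm_I]
  linarith

lemma norm_exp_dot (ξ : Fin n → ℝ) (z : Fin n → ℂ) :
    ‖Complex.exp (I * ∑ i, (ξ i : ℂ) * z i)‖ = Real.exp (-∑ i, ξ i * (z i).im) := by
  rw [Complex.norm_exp]
  simp

lemma mul_exp (h : StripDecay ψ) (ξ : Fin n → ℝ) :
    StripDecay (fun z => ψ z * Complex.exp (I * ∑ i, (ξ i : ℂ) * z i)) := by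
  refine h.mul_of_bound (by fun_prop) fun k hk =>
    ⟨Real.exp (∑ i, |ξ i| * k), 0, (Real.exp_pos _).le, fun z hz => ?_⟩
  rw [norm_exp_dot, pow_zero, mul_one, Real.exp_le_exp, ← Finset.sum_neg_distrib]
  refine Finset.sum_le_sum fun i _ => (neg_le_abs _).trans ?_
  rw [abs_mul]
  exact mul_le_mul_of_nonneg_left (hz i) (abs_nonneg _)

lemma exists_bound (h : StripDecay ψ) (R : ℝ) (N : ℕ) : ∃ C : ℝ, 0 ≤ C ∧
    ∀ (x : Fin n → ℝ) (y : Fin n → ℂ), ‖y‖ ≤ R →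
      ‖ψ (fun i => (x i : ℂ) + y i)‖ ≤ C * ((1 + ‖x‖) ^ N)⁻¹ := by
  obtain ⟨M, hM⟩ := h.2 (|R| + 1) (by positivity) N
  refine ⟨(1 + |R|) ^ N * |M|, by positivity, fun x y hy => ?_⟩
  have hyR : ‖y‖ ≤ |R| := hy.trans (le_abs_self R)
  rw [← div_eq_mul_inv, le_div_iff₀ (by positivity)]
  set z : Fin n → ℂ := fun i => (x i : ℂ) + y i with hz
  have hzM : (1 + ‖z‖) ^ N * ‖ψ z‖ ≤ M := by
    refine hM z fun i => ?_
    have h1 : (z i).im = (y i).im := by simp [hz]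
    rw [h1]
    linarith [abs_im_le_norm (y i), norm_le_pi_norm y i]
  have hx : ‖x‖ ≤ ‖z‖ + ‖y‖ := by
    rw [← norm_ofReal_pi x]
    have : (fun i => (x i : ℂ)) = z - y := by ext i; simp [hz]
    rw [this]
    exact norm_sub_le _ _
  have hx' : 1 + ‖x‖ ≤ (1 + |R|) * (1 + ‖z‖) := by
    nlinarith [norm_nonneg z, abs_nonneg R]
  calc ‖ψ z‖ * (1 + ‖x‖) ^ N ≤ ‖ψ z‖ * ((1 + |R|) * (1 + ‖z‖)) ^ N := by gcongr
    _ = (1 + |R|) ^ N * ((1 + ‖z‖) ^ N * ‖ψ z‖) := by rw [mul_pow]; ring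
    _ ≤ (1 + |R|) ^ N * |M| := by gcongr; exact hzM.trans (le_abs_self M)

lemma integrable_weight : Integrable (fun x : Fin n → ℝ => ((1 + ‖x‖) ^ (n + 1))⁻¹) := by
  have h := integrable_one_add_norm (E := Fin n → ℝ) (μ := volume) (r := ((n + 1 : ℕ) : ℝ))
    (by simp)
  refine h.congr (.of_forall fun x => ?_)
  simp only
  rw [Real.rpow_neg (by positivity), Real.rpow_natCast]

lemma continuous_add (h : StripDecay ψ) (y : Fin n → ℂ) :
    Continuous (fun x : Fin n → ℝ => ψ (fun i => (x i : ℂ) + y i)) :=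
  h.1.continuous.comp (by fun_prop)

lemma continuous_real (h : StripDecay ψ) :
    Continuous (fun x : Fin n → ℝ => ψ (fun i => (x i : ℂ))) :=
  h.1.continuous.comp (by fun_prop)

lemma integrable_add (h : StripDecay ψ) (y : Fin n → ℂ) :
    Integrable (fun x : Fin n → ℝ => ψ (fun i => (x i : ℂ) + y i)) := by
  obtain ⟨C, -, hC⟩ := h.exists_bound ‖y‖ (n + 1)
  exact (integrable_weight.const_mul C).mono' (h.continuous_add y).aestronglyMeasurable
    (.of_forall fun x => hC x y le_rfl)

lemma integrable_real (h : StripDecay ψ) :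
    Integrable (fun x : Fin n → ℝ => ψ (fun i => (x i : ℂ))) := by
  simpa using h.integrable_add 0

lemma integrable_norm_pow_mul (h : StripDecay ψ) (m : ℕ) :
    Integrable (fun x : Fin n → ℝ => ‖x‖ ^ m * ‖ψ (fun i => (x i : ℂ))‖) := by
  obtain ⟨C, hC0, hC⟩ := h.exists_bound 0 (n + 1 + m)
  refine (integrable_weight.const_mul C).mono'
    ((continuous_norm.pow m).mul h.continuous_real.norm).aestronglyMeasurable
    (.of_forall fun x => ?_)
  have hx := hC x 0 (by simp)
  simp only [Pi.zero_apply, add_zero] at hx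
  rw [Real.norm_of_nonneg (by positivity)]
  calc ‖x‖ ^ m * ‖ψ (fun i => (x i : ℂ))‖
      ≤ (1 + ‖x‖) ^ m * (C * ((1 + ‖x‖) ^ (n + 1 + m))⁻¹) := by
        gcongr
        linarith
    _ = C * ((1 + ‖x‖) ^ (n + 1))⁻¹ := by
        have : 1 + ‖x‖ ≠ 0 := by positivity
        rw [pow_add _ (n + 1) m]
        field_simp

/-- The integral along the complex line through the direction `η` is complex differentiable. -/
lemma differentiable_integral_line (h : StripDecay ψ) (η : Fin n → ℝ) :
    Differentiable ℂ (fun w : ℂ => ∫ x : Fin n → ℝ, ψ (fun i => (x i : ℂ) + w * η i)) := by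
  intro w₀
  obtain ⟨C, -, hC⟩ := h.exists_bound ((‖w₀‖ + 2) * ‖η‖) (n + 1)
  have hdiff (x : Fin n → ℝ) : Differentiable ℂ (fun w : ℂ => ψ (fun i => (x i : ℂ) + w * η i)) :=
    h.1.comp (by fun_prop)
  have hbound (x : Fin n → ℝ) (w : ℂ) (hw : w ∈ Metric.ball w₀ 1) :
      ‖deriv (fun w : ℂ => ψ (fun i => (x i : ℂ) + w * η i)) w‖
        ≤ C * ((1 + ‖x‖) ^ (n + 1))⁻¹ := by
    have := norm_deriv_le_of_forall_mem_sphere_norm_le (c := w) zero_lt_one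
      (hdiff x).diffContOnCl (C := C * ((1 + ‖x‖) ^ (n + 1))⁻¹) fun w' hw' => by
        refine hC x (fun i => w' * η i) ?_
        have h1 : (fun i => w' * (η i : ℂ)) = w' • (fun i => (η i : ℂ)) := rfl
        rw [h1, norm_smul, norm_ofReal_pi]
        gcongr
        rw [mem_sphere_iff_norm] at hw'
        rw [mem_ball_iff_norm] at hw
        have h2 : w' = (w' - w) + (w - w₀) + w₀ := by ring
        rw [h2]
        refine norm_add₃_le.trans ?_
        linarith
    simpa using this
  have hmeas : Measurable (fun x : Fin n → ℝ =>
      deriv (fun w : ℂ => ψ (fun i => (x i : ℂ) + w * η i)) w₀) := by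
    have hc : Continuous (Function.uncurry
        (fun (x : Fin n → ℝ) (w : ℂ) => ψ (fun i => (x i : ℂ) + w * η i))) :=
      h.1.continuous.comp (by fun_prop)
    exact (measurable_deriv_with_param hc).comp (measurable_id.prodMk measurable_const)
  refine (hasDerivAt_integral_of_dominated_loc_of_deriv_le (Metric.ball_mem_nhds w₀ one_pos)
    (.of_forall fun w => (h.continuous_add fun i => w * η i).aestronglyMeasurable)
    (h.integrable_add fun i => w₀ * η i)
    (F' := fun w x => deriv (fun w : ℂ => ψ (fun i => (x i : ℂ) + w * η i)) w)
    hmeas.aestronglyMeasurable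
    (.of_forall hbound) (integrable_weight.const_mul C)
    (.of_forall fun x w _ => (hdiff x w).hasDerivAt)).2.differentiableAt

/-- Shift of the contour of integration. -/
lemma integral_add_eq (h : StripDecay ψ) (η : Fin n → ℝ) (w : ℂ) :
    ∫ x : Fin n → ℝ, ψ (fun i => (x i : ℂ) + w * η i) =
      ∫ x : Fin n → ℝ, ψ (fun i => (x i : ℂ)) := by
  have hd := h.differentiable_integral_line η
  set H : ℂ → ℂ := fun w => ∫ x : Fin n → ℝ, ψ (fun i => (x i : ℂ) + w * η i) with hH
  have hper (w : ℂ) (s : ℝ) : H (w + s) = H w := by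
    simp only [hH]
    rw [← integral_add_right_eq_self (fun x : Fin n → ℝ => ψ (fun i => (x i : ℂ) + w * η i)) (s • η)]
    congr 1
    ext x
    congr 1
    ext i
    simp only [Pi.add_apply, Pi.smul_apply, smul_eq_mul]
    push_cast
    ring
  have hderiv (w : ℂ) : deriv H w = 0 := by
    have h1 : HasDerivAt (fun u : ℂ => H (w + u)) (deriv H w) ((0 : ℝ) : ℂ) :=
      HasDerivAt.comp_const_add w _ (by simpa using (hd w).hasDerivAt)
    have h2 := h1.comp_ofReal
    simp only [hper] at h2
    exact h2.unique (hasDerivAt_const _ _)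
  have := is_const_of_deriv_eq_zero hd hderiv w 0
  simpa [hH] using this

/-- Exponential decay of the Fourier transform. -/
lemma exp_mul_norm_realFT_le (h : StripDecay ψ) {k : ℝ} (hk : 0 < k) : ∃ M : ℝ,
    ∀ ξ : Fin n → ℝ, Real.exp (k * n1 ξ) * ‖realFT ψ ξ‖ ≤ M := by
  obtain ⟨C, -, hC⟩ := h.exists_bound k (n + 1)
  refine ⟨∫ x : Fin n → ℝ, C * ((1 + ‖x‖) ^ (n + 1))⁻¹, fun ξ => ?_⟩
  set η : Fin n → ℝ := fun i => k * SignType.sign (ξ i) with hη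
  have hηk : ‖fun i => I * (η i : ℂ)‖ ≤ k := by
    refine (pi_norm_le_iff_of_nonneg hk.le).2 fun i => ?_
    rcases lt_trichotomy (ξ i) 0 with hi | hi | hi <;> simp [hη, hi, abs_of_pos hk, hk.le]
  have hexp : ∑ i, ξ i * η i = k * n1 ξ := by
    rw [n1, Finset.mul_sum]
    refine Finset.sum_congr rfl fun i _ => ?_
    rw [hη, ← self_mul_sign]
    ring
  rw [realFT, ← (h.mul_exp ξ).integral_add_eq η I, ← Real.norm_of_nonneg (Real.exp_pos _).le,
    ← Complex.norm_real, ← norm_mul, ← integral_const_mul]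
  refine norm_integral_le_of_norm_le (integrable_weight.const_mul C) (.of_forall fun x => ?_)
  rw [norm_mul, norm_mul, norm_exp_dot, Complex.norm_real, Real.norm_of_nonneg (Real.exp_pos _).le]
  have : ∑ i, ξ i * ((x i : ℂ) + I * (η i : ℂ)).im = k * n1 ξ := by
    rw [← hexp]; simp
  rw [this, mul_left_comm, ← Real.exp_add, add_neg_cancel, Real.exp_zero, mul_one]
  exact hC x _ hηk

/-- The pairing for which the Fourier transform in the sense of Mathlib is `realFT`. -/
def pairing (n : ℕ) : (Fin n → ℝ) →L[ℝ] (Fin n → ℝ) →L[ℝ] ℝ :=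
  (-(2 * Real.pi)⁻¹) • ∑ i, (ContinuousLinearMap.proj (R := ℝ) (φ := fun _ : Fin n => ℝ) i).smulRight
    (ContinuousLinearMap.proj (R := ℝ) (φ := fun _ : Fin n => ℝ) i)

lemma pairing_apply (x ξ : Fin n → ℝ) :
    pairing n x ξ = -(2 * Real.pi)⁻¹ * ∑ i, ξ i * x i := by
  simp [pairing, mul_comm]

lemma fourierChar_pairing (x ξ : Fin n → ℝ) :
    (Real.fourierChar (-pairing n x ξ) : ℂ) = Complex.exp (I * ∑ i, (ξ i : ℂ) * (x i : ℂ)) := by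
  rw [Real.fourierChar_apply, pairing_apply]
  congr 1
  push_cast
  have : (Real.pi : ℂ) ≠ 0 := by exact_mod_cast Real.pi_ne_zero
  field_simp

lemma realFT_eq (ψ : (Fin n → ℂ) → ℂ) : realFT ψ =
    VectorFourier.fourierIntegral Real.fourierChar volume (pairing n).toLinearMap₁₂
      (fun x : Fin n → ℝ => ψ (fun i => (x i : ℂ))) := by
  ext ξ
  simp only [realFT, VectorFourier.fourierIntegral]
  congr 1
  ext x
  rw [Circle.smul_def, smul_eq_mul, mul_comm]
  congr 1
  exact (fourierChar_pairing x ξ).symm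

lemma contDiff_realFT (h : StripDecay ψ) : ContDiff ℝ (⊤ : ℕ∞) (realFT ψ) := by
  rw [realFT_eq]
  exact VectorFourier.contDiff_fourierIntegral _ fun m _ => h.integrable_norm_pow_mul m

lemma pd_realFT (h : StripDecay ψ) (i : Fin n) :
    pd i (realFT ψ) = realFT (fun z => ψ z * (I * z i)) := by
  ext ξ
  have hint : Integrable (fun x : Fin n → ℝ => ‖x‖ * ‖ψ (fun i => (x i : ℂ))‖) := by
    simpa using h.integrable_norm_pow_mul 1
  have hd := VectorFourier.hasFDerivAt_fourierIntegral (pairing n) h.integrable_real hint ξ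
  have hs : Integrable (VectorFourier.fourierSMulRight (pairing n)
      (fun x : Fin n → ℝ => ψ (fun i => (x i : ℂ)))) := by
    refine (hint.const_mul (2 * Real.pi * ‖pairing n‖)).mono'
      h.continuous_real.aestronglyMeasurable.fourierSMulRight (.of_forall fun x => ?_)
    exact (VectorFourier.norm_fourierSMulRight_le _ _ _).trans_eq (by ring)
  rw [pd, realFT_eq, hd.fderiv, VectorFourier.fourierIntegral, ContinuousLinearMap.integral_apply]
  · rw [realFT]
    congr 1
    ext x
    change (Real.fourierChar (-pairing n x ξ) : ℂ) • VectorFourier.fourierSMulRight (pairing n)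
      (fun x : Fin n → ℝ => ψ (fun i => (x i : ℂ))) x (Pi.single i 1) = _
    rw [VectorFourier.fourierSMulRight_apply, fourierChar_pairing, pairing_apply]
    have : (Real.pi : ℂ) ≠ 0 := by exact_mod_cast Real.pi_ne_zero
    simp [Pi.single_apply]
    field_simp
  · exact (VectorFourier.fourierIntegral_convergent_iff Real.continuous_fourierChar
      (pairing n).continuous₂ ξ).2 hs

lemma Dm_realFT (h : StripDecay ψ) (α : Fin n → ℕ) :
    ∃ φ : (Fin n → ℂ) → ℂ, StripDecay φ ∧ Dm α (realFT ψ) = realFT φ := by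
  have hiter (i : Fin n) (m : ℕ) : ∀ φ : (Fin n → ℂ) → ℂ, StripDecay φ →
      ∃ φ', StripDecay φ' ∧ (pd i)^[m] (realFT φ) = realFT φ' := by
    induction m with
    | zero => exact fun φ hφ => ⟨φ, hφ, rfl⟩
    | succ m ih =>
      intro φ hφ
      rw [Function.iterate_succ_apply, hφ.pd_realFT i]
      exact ih _ (hφ.mul_coord i)
  rw [Dm]
  induction List.finRange n with
  | nil => exact ⟨ψ, h, rfl⟩
  | cons i l ih =>
    obtain ⟨φ, hφ, he⟩ := ih
    rw [List.foldr_cons, he]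
    exact hiter i _ φ hφ

lemma norm_le_n1 (ξ : Fin n → ℝ) : ‖ξ‖ ≤ n1 ξ := by
  refine (pi_norm_le_iff_of_nonneg (Finset.sum_nonneg fun _ _ => abs_nonneg _)).2 fun i => ?_
  exact Finset.single_le_sum (f := fun i => |ξ i|) (fun _ _ => abs_nonneg _) (Finset.mem_univ i)

lemma integrable_realFT (h : StripDecay ψ) : Integrable (realFT ψ) := by
  obtain ⟨M, hM⟩ := h.exp_mul_norm_realFT_le one_pos
  refine (integrable_weight.const_mul (Real.exp 1 * (n + 1).factorial * M)).mono'
    h.contDiff_realFT.continuous.aestronglyMeasurable (.of_forall fun ξ => ?_)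
  rw [← div_eq_mul_inv, le_div_iff₀ (by positivity)]
  have h1 := Real.pow_div_factorial_le_exp (1 + ‖ξ‖) (by positivity) (n + 1)
  rw [div_le_iff₀ (by positivity), Real.exp_add] at h1
  have h2 : Real.exp ‖ξ‖ ≤ Real.exp (1 * n1 ξ) := by
    rw [one_mul]; exact Real.exp_le_exp.2 (norm_le_n1 ξ)
  calc ‖realFT ψ ξ‖ * (1 + ‖ξ‖) ^ (n + 1)
      ≤ ‖realFT ψ ξ‖ * (Real.exp 1 * Real.exp (1 * n1 ξ) * (n + 1).factorial) := by
        gcongr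
        exact h1.trans (by gcongr)
    _ = Real.exp 1 * (n + 1).factorial * (Real.exp (1 * n1 ξ) * ‖realFT ψ ξ‖) := by ring
    _ ≤ _ := by gcongr; exact hM ξ

/-- Fourier inversion. -/
lemma integral_realFT_mul_exp (h : StripDecay ψ) (x : Fin n → ℝ) :
    ∫ ξ : Fin n → ℝ, realFT ψ ξ * Complex.exp (-I * ∑ i, (ξ i : ℂ) * (x i : ℂ)) =
      (((2 * Real.pi) ^ n : ℝ) : ℂ) * ψ (fun i => (x i : ℂ)) := by
  have hmp := PiLp.volume_preserving_ofLp (Fin n)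
  have hme : MeasurableEmbedding (WithLp.ofLp : EuclideanSpace ℝ (Fin n) → Fin n → ℝ) :=
    (MeasurableEquiv.toLp 2 (Fin n → ℝ)).symm.measurableEmbedding
  set g : EuclideanSpace ℝ (Fin n) → ℂ := fun v => ψ (fun i => (v i : ℂ)) with hg
  have hpi : (0 : ℝ) < 2 * Real.pi := by positivity
  have hgi : Integrable g := (hmp.integrable_comp_emb hme).2 h.integrable_real
  have hgc : Continuous g := h.1.continuous.comp (by fun_prop)
  have hinv (w : EuclideanSpace ℝ (Fin n)) :
      FourierTransformInv.fourierInv g w = realFT ψ ((2 * Real.pi) • w.ofLp) := by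
    rw [Real.fourierInv_eq', realFT, ← hmp.integral_comp hme]
    congr 1
    ext v
    rw [smul_eq_mul, mul_comm]
    congr 2
    simp only [PiLp.inner_apply, RCLike.inner_apply, conj_trivial, Pi.smul_apply, smul_eq_mul]
    push_cast
    simp only [Finset.mul_sum, Finset.sum_mul]
    exact Finset.sum_congr rfl fun i _ => by ring
  have hfi : Integrable (FourierTransform.fourier g) := by
    have : FourierTransform.fourier g =
        (fun ξ : Fin n → ℝ => realFT ψ ((-(2 * Real.pi)) • ξ)) ∘ WithLp.ofLp := by
      ext w
      rw [← neg_neg w, ← Real.fourierInv_eq_fourier_neg, hinv]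
      simp
    rw [this, hmp.integrable_comp_emb hme]
    exact h.integrable_realFT.comp_smul (neg_ne_zero.2 hpi.ne')
  have hkey := congrFun (hgc.fourier_fourierInv_eq hgi hfi) (WithLp.toLp 2 x)
  rw [Real.fourier_eq'] at hkey
  have hscale := Measure.integral_comp_smul volume
    (fun ξ : Fin n → ℝ => realFT ψ ξ * Complex.exp (-I * ∑ i, (ξ i : ℂ) * (x i : ℂ)))
    (2 * Real.pi)
  rw [← hmp.integral_comp hme] at hscale
  have hl : ψ (fun i => (x i : ℂ)) = |((2 * Real.pi) ^ Module.finrank ℝ (Fin n → ℝ))⁻¹| •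
      ∫ ξ : Fin n → ℝ, realFT ψ ξ * Complex.exp (-I * ∑ i, (ξ i : ℂ) * (x i : ℂ)) := by
    rw [← hscale]
    refine Eq.trans hkey.symm ?_
    congr 1
    ext w
    rw [hinv, smul_eq_mul, mul_comm]
    congr 2
    simp only [PiLp.inner_apply, RCLike.inner_apply, conj_trivial, Pi.smul_apply, smul_eq_mul]
    push_cast
    simp only [Finset.mul_sum, Finset.sum_mul]
    exact Finset.sum_congr rfl fun i _ => by ring
  rw [hl, abs_of_pos (by positivity), Module.finrank_fin_fun, Complex.real_smul, ← mul_assoc,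
    ← Complex.ofReal_mul, mul_inv_cancel₀ (by positivity), Complex.ofReal_one, one_mul]

end StripDecay

lemma realFT_mul_const {n : ℕ} (ψ : (Fin n → ℂ) → ℂ) (c : ℂ) :
    realFT (fun z => ψ z * c) = fun ξ => c * realFT ψ ξ := by
  ext ξ
  rw [realFT, realFT, ← integral_const_mul]
  congr 1
  ext x
  ring

/-- For `ψ ∈ 𝔥(T(ℝⁿ))` the inverse Fourier transform
`f(ξ) = (2π)^{−n} ∫ ψ(x) e^{i⟨ξ,x⟩} dx` belongs to `H(ℝⁿ;ℝⁿ)`, and `ℱ` applied to `f`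
recovers `ψ` on the reals. -/
theorem stmt_6 {n : ℕ} (ψ : (Fin n → ℂ) → ℂ) (hψ : memFrakRn ψ) :
    (∀ ξ : Fin n → ℝ,
      Integrable (fun x : Fin n → ℝ =>
        ψ (fun i => (x i : ℂ)) * Complex.exp (Complex.I * ∑ i, (ξ i : ℂ) * (x i : ℂ)))) ∧
    ContDiff ℝ (⊤ : ℕ∞) (fun ξ : Fin n → ℝ => (((2 * Real.pi) ^ n : ℝ) : ℂ)⁻¹ *
        ∫ x : Fin n → ℝ,
          ψ (fun i => (x i : ℂ)) * Complex.exp (Complex.I * ∑ i, (ξ i : ℂ) * (x i : ℂ))) ∧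
    (∀ k : ℝ, 0 < k → ∀ α : Fin n → ℕ, ∃ M : ℝ, ∀ ξ : Fin n → ℝ,
      Real.exp (k * n1 ξ) *
        ‖Dm α (fun ξ' : Fin n → ℝ => (((2 * Real.pi) ^ n : ℝ) : ℂ)⁻¹ *
          ∫ x : Fin n → ℝ,
            ψ (fun i => (x i : ℂ)) * Complex.exp (Complex.I * ∑ i, (ξ' i : ℂ) * (x i : ℂ))) ξ‖
        ≤ M) ∧
    (∀ x : Fin n → ℝ,
      Integrable (fun ξ : Fin n → ℝ => ((((2 * Real.pi) ^ n : ℝ) : ℂ)⁻¹ *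
          ∫ x' : Fin n → ℝ,
            ψ (fun i => (x' i : ℂ)) * Complex.exp (Complex.I * ∑ i, (ξ i : ℂ) * (x' i : ℂ))) *
          Complex.exp (-Complex.I * ∑ i, (ξ i : ℂ) * (x i : ℂ))) ∧
      (∫ ξ : Fin n → ℝ, ((((2 * Real.pi) ^ n : ℝ) : ℂ)⁻¹ *
          ∫ x' : Fin n → ℝ,
            ψ (fun i => (x' i : ℂ)) * Complex.exp (Complex.I * ∑ i, (ξ i : ℂ) * (x' i : ℂ))) *
          Complex.exp (-Complex.I * ∑ i, (ξ i : ℂ) * (x i : ℂ)))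
        = ψ (fun i => (x i : ℂ))) := by
  have h := hψ.stripDecay
  have hc := h.mul_const (((2 * Real.pi) ^ n : ℝ) : ℂ)⁻¹
  have he := realFT_mul_const ψ (((2 * Real.pi) ^ n : ℝ) : ℂ)⁻¹
  change _ ∧ ContDiff ℝ (⊤ : ℕ∞) (fun ξ => (((2 * Real.pi) ^ n : ℝ) : ℂ)⁻¹ * realFT ψ ξ) ∧
    (∀ k : ℝ, 0 < k → ∀ α : Fin n → ℕ, ∃ M : ℝ, ∀ ξ : Fin n → ℝ, Real.exp (k * n1 ξ) *
      ‖Dm α (fun ξ => (((2 * Real.pi) ^ n : ℝ) : ℂ)⁻¹ * realFT ψ ξ) ξ‖ ≤ M) ∧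
    (∀ x : Fin n → ℝ, Integrable (fun ξ => (fun ξ => (((2 * Real.pi) ^ n : ℝ) : ℂ)⁻¹ *
        realFT ψ ξ) ξ * Complex.exp (-I * ∑ i, (ξ i : ℂ) * (x i : ℂ))) ∧
      (∫ ξ, (fun ξ => (((2 * Real.pi) ^ n : ℝ) : ℂ)⁻¹ * realFT ψ ξ) ξ *
        Complex.exp (-I * ∑ i, (ξ i : ℂ) * (x i : ℂ))) = ψ (fun i => (x i : ℂ)))
  rw [← he]
  refine ⟨fun ξ => (h.mul_exp ξ).integrable_real, hc.contDiff_realFT, fun k hk α => ?_,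
    fun x => ⟨?_, ?_⟩⟩
  · obtain ⟨φ, hφ, hD⟩ := hc.Dm_realFT α
    rw [hD]
    exact hφ.exp_mul_norm_realFT_le hk
  · refine hc.integrable_realFT.mul_bdd (c := 1)
      (Continuous.aestronglyMeasurable (by fun_prop)) (.of_forall fun ξ => ?_)
    rw [Complex.norm_exp]
    simp
  · rw [hc.integral_realFT_mul_exp x, mul_comm (ψ _), ← mul_assoc,
      mul_inv_cancel₀ (by norm_cast; positivity), one_mul]
end
end

section
/- Kernel theorem for tempered ultrahyperfunctions: let M : (𝔥(T(ℝ⁴)))ᵐ → ℂ be multilinear and separately continuous, i.e., for each j and fixed f₁,…,f_{j−1},f_{j+1},…,f_m, the map f_j ↦ M(f₁,…,f_m) is bounded by a constant times finitely many seminorms ‖f_j‖_{K,N} = sup_{z∈ℝ⁴+iK}(1+|z|)^N|f_j(z)| (K ⊂ ℝ⁴ compact convex, N ∈ ℕ). Then there exists a unique continuous linear functional F on 𝔥(T(ℝ^{4m})) — continuity meaning |F(φ)| ≤ C‖φ‖_{K,N} for some compact convex K ⊂ ℝ^{4m}, N ∈ ℕ, C > 0 — such that F(f₁ ⊗ ⋯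 ⊗ f_m) = M(f₁,…,f_m) for all f₁,…,f_m ∈ 𝔥(T(ℝ⁴)), where (f₁ ⊗ ⋯ ⊗ f_m)(z₁,…,z_m) = f₁(z₁)⋯f_m(z_m). -/
open MeasureTheory Complex Filter Topology

noncomputable section

/-- Euclidean norm `|z|` on `ℂ^ι`. -/
def cnormI {ι : Type*} [Fintype ι] (z : ι → ℂ) : ℝ := Real.sqrt (∑ i, ‖z i‖ ^ 2)

/-- The vector of imaginary parts of `z ∈ ℂ^ι`. -/
def imvI {ι : Type*} (z : ι → ℂ) : ι → ℝ := fun i => (z i).im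

/-- Membership in `𝔥(T(ℝ^ι))`: entire and rapidly decreasing in every horizontal strip. -/
def memFrakI {ι : Type*} [Fintype ι] (ψ : (ι → ℂ) → ℂ) : Prop :=
  Differentiable ℂ ψ ∧ ∀ k : ℝ, 0 < k → ∀ N : ℕ, ∃ M : ℝ,
    ∀ z : ι → ℂ, (∀ i, |(z i).im| ≤ k) → (1 + cnormI z) ^ N * ‖ψ z‖ ≤ M

/-- Continuity of a linear functional on `𝔥(T(ℝ^ι))` with respect to the seminorms
`‖φ‖_{K,N} = sup_{Im z ∈ K} (1+|z|)^N |φ(z)|`, `K` compact convex, `N ∈ ℕ`. -/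
def contLinI {ι : Type*} [Fintype ι] (F : ((ι → ℂ) → ℂ) → ℂ) : Prop :=
  ∃ K : Set (ι → ℝ), IsCompact K ∧ Convex ℝ K ∧ ∃ (N : ℕ) (C : ℝ), 0 < C ∧
    ∀ ψ, memFrakI ψ → ∀ B : ℝ,
      (∀ z : ι → ℂ, imvI z ∈ K → (1 + cnormI z) ^ N * ‖ψ z‖ ≤ B) → ‖F ψ‖ ≤ C * B

/-- `F` is a continuous linear extension of the multilinear functional `M` to
`𝔥(T(ℝ^{4m}))`, agreeing with `M` on tensor products. -/
def IsKernelExtension {m : ℕ} (M : (Fin m → ((Fin 4 → ℂ) → ℂ)) → ℂ)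
    (F : ((Fin m × Fin 4 → ℂ) → ℂ) → ℂ) : Prop :=
  (∀ φ ψ, memFrakI φ → memFrakI ψ → F (φ + ψ) = F φ + F ψ) ∧
  (∀ (c : ℂ) (φ), memFrakI φ → F (c • φ) = c * F φ) ∧
  contLinI F ∧
  ∀ f : Fin m → ((Fin 4 → ℂ) → ℂ), (∀ i, memFrakI (f i)) →
    F (fun z => ∏ j, f j (fun i => z (j, i))) = M f

section Basics

variable {ι : Type*}

/-- The closed horizontal strip of half-width `k` in `ℂ^ι`. -/
def hstrip (ι : Type*) (k : ℕ) : Set (ι → ℂ) := {z | ∀ i, |(z i).im| ≤ k}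

lemma hstrip_mono {k n : ℕ} (h : k ≤ n) : hstrip ι k ⊆ hstrip ι n := fun _ hz i =>
  (hz i).trans (by exact_mod_cast h)

lemma isClosed_hstrip (k : ℕ) : IsClosed (hstrip ι k) := by
  simp only [hstrip, Set.ofPred_forall]
  exact isClosed_iInter fun i => isClosed_le (by fun_prop) continuous_const

lemma zero_mem_hstrip (k : ℕ) : (0 : ι → ℂ) ∈ hstrip ι k := fun i => by simp

variable [Fintype ι]

lemma add_mem_hstrip {k n : ℕ} {z u : ι → ℂ} (hz : z ∈ hstrip ι k) (hu : ‖u‖ ≤ n) :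
    z + u ∈ hstrip ι (k + n) := fun i => by
  have h1 := hz i
  have h2 : |(u i).im| ≤ n := (Complex.abs_im_le_norm _).trans ((norm_le_pi_norm u i).trans hu)
  simp only [Pi.add_apply, Complex.add_im]
  push_cast
  exact (abs_add_le _ _).trans (add_le_add h1 h2)

lemma norm_le_cnormI (z : ι → ℂ) : ‖z‖ ≤ cnormI z := by
  refine (pi_norm_le_iff_of_nonneg (Real.sqrt_nonneg _)).2 fun i => ?_
  refine Real.le_sqrt_of_sq_le ?_
  exact Finset.single_le_sum (f := fun i => ‖z i‖ ^ 2) (fun _ _ => sq_nonneg _) (Finset.mem_univ i)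

lemma one_add_cnormI_le (z : ι → ℂ) : 1 + cnormI z ≤ (Fintype.card ι + 1) * (1 + ‖z‖) := by
  have h : cnormI z ≤ Fintype.card ι * ‖z‖ := by
    refine Real.sqrt_le_iff.2 ⟨by positivity, ?_⟩
    have h1 : ∑ i, ‖z i‖ ^ 2 ≤ ∑ _i : ι, ‖z‖ ^ 2 :=
      Finset.sum_le_sum fun i _ => by gcongr; exact norm_le_pi_norm z i
    refine h1.trans ?_
    simp only [Finset.sum_const, Finset.card_univ, nsmul_eq_mul, mul_pow]
    gcongr
    exact_mod_cast Nat.le_self_pow two_ne_zero _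
  nlinarith [norm_nonneg z, (Nat.cast_nonneg (Fintype.card ι) : (0 : ℝ) ≤ _)]

lemma cnormI_nonneg (z : ι → ℂ) : 0 ≤ cnormI z := Real.sqrt_nonneg _

/-- `B` bounds the seminorm with strip `|Im z| ≤ k` and weight `(1 + ‖z‖) ^ k`. -/
def StripBound (k : ℕ) (φ : (ι → ℂ) → ℂ) (B : ℝ) : Prop :=
  ∀ z ∈ hstrip ι k, (1 + ‖z‖) ^ k * ‖φ z‖ ≤ B

lemma StripBound.nonneg {k : ℕ} {φ : (ι → ℂ) → ℂ} {B : ℝ} (h : StripBound k φ B) : 0 ≤ B :=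
  le_trans (by positivity) (h 0 (zero_mem_hstrip k))

lemma StripBound.mono {k n : ℕ} (hkn : k ≤ n) {φ : (ι → ℂ) → ℂ} {B B' : ℝ} (hB : B ≤ B')
    (h : StripBound n φ B) : StripBound k φ B' := fun z hz => by
  refine le_trans ?_ ((h z (hstrip_mono hkn hz)).trans hB)
  gcongr
  linarith [norm_nonneg z]

lemma StripBound.norm_le {k : ℕ} {φ : (ι → ℂ) → ℂ} {B : ℝ} (h : StripBound k φ B)
    {z : ι → ℂ} (hz : z ∈ hstrip ι k) : ‖φ z‖ ≤ B := by
  refine le_trans ?_ (h z hz)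
  exact le_mul_of_one_le_left (norm_nonneg _) (one_le_pow₀ (by linarith [norm_nonneg z]))

lemma StripBound.add {k : ℕ} {φ ψ : (ι → ℂ) → ℂ} {B B' : ℝ} (h : StripBound k φ B)
    (h' : StripBound k ψ B') : StripBound k (φ + ψ) (B + B') := fun z hz => by
  calc (1 + ‖z‖) ^ k * ‖φ z + ψ z‖ ≤ (1 + ‖z‖) ^ k * (‖φ z‖ + ‖ψ z‖) := by
        gcongr; exact norm_add_le _ _
    _ ≤ B + B' := by rw [mul_add]; exact add_le_add (h z hz) (h' z hz)

lemma StripBound.smul {k : ℕ} {φ : (ι → ℂ) → ℂ} {B : ℝ} (h : StripBound k φ B) (c : ℂ) :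
    StripBound k (c • φ) (‖c‖ * B) := fun z hz => by
  calc (1 + ‖z‖) ^ k * ‖c * φ z‖ = ‖c‖ * ((1 + ‖z‖) ^ k * ‖φ z‖) := by rw [norm_mul]; ring
    _ ≤ ‖c‖ * B := by gcongr; exact h z hz

lemma memFrakI_iff {φ : (ι → ℂ) → ℂ} :
    memFrakI φ ↔ Differentiable ℂ φ ∧ ∀ k : ℕ, ∃ B, StripBound k φ B := by
  refine and_congr_right fun _ => ⟨fun h k => ?_, fun h k hk N => ?_⟩
  · obtain ⟨B, hB⟩ := h (k + 1) (by positivity) k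
    refine ⟨B, fun z hz => le_trans ?_ (hB z fun i => (hz i).trans (by linarith))⟩
    gcongr
    exact norm_le_cnormI z
  · obtain ⟨n, hn⟩ := exists_nat_ge k
    obtain ⟨B, hB⟩ := h (max n N)
    refine ⟨(Fintype.card ι + 1) ^ N * B, fun z hz => ?_⟩
    have hz' : z ∈ hstrip ι (max n N) := hstrip_mono (le_max_left _ _) fun i => (hz i).trans hn
    calc (1 + cnormI z) ^ N * ‖φ z‖ ≤ ((Fintype.card ι + 1) * (1 + ‖z‖)) ^ N * ‖φ z‖ := by
          gcongr
          · linarith [cnormI_nonneg z]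
          · exact one_add_cnormI_le z
      _ = (Fintype.card ι + 1) ^ N * ((1 + ‖z‖) ^ N * ‖φ z‖) := by rw [mul_pow]; ring
      _ ≤ (Fintype.card ι + 1) ^ N * B := by
          gcongr
          refine le_trans ?_ (hB z hz')
          gcongr
          · linarith [norm_nonneg z]
          · exact le_max_right _ _

/-- The space `𝔥(T(ℝ^ι))` as a submodule of the space of all functions. -/
def frakSubmodule (ι : Type*) [Fintype ι] : Submodule ℂ ((ι → ℂ) → ℂ) where
  carrier := {φ | memFrakI φ}
  zero_mem' := memFrakI_iff.2 ⟨differentiable_const 0, fun k => ⟨0, fun z _ => by simp⟩⟩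
  add_mem' := by
    intro φ ψ hφ hψ
    obtain ⟨h1, h2⟩ := memFrakI_iff.1 hφ
    obtain ⟨h3, h4⟩ := memFrakI_iff.1 hψ
    refine memFrakI_iff.2 ⟨h1.add h3, fun k => ?_⟩
    obtain ⟨B, hB⟩ := h2 k
    obtain ⟨B', hB'⟩ := h4 k
    exact ⟨_, hB.add hB'⟩
  smul_mem' := by
    intro c φ hφ
    obtain ⟨h1, h2⟩ := memFrakI_iff.1 hφ
    refine memFrakI_iff.2 ⟨h1.const_smul c, fun k => ?_⟩
    obtain ⟨B, hB⟩ := h2 k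
    exact ⟨_, hB.smul c⟩

lemma contLinI.exists_stripBound {F : ((ι → ℂ) → ℂ) → ℂ} (hF : contLinI F) :
    ∃ (n : ℕ) (C : ℝ), 0 ≤ C ∧
      ∀ φ, memFrakI φ → ∀ B, StripBound n φ B → ‖F φ‖ ≤ C * B := by
  obtain ⟨K, hK, -, N, C, hC, h⟩ := hF
  obtain ⟨R, hR⟩ := hK.isBounded.exists_norm_le
  obtain ⟨n, hn⟩ := exists_nat_ge R
  refine ⟨max n N, C * (Fintype.card ι + 1) ^ N, by positivity, fun φ hφ B hB => ?_⟩
  rw [mul_assoc]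
  refine h φ hφ _ fun z hz => ?_
  have hz' : z ∈ hstrip ι (max n N) := hstrip_mono (le_max_left _ _) fun i =>
    (norm_le_pi_norm (imvI z) i).trans ((hR _ hz).trans hn)
  calc (1 + cnormI z) ^ N * ‖φ z‖ ≤ ((Fintype.card ι + 1) * (1 + ‖z‖)) ^ N * ‖φ z‖ := by
        gcongr
        · linarith [cnormI_nonneg z]
        · exact one_add_cnormI_le z
    _ = (Fintype.card ι + 1) ^ N * ((1 + ‖z‖) ^ N * ‖φ z‖) := by rw [mul_pow]; ring
    _ ≤ (Fintype.card ι + 1) ^ N * B := by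
        gcongr
        refine le_trans ?_ (hB z hz')
        gcongr
        · linarith [norm_nonneg z]
        · exact le_max_right _ _

lemma contLinI_of_stripBound {F : ((ι → ℂ) → ℂ) → ℂ} {n : ℕ} {C : ℝ}
    (h : ∀ φ, memFrakI φ → ∀ B, StripBound n φ B → ‖F φ‖ ≤ C * B) : contLinI F := by
  refine ⟨Metric.closedBall 0 n, isCompact_closedBall _ _, convex_closedBall _ _, n, max C 1,
    by positivity, fun φ hφ B hB => ?_⟩
  have hS : StripBound n φ B := fun z hz => by
    refine le_trans ?_ (hB z ?_)
    · gcongr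
      exact norm_le_cnormI z
    · rw [mem_closedBall_zero_iff]
      exact (pi_norm_le_iff_of_nonneg (Nat.cast_nonneg n)).2 hz
  exact (h φ hφ B hS).trans (mul_le_mul_of_nonneg_right (le_max_left _ _) hS.nonneg)

end Basics

section JointContinuity

variable {ι : Type*}

/-- The open horizontal strip of half-width `k` in `ℂ^ι`. -/
def openStrip (ι : Type*) (k : ℕ) : Set (ι → ℂ) := Set.univ.pi fun _ => Complex.im ⁻¹' Metric.ball 0 k

lemma isPreconnected_openStrip (k : ℕ) : IsPreconnected (openStrip ι k) := by
  have : Convex ℝ (openStrip ι k) :=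
    convex_pi fun _ _ => (convex_ball (0 : ℝ) k).linear_preimage Complex.imLm
  exact this.isPreconnected

lemma mem_openStrip {k : ℕ} {z : ι → ℂ} : z ∈ openStrip ι k ↔ ∀ i, |(z i).im| < k := by
  simp [openStrip]

lemma openStrip_subset (k : ℕ) : openStrip ι k ⊆ hstrip ι k := fun _ hz i =>
  (mem_openStrip.1 hz i).le

lemma zero_mem_openStrip {k : ℕ} {z : ι → ℂ} (hz : z ∈ openStrip ι k) :
    (0 : ι → ℂ) ∈ openStrip ι k :=
  mem_openStrip.2 fun i => by simpa using (abs_nonneg _).trans_lt (mem_openStrip.1 hz i)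

variable [Fintype ι]

lemma StripBound.norm_fderiv_le {k : ℕ} {φ : (ι → ℂ) → ℂ} {B : ℝ} (hd : Differentiable ℂ φ)
    (h : StripBound (k + 1) φ B) {z : ι → ℂ} (hz : z ∈ hstrip ι k) : ‖fderiv ℂ φ z‖ ≤ B := by
  refine ContinuousLinearMap.opNorm_le_bound _ h.nonneg fun v => ?_
  rcases eq_or_ne v 0 with rfl | hv
  · simp
  have hv' : 0 < ‖v‖ := norm_pos_iff.2 hv
  have hg : HasDerivAt (fun t : ℂ => φ (z + t • v)) (fderiv ℂ φ z v) 0 := by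
    have h1 : HasDerivAt (fun t : ℂ => z + t • v) v 0 := by
      simpa using ((hasDerivAt_id (0 : ℂ)).smul_const v).const_add z
    have h2 : HasFDerivAt φ (fderiv ℂ φ z) (z + (0 : ℂ) • v) := by
      simpa using (hd z).hasFDerivAt
    exact h2.comp_hasDerivAt 0 h1
  rw [← hg.deriv]
  have := Complex.norm_deriv_le_of_forall_mem_sphere_norm_le (f := fun t : ℂ => φ (z + t • v))
    (c := 0) (R := ‖v‖⁻¹) (C := B) (inv_pos.2 hv')
    (Differentiable.diffContOnCl (by fun_prop)) ?_
  · simpa [div_eq_mul_inv] using this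
  · intro t ht
    refine h.norm_le (add_mem_hstrip hz ?_)
    rw [mem_sphere_zero_iff_norm] at ht
    rw [norm_smul, ht, inv_mul_cancel₀ hv'.ne']
    simp

lemma isOpen_openStrip (k : ℕ) : IsOpen (openStrip ι k) :=
  isOpen_set_pi Set.finite_univ fun _ _ => Metric.isOpen_ball.preimage Complex.continuous_im

lemma exists_mem_openStrip (z : ι → ℂ) : ∃ k : ℕ, z ∈ openStrip ι k := by
  obtain ⟨n, hn⟩ := exists_nat_gt ‖z‖
  exact ⟨n, mem_openStrip.2 fun i =>
    ((Complex.abs_im_le_norm _).trans (norm_le_pi_norm z i)).trans_lt hn⟩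

lemma stripBound_tsum {h : ℕ → (ι → ℂ) → ℂ} {N : ℕ} {D : ℝ}
    (hD : ∀ i, StripBound N (h i) D) {c : ℕ → ℂ} (hc : Summable fun i => ‖c i‖) :
    StripBound N (fun z => ∑' i, c i * h i z) ((∑' i, ‖c i‖) * D) := by
  intro z hz
  have h1 : ∀ i, ‖(((1 + ‖z‖) ^ N : ℝ) : ℂ) * (c i * h i z)‖ ≤ ‖c i‖ * D := fun i => by
    have h0 : ‖(((1 + ‖z‖) ^ N : ℝ) : ℂ)‖ = (1 + ‖z‖) ^ N := by
      rw [Complex.norm_real, Real.norm_of_nonneg (by positivity)]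
    rw [norm_mul, norm_mul, h0, mul_left_comm]
    exact mul_le_mul_of_nonneg_left (hD i z hz) (norm_nonneg _)
  have h2 := tsum_of_norm_bounded (hc.mul_right D).hasSum h1
  rw [tsum_mul_left, norm_mul, Complex.norm_real, Real.norm_of_nonneg (by positivity),
    tsum_mul_right] at h2
  exact h2

lemma memFrakI_tsum {h : ℕ → (ι → ℂ) → ℂ} (hd : ∀ i, Differentiable ℂ (h i)) {D : ℕ → ℝ}
    (hD : ∀ N i, StripBound N (h i) (D N)) {c : ℕ → ℂ} (hc : Summable fun i => ‖c i‖) :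
    memFrakI (fun z => ∑' i, c i * h i z) := by
  refine memFrakI_iff.2 ⟨fun z => ?_, fun k => ⟨_, stripBound_tsum (hD k) hc⟩⟩
  obtain ⟨k, hk⟩ := exists_mem_openStrip z
  refine (hasFDerivAt_tsum_of_isPreconnected (f' := fun i z => c i • fderiv ℂ (h i) z)
    (hc.mul_right (D (k + 1))) (isOpen_openStrip k)
    (isPreconnected_openStrip k) (fun i w _ => ((hd i w).hasFDerivAt.const_mul (c i)))
    (fun i w hw => ?_) (zero_mem_openStrip hk) ?_ hk).differentiableAt
  · rw [norm_smul]
    exact mul_le_mul_of_nonneg_left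
      ((hD (k + 1) i).norm_fderiv_le (hd i) (openStrip_subset k hw)) (norm_nonneg _)
  · refine Summable.of_norm_bounded (hc.mul_right (D 0)) fun i => ?_
    rw [norm_mul]
    exact mul_le_mul_of_nonneg_left ((hD 0 i).norm_le (zero_mem_hstrip 0)) (norm_nonneg _)

/-- A sequence in `𝔥` whose `i`-th member is bounded by `1` in the `i`-th seminorm is bounded. -/
lemma exists_uniform_stripBound {h : ℕ → (ι → ℂ) → ℂ} (hm : ∀ i, memFrakI (h i))
    (hb : ∀ i, StripBound i (h i) 1) : ∃ D : ℕ → ℝ, ∀ N i, StripBound N (h i) (D N) := by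
  choose B hB using fun i => (memFrakI_iff.1 (hm i)).2
  refine ⟨fun N => 1 + ∑ i ∈ Finset.range N, B i N, fun N i => ?_⟩
  have hnn : ∀ i ∈ Finset.range N, 0 ≤ B i N := fun i _ => (hB i N).nonneg
  rcases le_or_gt N i with hi | hi
  · exact (hb i).mono hi (by linarith [Finset.sum_nonneg hnn])
  · refine (hB i N).mono le_rfl ?_
    linarith [Finset.single_le_sum hnn (Finset.mem_range.2 hi)]

variable {J : Type*} [DecidableEq J]

/-- Separately continuous multilinear functionals on `𝔥` are jointly bounded. -/
theorem exists_joint_stripBound (M : (J → ((ι → ℂ) → ℂ)) → ℂ)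
    (hlin : ∀ (j : J) (f : J → ((ι → ℂ) → ℂ)), (∀ i, i ≠ j → memFrakI (f i)) →
      ∀ (c : ℂ) (φ ψ : (ι → ℂ) → ℂ), memFrakI φ → memFrakI ψ →
        M (Function.update f j (c • φ + ψ)) =
          c * M (Function.update f j φ) + M (Function.update f j ψ))
    (hcont : ∀ (j : J) (f : J → ((ι → ℂ) → ℂ)), (∀ i, i ≠ j → memFrakI (f i)) →
      contLinI fun φ => M (Function.update f j φ)) (S : Finset J) :
    ∀ f : J → ((ι → ℂ) → ℂ), (∀ i, memFrakI (f i)) → ∃ (k : ℕ) (C : ℝ),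
      ∀ (g : J → ((ι → ℂ) → ℂ)) (B : J → ℝ), (∀ i, memFrakI (g i)) → (∀ i ∉ S, g i = f i) →
        (∀ i, 0 < B i) → (∀ i ∈ S, StripBound k (g i) (B i)) → ‖M g‖ ≤ C * ∏ i ∈ S, B i := by
  induction S using Finset.induction with
  | empty =>
    intro f _
    refine ⟨0, ‖M f‖, fun g B _ hgf _ _ => ?_⟩
    have : g = f := funext fun i => hgf i (Finset.notMem_empty i)
    simp [this]
  | insert j S hj ih =>
    intro f hf
    by_contra hcon
    push Not at hcon
    choose g B hg hgf hB hgB hM using fun k : ℕ => hcon k (k * 2 ^ k)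
    set h : ℕ → (ι → ℂ) → ℂ := fun k => ((B k j)⁻¹ : ℂ) • g k j with hh
    have hmem : ∀ k, memFrakI (h k) := fun k => (frakSubmodule ι).smul_mem _ (hg k j)
    have hh1 : ∀ k, StripBound k (h k) 1 := fun k => by
      have := (hgB k j (Finset.mem_insert_self j S)).smul ((B k j)⁻¹ : ℂ)
      rwa [norm_inv, Complex.norm_real, Real.norm_of_nonneg (hB k j).le,
        inv_mul_cancel₀ (hB k j).ne'] at this
    obtain ⟨D, hD⟩ := exists_uniform_stripBound hmem hh1
    let cf : BoundedContinuousFunction ℕ ℂ → ℕ → ℂ := fun c i => c i * (2 ^ i)⁻¹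
    have hcf : ∀ c i, ‖cf c i‖ ≤ ‖c‖ * (1 / 2) ^ i := fun c i => by
      simp only [cf, norm_mul, norm_inv, norm_pow, Complex.norm_ofNat, one_div, inv_pow]
      gcongr
      exact c.norm_coe_le_norm i
    have hgeo : Summable fun i : ℕ => (1 / 2 : ℝ) ^ i := summable_geometric_two
    have hcs : ∀ c, Summable fun i => ‖cf c i‖ := fun c =>
      Summable.of_nonneg_of_le (fun _ => norm_nonneg _) (hcf c) (hgeo.mul_left _)
    have hcn : ∀ c, ∑' i, ‖cf c i‖ ≤ ‖c‖ * 2 := fun c => by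
      refine ((hcs c).tsum_le_tsum (hcf c) (hgeo.mul_left _)).trans_eq ?_
      rw [tsum_mul_left, tsum_geometric_two]
    let s : BoundedContinuousFunction ℕ ℂ → (ι → ℂ) → ℂ := fun c z => ∑' i, cf c i * h i z
    have hs : ∀ c, memFrakI (s c) := fun c => memFrakI_tsum (fun i => (hmem i).1) hD (hcs c)
    have hpt : ∀ c z, Summable fun i => cf c i * h i z := fun c z => by
      obtain ⟨k, hk⟩ := exists_mem_openStrip z
      refine Summable.of_norm_bounded ((hcs c).mul_right (D k)) fun i => ?_
      rw [norm_mul]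
      exact mul_le_mul_of_nonneg_left ((hD k i).norm_le (openStrip_subset k hk)) (norm_nonneg _)
    have hs_lin : ∀ (a : ℂ) c d, s (a • c + d) = a • s c + s d := fun a c d => by
      funext z
      simp only [s, Pi.add_apply, Pi.smul_apply, smul_eq_mul]
      rw [← tsum_mul_left, ← ((hpt c z).mul_left a).tsum_add (hpt d z)]
      refine tsum_congr fun i => ?_
      simp only [cf, BoundedContinuousFunction.add_apply, BoundedContinuousFunction.smul_apply,
        smul_eq_mul]
      ring
    have hgne : ∀ k i, i ≠ j → memFrakI (g k i) := fun k i _ => hg k i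
    have hP : ∀ k, 0 < ∏ i ∈ S, B k i := fun k => Finset.prod_pos fun i _ => hB k i
    let Tl : ℕ → BoundedContinuousFunction ℕ ℂ →ₗ[ℂ] ℂ := fun k =>
      { toFun := fun c => ((∏ i ∈ S, B k i : ℝ) : ℂ)⁻¹ * M (Function.update (g k) j (s c))
        map_add' := fun c d => by
          have := hs_lin 1 c d
          rw [one_smul, one_smul] at this
          rw [this, ← one_smul ℂ (s c), hlin j (g k) (hgne k) 1 _ _ (hs c) (hs d), one_smul]
          ring
        map_smul' := fun a c => by
          have h0 : s 0 = 0 := by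
            funext z
            simp [s, cf]
          have h1 := hs_lin a c 0
          have h2 := hlin j (g k) (hgne k) 1 _ _ (hs 0) (hs 0)
          rw [h0, smul_zero, zero_add] at h2
          have h3 : M (Function.update (g k) j 0) = 0 := by linear_combination -h2
          rw [add_zero] at h1
          rw [h1, hlin j (g k) (hgne k) a _ _ (hs c) (hs 0), h0, h3, add_zero, RingHom.id_apply,
            smul_eq_mul]
          ring }
    have hTb : ∀ k, ∃ C : ℝ, ∀ c, ‖Tl k c‖ ≤ C * ‖c‖ := fun k => by
      obtain ⟨n, C, hC, hn⟩ := (hcont j (g k) (hgne k)).exists_stripBound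
      refine ⟨(∏ i ∈ S, B k i)⁻¹ * (C * (2 * D n)), fun c => ?_⟩
      have hDn : 0 ≤ D n := (hD n 0).nonneg
      have h1 : ‖M (Function.update (g k) j (s c))‖ ≤ C * (‖c‖ * 2 * D n) :=
        hn _ (hs c) _ ((stripBound_tsum (hD n) (hcs c)).mono le_rfl
          (mul_le_mul_of_nonneg_right (hcn c) hDn))
      change ‖((∏ i ∈ S, B k i : ℝ) : ℂ)⁻¹ * M (Function.update (g k) j (s c))‖ ≤ _
      rw [norm_mul, norm_inv, Complex.norm_real, Real.norm_of_nonneg (hP k).le, mul_assoc]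
      refine mul_le_mul_of_nonneg_left (h1.trans_eq ?_) (inv_nonneg.2 (hP k).le)
      ring
    choose CT hCT using hTb
    let T : ℕ → BoundedContinuousFunction ℕ ℂ →L[ℂ] ℂ := fun k => (Tl k).mkContinuous (CT k) (hCT k)
    have hTapp : ∀ k c, T k c =
      ((∏ i ∈ S, B k i : ℝ) : ℂ)⁻¹ * M (Function.update (g k) j (s c)) := fun k c => rfl
    have hpw : ∀ c, ∃ C, ∀ k, ‖T k c‖ ≤ C := fun c => by
      obtain ⟨K, C, hKC⟩ := ih (Function.update f j (s c)) fun i => by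
        rcases eq_or_ne i j with rfl | hi
        · simpa using hs c
        · simpa [hi] using hf i
      refine ⟨max C 0 + ∑ k ∈ Finset.range K, ‖T k c‖, fun k => ?_⟩
      rcases lt_or_ge k K with hk | hk
      · linarith [Finset.single_le_sum (f := fun k => ‖T k c‖) (fun _ _ => norm_nonneg _)
          (Finset.mem_range.2 hk), le_max_right C 0]
      · have h1 := hKC (Function.update (g k) j (s c)) (B k)
          (fun i => by
            rcases eq_or_ne i j with rfl | hi
            · simpa using hs c
            · simpa [hi] using hg k i)
          (fun i hi => by
            rcases eq_or_ne i j with rfl | hij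
            · simp
            · simpa [hij] using hgf k i (by simp [hij, hi]))
          (hB k)
          (fun i hi => by
            have hij : i ≠ j := fun h => hj (h ▸ hi)
            simpa [hij] using (hgB k i (Finset.mem_insert_of_mem hi)).mono hk le_rfl)
        rw [hTapp, norm_mul, norm_inv, Complex.norm_real, Real.norm_of_nonneg (hP k).le]
        have h2 : (∏ i ∈ S, B k i)⁻¹ * ‖M (Function.update (g k) j (s c))‖ ≤ C := by
          rw [inv_mul_le_iff₀ (hP k), mul_comm]
          exact h1
        have h3 : 0 ≤ ∑ k ∈ Finset.range K, ‖T k c‖ := Finset.sum_nonneg fun _ _ => norm_nonneg _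
        linarith [le_max_left C 0]
    obtain ⟨C', hC'⟩ := banach_steinhaus hpw
    obtain ⟨k, hk⟩ := exists_nat_gt C'
    let e : BoundedContinuousFunction ℕ ℂ :=
      BoundedContinuousFunction.ofNormedAddCommGroupDiscrete (Pi.single k 1) 1 fun i => by
        rcases eq_or_ne i k with rfl | hi
        · simp
        · simp [hi]
    have he : ‖e‖ ≤ 1 := BoundedContinuousFunction.norm_ofNormedAddCommGroup_le _ zero_le_one _
    have hse : s e = ((2 ^ k)⁻¹ : ℂ) • h k := by
      funext z
      simp only [s]
      rw [tsum_eq_single k]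
      · simp [cf, e]
      · intro i hi
        simp [cf, e, hi]
    have hMe : M (Function.update (g k) j (s e)) = ((2 ^ k)⁻¹ * (B k j : ℂ)⁻¹) * M (g k) := by
      have h2 := hlin j (g k) (hgne k) 1 0 0 (frakSubmodule ι).zero_mem (frakSubmodule ι).zero_mem
      rw [smul_zero, zero_add] at h2
      have h3 : M (Function.update (g k) j 0) = 0 := by linear_combination -h2
      have h4 := hlin j (g k) (hgne k) ((2 ^ k)⁻¹ * (B k j : ℂ)⁻¹) (g k j) 0 (hg k j)
        (frakSubmodule ι).zero_mem
      rw [h3, add_zero, add_zero, Function.update_eq_self] at h4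
      rw [hse, hh, smul_smul, h4]
    have h5 : ‖T k e‖ ≤ C' := by
      calc ‖T k e‖ ≤ ‖T k‖ * ‖e‖ := (T k).le_opNorm e
        _ ≤ ‖T k‖ * 1 := by gcongr
        _ ≤ C' := by rw [mul_one]; exact hC' k
    have h6 : ‖T k e‖ = ‖M (g k)‖ / (2 ^ k * (B k j * ∏ i ∈ S, B k i)) := by
      rw [hTapp, hMe]
      simp only [norm_mul, norm_inv, Complex.norm_real, norm_pow, Complex.norm_ofNat]
      rw [Real.norm_of_nonneg (hP k).le, Real.norm_of_nonneg (hB k j).le]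
      have := hP k
      have := hB k j
      field_simp
    have h7 := hM k
    rw [Finset.prod_insert hj] at h7
    have h8 : (k : ℝ) < ‖T k e‖ := by
      rw [h6, lt_div_iff₀ (mul_pos (by positivity) (mul_pos (hB k j) (hP k)))]
      linarith
    linarith

end JointContinuity

section MeanValue

/-- A parameter integral of entire functions, locally uniformly dominated, is entire. -/
lemma differentiable_integral_of_dominated {X : Type*} [TopologicalSpace X]
    [SecondCountableTopology X] [MeasurableSpace X] [OpensMeasurableSpace X] {μ : Measure X}
    {Φ : X → ℂ → ℂ} (hΦ : Continuous (Function.uncurry Φ)) (hd : ∀ a, Differentiable ℂ (Φ a))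
    (hb : ∀ R : ℝ, ∃ b : X → ℝ, Integrable b μ ∧ ∀ᵐ a ∂μ, ∀ ζ : ℂ, ‖ζ‖ ≤ R → ‖Φ a ζ‖ ≤ b a) :
    Differentiable ℂ fun ζ => ∫ a, Φ a ζ ∂μ := by
  intro ζ₀
  obtain ⟨b, hbi, hb⟩ := hb (‖ζ₀‖ + 2)
  have hmeas : ∀ ζ, AEStronglyMeasurable (fun a => Φ a ζ) μ := fun ζ =>
    (hΦ.comp (continuous_id.prodMk continuous_const)).aestronglyMeasurable
  refine (hasDerivAt_integral_of_dominated_loc_of_deriv_le (F := fun ζ a => Φ a ζ)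
    (F' := fun ζ a => deriv (Φ a) ζ) (bound := b) (Metric.ball_mem_nhds ζ₀ one_pos)
    (Eventually.of_forall hmeas) ?_ ?_ ?_ hbi ?_).2.differentiableAt
  · refine hbi.mono' (hmeas ζ₀) ?_
    filter_upwards [hb] with a ha
    exact ha _ (by linarith)
  · exact ((stronglyMeasurable_deriv_with_param hΦ).comp_measurable
      (measurable_id.prodMk measurable_const)).aestronglyMeasurable
  · filter_upwards [hb] with a ha ζ hζ
    have := Complex.norm_deriv_le_of_forall_mem_sphere_norm_le (c := ζ) (C := b a) one_pos
      (hd a).diffContOnCl fun w hw => ha w ?_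
    · simpa using this
    · rw [mem_sphere_iff_norm] at hw
      rw [Metric.mem_ball, dist_eq_norm] at hζ
      have h1 : w = (w - ζ) + (ζ - ζ₀) + ζ₀ := by ring
      calc ‖w‖ = ‖(w - ζ) + (ζ - ζ₀) + ζ₀‖ := by rw [← h1]
        _ ≤ ‖w - ζ‖ + ‖ζ - ζ₀‖ + ‖ζ₀‖ := norm_add₃_le
        _ ≤ ‖ζ₀‖ + 2 := by linarith
  · exact Eventually.of_forall fun a ζ _ => (hd a ζ).hasDerivAt

variable {ι : Type*} [Fintype ι]

lemma setIntegral_closedBall_smul (g : (ι → ℂ) → ℂ) (c : Circle) :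
    ∫ u in Metric.closedBall (0 : ι → ℂ) 1, g ((c : ℂ) • u) =
      ∫ u in Metric.closedBall (0 : ι → ℂ) 1, g u := by
  have hmp : MeasurePreserving (fun u : ι → ℂ => fun i => rotation c (u i)) volume volume :=
    volume_preserving_pi fun _ => (rotation c).measurePreserving
  have hemb : MeasurableEmbedding (fun u : ι → ℂ => fun i => rotation c (u i)) :=
    (MeasurableEquiv.piCongrRight fun _ : ι =>
      (rotation c).toHomeomorph.toMeasurableEquiv).measurableEmbedding
  have h := hmp.setIntegral_preimage_emb hemb g (Metric.closedBall 0 1)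
  rw [← h]
  have h1 : (fun u : ι → ℂ => fun i => rotation c (u i)) = fun u => (c : ℂ) • u := by
    ext u i
    simp
  rw [h1]
  congr 2
  ext u
  simp [norm_smul, Circle.norm_coe]

/-- Mean value property of entire functions over the unit polydisc. -/
lemma setIntegral_closedBall_add {g : (ι → ℂ) → ℂ} (hg : Differentiable ℂ g) (z : ι → ℂ) :
    ∫ u in Metric.closedBall (0 : ι → ℂ) 1, g (z + u) =
      (volume.real (Metric.closedBall (0 : ι → ℂ) 1) : ℂ) * g z := by
  set U := Metric.closedBall (0 : ι → ℂ) 1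
  have hUfin : volume U < ⊤ := measure_closedBall_lt_top
  set h : ℂ → ℂ := fun ζ => ∫ u in U, g (z + ζ • u) with hh
  have hd : Differentiable ℂ h := by
    refine differentiable_integral_of_dominated (Φ := fun u ζ => g (z + ζ • u)) ?_ ?_ ?_
    · exact hg.continuous.comp (by fun_prop)
    · intro u
      exact hg.comp (by fun_prop)
    · intro R
      obtain ⟨C, hC⟩ := (isCompact_closedBall (0 : ι → ℂ) (‖z‖ + R)).exists_bound_of_continuousOn
        hg.continuous.continuousOn
      have : IsFiniteMeasure (volume.restrict U) := ⟨by simpa using hUfin⟩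
      refine ⟨fun _ => C, integrable_const C, ?_⟩
      filter_upwards [ae_restrict_mem Metric.isClosed_closedBall.measurableSet] with u hu ζ hζ
      refine hC _ ?_
      rw [mem_closedBall_zero_iff] at hu ⊢
      refine (norm_add_le _ _).trans ?_
      rw [norm_smul]
      have := mul_le_mul hζ hu (norm_nonneg _) ((norm_nonneg _).trans hζ)
      linarith
  have h1 : ∀ ζ ∈ Metric.sphere (0 : ℂ) |1|, h ζ = h 1 := by
    intro ζ hζ
    have hζ' : ‖ζ‖ = 1 := by simpa using hζ
    have := setIntegral_closedBall_smul (fun u => g (z + u)) ⟨ζ, by simp [Submonoid.unitSphere, hζ']⟩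
    simpa [hh] using this
  have h2 := Real.circleAverage_const_on_circle h1
  have h3 := hd.diffContOnCl.circleAverage (c := 0) (R := 1)
  have h4 : h 0 = h 1 := h3.symm.trans h2
  have h5 : h 1 = ∫ u in U, g (z + u) := by simp [hh]
  have h6 : h 0 = (volume.real U : ℂ) * g z := by simp [hh]
  rw [← h5, ← h4, h6]

end MeanValue

section Hilbert

lemma norm_toLp_sq {X : Type*} [MeasurableSpace X] {μ : Measure X} {f : X → ℂ}
    (hf : MemLp f 2 μ) : ‖hf.toLp f‖ ^ 2 = ∫ a, ‖f a‖ ^ 2 ∂μ := by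
  have h1 : ((‖hf.toLp f‖ ^ 2 : ℝ) : ℂ) = ∫ a, ((‖f a‖ ^ 2 : ℝ) : ℂ) ∂μ := by
    have h := inner_self_eq_norm_sq_to_K (𝕜 := ℂ) (hf.toLp f)
    rw [L2.inner_def] at h
    rw [Complex.ofReal_pow]
    refine h.symm.trans (integral_congr_ae ?_)
    filter_upwards [hf.coeFn_toLp] with a ha
    rw [ha, inner_self_eq_norm_sq_to_K]
    simp
  rw [integral_complex_ofReal] at h1
  exact_mod_cast h1

/-- Bessel's inequality for a functional bounded by the norm of a linear image. -/
lemma sum_norm_sq_le_of_orthonormal {V E A : Type*} [AddCommGroup V] [Module ℂ V]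
    [NormedAddCommGroup E] [InnerProductSpace ℂ E] {T : V →ₗ[ℂ] E} {D : V →ₗ[ℂ] ℂ} {C : ℝ}
    (hD : ∀ φ, ‖D φ‖ ≤ C * ‖T φ‖) {e : A → V} (he : Orthonormal ℂ fun a => T (e a))
    (S : Finset A) : ∑ a ∈ S, ‖D (e a)‖ ^ 2 ≤ C ^ 2 := by
  set s := ∑ a ∈ S, ‖D (e a)‖ ^ 2 with hs
  have hs0 : 0 ≤ s := Finset.sum_nonneg fun _ _ => by positivity
  set f : V := ∑ a ∈ S, (starRingEnd ℂ (D (e a))) • e a with hf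
  have h1 : ‖T f‖ ^ 2 = s := by
    have h2 := he.inner_sum (fun a => starRingEnd ℂ (D (e a))) (fun a => starRingEnd ℂ (D (e a))) S
    have h3 : T f = ∑ a ∈ S, (starRingEnd ℂ (D (e a))) • T (e a) := by simp [hf, map_sum]
    rw [← h3, inner_self_eq_norm_sq_to_K] at h2
    have h4 : ((‖T f‖ ^ 2 : ℝ) : ℂ) = ((s : ℝ) : ℂ) := by
      rw [hs]
      push_cast
      refine h2.trans (Finset.sum_congr rfl fun a _ => ?_)
      rw [Complex.conj_mul', Complex.norm_conj]
    exact_mod_cast h4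
  have h5 : D f = (s : ℂ) := by
    rw [hf, map_sum, hs]
    push_cast
    refine Finset.sum_congr rfl fun a _ => ?_
    rw [map_smul, smul_eq_mul, ← Complex.conj_mul']
  have h7 := hD f
  rw [h5, Complex.norm_real, Real.norm_of_nonneg hs0] at h7
  have h8 : s ^ 2 ≤ s * C ^ 2 := by
    calc s ^ 2 ≤ (C * ‖T f‖) ^ 2 := by gcongr
      _ = _ := by rw [mul_pow, h1, mul_comm]
  rcases hs0.eq_or_lt with h9 | h9
  · rw [← h9]; positivity
  · rw [sq s] at h8
    exact le_of_mul_le_mul_left h8 h9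

variable {ι : Type*} [Fintype ι]

variable (ι) in
/-- A weight exponent large enough for square integrability on `ℂ^ι`. -/
def decay : ℕ := Fintype.card ι + 1

lemma integrable_inv_pow : Integrable fun z : ι → ℂ => (((1 + ‖z‖) ^ decay ι)⁻¹) ^ 2 := by
  have h := integrable_one_add_norm (E := ι → ℂ) (μ := volume) (r := (2 * decay ι : ℕ)) (by
    rw [Module.finrank_pi_fintype]
    simp only [Complex.finrank_real_complex, Finset.sum_const, Finset.card_univ, smul_eq_mul, decay]
    exact_mod_cast by omega)
  refine h.congr (Eventually.of_forall fun z => ?_)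
  simp only
  rw [Real.rpow_neg (by positivity), Real.rpow_natCast, inv_pow, ← pow_mul, mul_comm]

variable (ι) in
/-- Lebesgue measure on the strip of half-width `k`. -/
def stripMeasure (k : ℕ) : Measure (ι → ℂ) := volume.restrict (hstrip ι k)

instance (k : ℕ) : SigmaFinite (stripMeasure ι k) := by
  unfold stripMeasure; infer_instance

lemma ae_mem_hstrip (k : ℕ) : ∀ᵐ z ∂stripMeasure ι k, z ∈ hstrip ι k :=
  ae_restrict_mem (isClosed_hstrip k).measurableSet

/-- The function `φ` multiplied by the weight `(1 + ‖z‖) ^ k`. -/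
def weighted (k : ℕ) (φ : (ι → ℂ) → ℂ) : (ι → ℂ) → ℂ := fun z => ((1 + ‖z‖ : ℝ) : ℂ) ^ k * φ z

lemma norm_weighted (k : ℕ) (φ : (ι → ℂ) → ℂ) (z : ι → ℂ) :
    ‖weighted k φ z‖ = (1 + ‖z‖) ^ k * ‖φ z‖ := by
  rw [weighted, norm_mul, norm_pow, Complex.norm_real, Real.norm_of_nonneg (by positivity)]

lemma memFrakI.continuous {φ : (ι → ℂ) → ℂ} (h : memFrakI φ) : Continuous φ := h.1.continuous

lemma continuous_weighted (k : ℕ) {φ : (ι → ℂ) → ℂ} (h : Continuous φ) :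
    Continuous (weighted k φ) := by
  unfold weighted
  fun_prop

lemma StripBound.norm_weighted_le {k : ℕ} {φ : (ι → ℂ) → ℂ} {B : ℝ}
    (h : StripBound (k + decay ι) φ B) {z : ι → ℂ} (hz : z ∈ hstrip ι k) :
    ‖weighted k φ z‖ ≤ B * ((1 + ‖z‖) ^ decay ι)⁻¹ := by
  have h1 := h z (hstrip_mono (Nat.le_add_right _ _) hz)
  rw [norm_weighted, ← div_eq_mul_inv, le_div_iff₀ (by positivity)]
  calc _ = (1 + ‖z‖) ^ (k + decay ι) * ‖φ z‖ := by rw [pow_add]; ring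
    _ ≤ B := h1

lemma memLp_weighted (k : ℕ) {φ : (ι → ℂ) → ℂ} (h : memFrakI φ) :
    MemLp (weighted k φ) 2 (stripMeasure ι k) := by
  have hc := continuous_weighted k h.continuous
  rw [memLp_two_iff_integrable_sq_norm hc.aestronglyMeasurable]
  obtain ⟨B, hB⟩ := (memFrakI_iff.1 h).2 (k + decay ι)
  refine ((integrable_inv_pow.restrict (s := hstrip ι k)).const_mul (B ^ 2)).mono'
    (by fun_prop) ?_
  filter_upwards [ae_mem_hstrip k] with z hz
  rw [Real.norm_of_nonneg (by positivity), ← mul_pow]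
  gcongr
  exact hB.norm_weighted_le hz

/-- The weighted `L²` embedding of `𝔥(T(ℝ^ι))`. -/
def toL2 (k : ℕ) : frakSubmodule ι →ₗ[ℂ] Lp ℂ 2 (stripMeasure ι k) where
  toFun φ := (memLp_weighted k φ.2).toLp
  map_add' φ ψ := by
    rw [← MemLp.toLp_add]
    congr 1
    ext z
    simp [weighted, mul_add]
  map_smul' c φ := by
    rw [RingHom.id_apply, ← MemLp.toLp_const_smul]
    congr 1
    ext z
    simp [weighted, mul_left_comm]

lemma norm_toL2_sq (k : ℕ) (φ : frakSubmodule ι) :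
    ‖toL2 k φ‖ ^ 2 = ∫ z, ‖weighted k φ z‖ ^ 2 ∂stripMeasure ι k :=
  norm_toLp_sq (memLp_weighted k φ.2)

lemma integrable_weighted_sq (k : ℕ) {φ : (ι → ℂ) → ℂ} (h : memFrakI φ) :
    Integrable (fun z => ‖weighted k φ z‖ ^ 2) (stripMeasure ι k) :=
  (memLp_two_iff_integrable_sq_norm
    (continuous_weighted k h.continuous).aestronglyMeasurable).1 (memLp_weighted k h)

lemma exists_stripBound_norm_toL2 (k : ℕ) :
    ∃ C : ℝ, 0 < C ∧ ∀ φ : frakSubmodule ι, StripBound k (φ : (ι → ℂ) → ℂ) (C * ‖toL2 (k + 1) φ‖) := by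
  set V := volume.real (Metric.closedBall (0 : ι → ℂ) 1) with hV
  have hVpos : 0 < V := by
    refine ENNReal.toReal_pos ?_ measure_closedBall_lt_top.ne
    exact (Metric.measure_closedBall_pos _ _ one_pos).ne'
  refine ⟨Real.sqrt (4 ^ k / V), by positivity, fun φ z hz => ?_⟩
  have hφ : memFrakI (φ : (ι → ℂ) → ℂ) := φ.2
  refine le_of_sq_le_sq ?_ (by positivity)
  rw [mul_pow, mul_pow, Real.sq_sqrt (by positivity), norm_toL2_sq]
  have hmv := setIntegral_closedBall_add (g := fun w => (φ : (ι → ℂ) → ℂ) w ^ 2) (hφ.1.pow 2) z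
  have hsq : V * ‖(φ : (ι → ℂ) → ℂ) z‖ ^ 2 ≤
      ∫ u in Metric.closedBall (0 : ι → ℂ) 1, ‖(φ : (ι → ℂ) → ℂ) (z + u)‖ ^ 2 := by
    calc _ = ‖((V : ℝ) : ℂ) * (φ : (ι → ℂ) → ℂ) z ^ 2‖ := by
          rw [norm_mul, norm_pow, Complex.norm_real, Real.norm_of_nonneg hVpos.le]
      _ = ‖∫ u in Metric.closedBall (0 : ι → ℂ) 1, (φ : (ι → ℂ) → ℂ) (z + u) ^ 2‖ := by rw [hmv]
      _ ≤ _ := by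
          refine (norm_integral_le_integral_norm _).trans_eq ?_
          simp only [norm_pow]
  have hinteg : Integrable (fun u => ‖weighted (k + 1) φ u‖ ^ 2) (stripMeasure ι (k + 1)) :=
    integrable_weighted_sq (k + 1) hφ
  have hshift : ∫ u in Metric.closedBall (0 : ι → ℂ) 1, ‖weighted (k + 1) φ (z + u)‖ ^ 2 ≤
      ∫ w, ‖weighted (k + 1) φ w‖ ^ 2 ∂stripMeasure ι (k + 1) := by
    have h1 : ∫ u in (fun u => z + u) ⁻¹' (Metric.closedBall z 1), ‖weighted (k + 1) φ (z + u)‖ ^ 2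
        = ∫ w in Metric.closedBall z 1, ‖weighted (k + 1) φ w‖ ^ 2 :=
      (measurePreserving_add_left volume z).setIntegral_preimage_emb
        (measurableEmbedding_addLeft z) (fun w => ‖weighted (k + 1) φ w‖ ^ 2) _
    have h2 : (fun u => z + u) ⁻¹' (Metric.closedBall z 1) = Metric.closedBall 0 1 := by
      ext u
      simp
    rw [← h2, h1]
    refine setIntegral_mono_set hinteg (Eventually.of_forall fun _ => by positivity) ?_
    have h5 : Metric.closedBall z 1 ⊆ hstrip ι (k + 1) := fun w hw => by
      have h6 : ‖w - z‖ ≤ (1 : ℕ) := by simpa using mem_closedBall_iff_norm.1 hw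
      simpa using add_mem_hstrip hz h6
    exact h5.eventuallyLE
  have hloc :
      ∫ u in Metric.closedBall (0 : ι → ℂ) 1, ((1 + ‖z‖) ^ k * ‖(φ : (ι → ℂ) → ℂ) (z + u)‖) ^ 2 ≤
      ∫ u in Metric.closedBall (0 : ι → ℂ) 1, 4 ^ k * ‖weighted (k + 1) φ (z + u)‖ ^ 2 := by
    have hc := hφ.continuous
    have hc' := continuous_weighted (k + 1) hc
    refine setIntegral_mono_on ?_ ?_ Metric.isClosed_closedBall.measurableSet fun u hu => ?_
    · exact (Continuous.continuousOn (by fun_prop)).integrableOn_compact (isCompact_closedBall _ _)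
    · exact (Continuous.continuousOn (by fun_prop)).integrableOn_compact (isCompact_closedBall _ _)
    · rw [mem_closedBall_zero_iff] at hu
      have h3 : 1 + ‖z‖ ≤ 2 * (1 + ‖z + u‖) := by
        have : ‖z‖ ≤ ‖z + u‖ + ‖u‖ := by simpa using norm_sub_le (z + u) u
        linarith [norm_nonneg (z + u)]
      have h4 : (4 : ℝ) ^ k = (2 ^ k) ^ 2 := by rw [← pow_mul, mul_comm, pow_mul]; norm_num
      rw [h4, ← mul_pow, norm_weighted, ← mul_assoc]
      gcongr
      calc (1 + ‖z‖) ^ k ≤ (2 * (1 + ‖z + u‖)) ^ k := by gcongr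
        _ = 2 ^ k * (1 + ‖z + u‖) ^ k := mul_pow _ _ _
        _ ≤ 2 ^ k * (1 + ‖z + u‖) ^ (k + 1) := by
            gcongr
            · linarith [norm_nonneg (z + u)]
            · omega
  simp only [mul_pow] at hloc
  rw [integral_const_mul, integral_const_mul] at hloc
  rw [div_mul_eq_mul_div, le_div_iff₀ hVpos]
  calc _ = ((1 + ‖z‖) ^ k) ^ 2 * (V * ‖(φ : (ι → ℂ) → ℂ) z‖ ^ 2) := by ring
    _ ≤ _ := by gcongr
    _ ≤ _ := hloc
    _ ≤ _ := by gcongr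

/-- Hilbert–Schmidt estimate for the weighted `L²` embeddings. -/
lemma exists_sum_norm_toL2_sq_le (k : ℕ) : ∃ C : ℝ, ∀ {A : Type*} (e : A → frakSubmodule ι),
    Orthonormal ℂ (fun a => toL2 (k + decay ι + 1) (e a)) →
    ∀ S : Finset A, ∑ a ∈ S, ‖toL2 k (e a)‖ ^ 2 ≤ C := by
  obtain ⟨C, hC, h⟩ := exists_stripBound_norm_toL2 (ι := ι) (k + decay ι)
  refine ⟨C ^ 2 * ∫ z : ι → ℂ in hstrip ι k, (((1 + ‖z‖) ^ decay ι)⁻¹) ^ 2, fun e he S => ?_⟩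
  have hpt : ∀ z ∈ hstrip ι k, ∑ a ∈ S, ‖weighted k (e a) z‖ ^ 2 ≤
      C ^ 2 * (((1 + ‖z‖) ^ decay ι)⁻¹) ^ 2 := by
    intro z hz
    have h1 := sum_norm_sq_le_of_orthonormal (T := toL2 (k + decay ι + 1))
      (D := ((((1 + ‖z‖ : ℝ) : ℂ) ^ k) • (LinearMap.proj z : ((ι → ℂ) → ℂ) →ₗ[ℂ] ℂ)) ∘ₗ
        (frakSubmodule ι).subtype) (C := C * ((1 + ‖z‖) ^ decay ι)⁻¹) (fun φ => ?_) he S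
    · rw [mul_pow] at h1
      exact h1
    · have h2 := (h φ).norm_weighted_le hz
      rw [mul_right_comm] at h2
      exact h2
  simp only [norm_toL2_sq]
  rw [← integral_finsetSum _ fun a _ => integrable_weighted_sq k (e a).2, ← integral_const_mul]
  refine setIntegral_mono_on ?_ ?_ (isClosed_hstrip k).measurableSet hpt
  · exact integrable_finsetSum _ fun a _ => integrable_weighted_sq k (e a).2
  · exact integrable_inv_pow.restrict.const_mul _

end Hilbert

section Basis

variable {ι : Type*} [Fintype ι]

lemma exists_orthonormal_toL2 (k : ℕ) : ∃ (A : Set ℕ) (e : A → frakSubmodule ι),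
    Orthonormal ℂ (fun a => toL2 k (e a)) ∧
    ∀ φ : frakSubmodule ι,
      toL2 k φ ∈ closure (Submodule.span ℂ (Set.range fun a => toL2 k (e a)) : Set _) := by
  have : Fact ((2 : ENNReal) ≠ ⊤) := ⟨by norm_num⟩
  have : IsSeparable (stripMeasure ι k) := inferInstance
  have : SecondCountableTopology (Lp ℂ 2 (stripMeasure ι k)) := inferInstance
  obtain ⟨u, hu⟩ := TopologicalSpace.exists_dense_seq (LinearMap.range (toL2 (ι := ι) k))
  set f : ℕ → Lp ℂ 2 (stripMeasure ι k) := fun n => u n with hf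
  have hspan : Submodule.span ℂ (Set.range f) ≤ LinearMap.range (toL2 (ι := ι) k) := by
    rw [Submodule.span_le]
    rintro _ ⟨n, rfl⟩
    exact (u n).2
  have hg : ∀ n, ∃ x : frakSubmodule ι, toL2 k x = InnerProductSpace.gramSchmidtNormed ℂ f n := by
    intro n
    have h1 : InnerProductSpace.gramSchmidtNormed ℂ f n ∈ Submodule.span ℂ (Set.range f) := by
      rw [← InnerProductSpace.span_gramSchmidt ℂ f, ← InnerProductSpace.span_gramSchmidtNormed_range]
      exact Submodule.subset_span ⟨n, rfl⟩
    exact hspan h1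
  choose x hx using hg
  refine ⟨{n | InnerProductSpace.gramSchmidtNormed ℂ f n ≠ 0}, fun a => x a, ?_, fun φ => ?_⟩
  · simp only [hx]
    exact InnerProductSpace.gramSchmidtNormed_orthonormal' f
  · have h1 : Submodule.span ℂ (Set.range f) ≤ Submodule.span ℂ (Set.range
        fun a : {n | InnerProductSpace.gramSchmidtNormed ℂ f n ≠ 0} => toL2 k (x a)) := by
      rw [← InnerProductSpace.span_gramSchmidt ℂ f, ← InnerProductSpace.span_gramSchmidtNormed_range,
        Submodule.span_le]
      rintro _ ⟨n, rfl⟩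
      by_cases h : InnerProductSpace.gramSchmidtNormed ℂ f n = 0
      · rw [h]; exact Submodule.zero_mem _
      · exact Submodule.subset_span ⟨⟨n, h⟩, hx n⟩
    refine closure_mono (h1 : (_ : Set _) ⊆ _) (closure_mono Submodule.subset_span ?_)
    have h2 := hu.closure_range.ge (Set.mem_univ ⟨toL2 k φ, LinearMap.mem_range_self _ φ⟩)
    have h3 := image_closure_subset_closure_image continuous_subtype_val (Set.mem_image_of_mem _ h2)
    rwa [← Set.range_comp] at h3

/-- A continuous functional for the weighted `L²` norm that vanishes on an orthonormal system
with dense span vanishes. -/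
lemma eq_zero_of_forall_basis {k : ℕ} {D : frakSubmodule ι →ₗ[ℂ] ℂ} {C : ℝ}
    (hD : ∀ φ, ‖D φ‖ ≤ C * ‖toL2 k φ‖) {A : Type*} {e : A → frakSubmodule ι}
    (he : ∀ φ : frakSubmodule ι,
      toL2 k φ ∈ closure (Submodule.span ℂ (Set.range fun a => toL2 k (e a)) : Set _))
    (h0 : ∀ a, D (e a) = 0) : D = 0 := by
  have hC : 0 ≤ |C| := abs_nonneg C
  ext φ
  rw [LinearMap.zero_apply, ← norm_le_zero_iff]
  refine le_of_forall_pos_le_add fun ε hε => ?_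
  obtain ⟨y, hy, hyd⟩ := Metric.mem_closure_iff.1 (he φ) (ε / (|C| + 1)) (by positivity)
  have h1 : Submodule.span ℂ (Set.range fun a => toL2 k (e a)) =
      (Submodule.span ℂ (Set.range e)).map (toL2 k) := by
    rw [Submodule.map_span, ← Set.range_comp]
    rfl
  rw [h1] at hy
  obtain ⟨ψ, hψ, rfl⟩ := hy
  have h2 : Submodule.span ℂ (Set.range e) ≤ LinearMap.ker D := by
    rw [Submodule.span_le]
    rintro _ ⟨a, rfl⟩
    exact h0 a
  have h3 : D ψ = 0 := h2 hψ
  have h4 : D φ = D (φ - ψ) := by rw [map_sub, h3, sub_zero]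
  rw [h4, zero_add]
  refine (hD _).trans ?_
  rw [map_sub, ← dist_eq_norm]
  calc C * dist (toL2 k φ) (toL2 k ψ) ≤ (|C| + 1) * (ε / (|C| + 1)) := by
        gcongr
        linarith [le_abs_self C]
    _ = ε := by field_simp

end Basis

section Multilinear

variable {ι J : Type*} [Fintype ι]

/-- A multilinear functional on `𝔥`, bundled. -/
def frakMultilinear [decJ : DecidableEq J] (M : (J → ((ι → ℂ) → ℂ)) → ℂ)
    (hlin : ∀ (j : J) (f : J → ((ι → ℂ) → ℂ)), (∀ i, i ≠ j → memFrakI (f i)) →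
      ∀ (c : ℂ) (φ ψ : (ι → ℂ) → ℂ), memFrakI φ → memFrakI ψ →
        M (Function.update f j (c • φ + ψ)) =
          c * M (Function.update f j φ) + M (Function.update f j ψ)) :
    MultilinearMap ℂ (fun _ : J => frakSubmodule ι) ℂ := by
  have hup : ∀ (f : J → frakSubmodule ι) (j : J) (x : frakSubmodule ι),
      (fun i => (Function.update f j x i : (ι → ℂ) → ℂ)) =
        Function.update (fun i => (f i : (ι → ℂ) → ℂ)) j x := fun f j x =>
    funext fun i => Function.apply_update (fun _ (y : frakSubmodule ι) => (y : (ι → ℂ) → ℂ)) f j x i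
  have h0 : memFrakI (0 : (ι → ℂ) → ℂ) := (frakSubmodule ι).zero_mem
  exact
  { toFun := fun f => M fun j => f j
    map_update_add' := by
      intro inst f j x y
      have hi : inst = decJ := Subsingleton.elim _ _
      subst hi
      have h := hlin j (fun i => f i) (fun i _ => (f i).2) 1 x y x.2 y.2
      rw [one_smul, one_mul] at h
      rw [hup, hup, hup, ← h]
      rfl
    map_update_smul' := by
      intro inst f j c x
      have hi : inst = decJ := Subsingleton.elim _ _
      subst hi
      have h := hlin j (fun i => f i) (fun i _ => (f i).2) c x 0 x.2 h0
      have hz := hlin j (fun i => f i) (fun i _ => (f i).2) 1 0 0 h0 h0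
      rw [one_smul, one_mul, add_zero, left_eq_add] at hz
      rw [hz, add_zero, add_zero] at h
      rw [hup, hup, smul_eq_mul, ← h]
      rfl }

lemma exists_norm_le_prod_toL2 [Fintype J]
    {T : MultilinearMap ℂ (fun _ : J => frakSubmodule ι) ℂ} {k : ℕ}
    {C : ℝ} (h : ∀ (f : J → frakSubmodule ι) (B : J → ℝ), (∀ i, 0 < B i) →
      (∀ i, StripBound k (f i : (ι → ℂ) → ℂ) (B i)) → ‖T f‖ ≤ C * ∏ i, B i) {n : ℕ} (hn : k ≤ n) :
    ∃ C' : ℝ, 0 ≤ C' ∧ ∀ f, ‖T f‖ ≤ C' * ∏ i, ‖toL2 (n + 1) (f i)‖ := by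
  obtain ⟨D, hD, hDb⟩ := exists_stripBound_norm_toL2 (ι := ι) n
  refine ⟨|C| * D ^ Fintype.card J, by positivity, fun f => ?_⟩
  have h1 : ∀ ε : ℝ, 0 < ε → ‖T f‖ ≤ |C| * ∏ i, (D * ‖toL2 (n + 1) (f i)‖ + ε) := by
    intro ε hε
    refine (h f (fun i => D * ‖toL2 (n + 1) (f i)‖ + ε) (fun i => by positivity) fun i =>
      (hDb (f i)).mono hn (by linarith)).trans ?_
    exact mul_le_mul_of_nonneg_right (le_abs_self C) (Finset.prod_nonneg fun i _ => by positivity)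
  have h2 : Tendsto (fun ε : ℝ => |C| * ∏ i, (D * ‖toL2 (n + 1) (f i)‖ + ε)) (𝓝[>] 0)
      (𝓝 (|C| * ∏ i, (D * ‖toL2 (n + 1) (f i)‖ + 0))) := by
    refine Tendsto.mono_left ?_ nhdsWithin_le_nhds
    exact Continuous.tendsto (by fun_prop) 0
  have h3 := ge_of_tendsto h2 (by filter_upwards [self_mem_nhdsWithin] with ε hε using h1 ε hε)
  refine h3.trans_eq ?_
  simp [Finset.prod_mul_distrib, mul_assoc]

/-- Multilinear functionals bounded in the weighted `L²` norms are determined on an orthonormal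
system with dense span. -/
lemma multilinear_eq_zero [Fintype J] [DecidableEq J] {k : ℕ}
    {D : MultilinearMap ℂ (fun _ : J => frakSubmodule ι) ℂ} {C : ℝ}
    (hD : ∀ f, ‖D f‖ ≤ C * ∏ i, ‖toL2 k (f i)‖) {A : Type*} {e : A → frakSubmodule ι}
    (he : ∀ φ : frakSubmodule ι,
      toL2 k φ ∈ closure (Submodule.span ℂ (Set.range fun a => toL2 k (e a)) : Set _))
    (h0 : ∀ a : J → A, D (fun j => e (a j)) = 0) : D = 0 := by
  suffices h : ∀ (S : Finset J) (f : J → frakSubmodule ι), (∀ i ∉ S, f i ∈ Set.range e) →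
      D f = 0 by
    ext f
    exact h Finset.univ f fun i hi => absurd (Finset.mem_univ i) hi
  intro S
  induction S using Finset.induction with
  | empty =>
    intro f hf
    choose a ha using fun i => hf i (Finset.notMem_empty i)
    rw [← h0 a]
    congr 1
    ext1 i
    exact (ha i).symm
  | insert j S hj ih =>
    intro f hf
    have h1 : D.toLinearMap f j = 0 := by
      refine eq_zero_of_forall_basis (k := k) (C := C * ∏ i ∈ Finset.univ.erase j, ‖toL2 k (f i)‖)
        (fun φ => ?_) he fun a => ?_
      · refine (hD _).trans_eq ?_
        rw [← Finset.mul_prod_erase _ _ (Finset.mem_univ j), Function.update_self, mul_assoc,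
          mul_comm (∏ i ∈ _, _)]
        congr 2
        refine Finset.prod_congr rfl fun i hi => ?_
        rw [Function.update_of_ne (Finset.ne_of_mem_erase hi)]
      · refine ih _ fun i hi => ?_
        by_cases hij : i = j
        · subst hij
          rw [Function.update_self]
          exact ⟨a, rfl⟩
        · rw [Function.update_of_ne hij]
          exact hf i (by simp [hij, hi])
    have h2 := LinearMap.congr_fun h1 (f j)
    simpa using h2

/-- The values of a bounded multilinear functional on products of an orthonormal system are square
summable. -/
lemma exists_sum_norm_sq_le [Fintype J] {k : ℕ}
    {T : MultilinearMap ℂ (fun _ : J => frakSubmodule ι) ℂ} {C : ℝ}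
    (hT : ∀ f, ‖T f‖ ≤ C * ∏ i, ‖toL2 k (f i)‖) {A : Type*} {e : A → frakSubmodule ι}
    (he : Orthonormal ℂ (fun a => toL2 (k + decay ι + 1) (e a))) :
    ∃ C' : ℝ, ∀ S : Finset (J → A), ∑ a ∈ S, ‖T fun j => e (a j)‖ ^ 2 ≤ C' := by
  classical
  obtain ⟨H, hH⟩ := exists_sum_norm_toL2_sq_le (ι := ι) k
  have hH' := hH e he
  refine ⟨C ^ 2 * ∏ _j : J, H, fun S => ?_⟩
  set U : Finset A := S.biUnion fun a => Finset.univ.image a with hU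
  have hSU : S ⊆ Fintype.piFinset fun _ => U := fun a ha => by
    rw [Fintype.mem_piFinset]
    intro j
    exact Finset.mem_biUnion.2 ⟨a, ha, Finset.mem_image_of_mem _ (Finset.mem_univ j)⟩
  calc ∑ a ∈ S, ‖T fun j => e (a j)‖ ^ 2
      ≤ ∑ a ∈ S, C ^ 2 * ∏ j, ‖toL2 k (e (a j))‖ ^ 2 := by
        refine Finset.sum_le_sum fun a _ => ?_
        rw [Finset.prod_pow, ← mul_pow]
        gcongr
        exact hT _
    _ ≤ ∑ a ∈ Fintype.piFinset fun _ => U, C ^ 2 * ∏ j, ‖toL2 k (e (a j))‖ ^ 2 :=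
        Finset.sum_le_sum_of_subset_of_nonneg hSU fun _ _ _ =>
          mul_nonneg (sq_nonneg _) (Finset.prod_nonneg fun _ _ => by positivity)
    _ = C ^ 2 * ∏ _j : J, ∑ a ∈ U, ‖toL2 k (e a)‖ ^ 2 := by
        rw [← Finset.mul_sum, Finset.prod_univ_sum (fun _ : J => U)
          (fun _ a => ‖toL2 k (e a)‖ ^ 2)]
    _ ≤ C ^ 2 * ∏ _j : J, H := by
        gcongr with j
        exact hH' U

end Multilinear

section Existence

/-- Square summable coefficients along an orthonormal family come from a vector. -/
lemma exists_inner_eq {E B : Type*} [NormedAddCommGroup E] [InnerProductSpace ℂ E] [CompleteSpace E]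
    {v : B → E} (hv : Orthonormal ℂ v) {c : B → ℂ} {C : ℝ}
    (hc : ∀ S : Finset B, ∑ b ∈ S, ‖c b‖ ^ 2 ≤ C) : ∃ κ : E, ∀ b, inner ℂ κ (v b) = c b := by
  have h1 : Summable fun b => ‖starRingEnd ℂ (c b)‖ ^ 2 := by
    simp only [Complex.norm_conj]
    exact summable_of_sum_le (fun _ => sq_nonneg _) hc
  have h2 := (hv.orthogonalFamily.summable_iff_norm_sq_summable fun b => starRingEnd ℂ (c b)).2 h1
  refine ⟨∑' b, LinearIsometry.toSpanSingleton ℂ E (hv.1 b) (starRingEnd ℂ (c b)), fun b => ?_⟩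
  have h3 := (innerSL ℂ (v b)).hasSum h2.hasSum
  have h4 := h3.unique (hasSum_single b fun a hab => by
    simp [hv.2 (Ne.symm hab)])
  rw [← inner_conj_symm]
  have h5 : inner ℂ (v b) (∑' b, LinearIsometry.toSpanSingleton ℂ E (hv.1 b) (starRingEnd ℂ (c b))) =
      starRingEnd ℂ (c b) := by
    refine h4.trans ?_
    simp [inner_self_eq_norm_sq_to_K, hv.1 b]
  rw [h5, Complex.conj_conj]

variable {ι J : Type*} [Fintype ι] [Fintype J]

variable (ι J) in
/-- Product of the strip measures. -/
def stripPi (k : ℕ) : Measure (J → ι → ℂ) := Measure.pi fun _ => stripMeasure ι k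

/-- Weighted tensor product. -/
def weightedTensor (k : ℕ) (f : J → (ι → ℂ) → ℂ) (z : J → ι → ℂ) : ℂ :=
  ∏ j, weighted k (f j) (z j)

lemma continuous_weightedTensor (k : ℕ) {f : J → (ι → ℂ) → ℂ} (h : ∀ j, memFrakI (f j)) :
    Continuous (weightedTensor k f) :=
  continuous_finsetProd _ fun j _ => (continuous_weighted k (h j).continuous).comp (continuous_apply j)

lemma memLp_weightedTensor (k : ℕ) {f : J → (ι → ℂ) → ℂ} (h : ∀ j, memFrakI (f j)) :
    MemLp (weightedTensor k f) 2 (stripPi ι J k) := by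
  rw [memLp_two_iff_integrable_sq_norm (continuous_weightedTensor k h).aestronglyMeasurable]
  have := Integrable.fintype_prod (fun j => integrable_weighted_sq k (h j))
  refine this.congr (Eventually.of_forall fun z => ?_)
  simp [weightedTensor, Finset.prod_pow]

/-- The class in `L²` of the weighted tensor product. -/
def tensorL2 (k : ℕ) (f : J → frakSubmodule ι) : Lp ℂ 2 (stripPi ι J k) :=
  (memLp_weightedTensor k fun j => (f j).2).toLp

lemma inner_tensorL2 (k : ℕ) (f g : J → frakSubmodule ι) :
    inner ℂ (tensorL2 k f) (tensorL2 k g) = ∏ j, inner ℂ (toL2 k (f j)) (toL2 k (g j)) := by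
  have h1 : ∀ j, inner ℂ (toL2 k (f j)) (toL2 k (g j)) =
      ∫ z, inner ℂ (weighted k (f j) z) (weighted k (g j) z) ∂stripMeasure ι k := fun j => by
    rw [L2.inner_def]
    refine integral_congr_ae ?_
    filter_upwards [(memLp_weighted k (f j).2).coeFn_toLp, (memLp_weighted k (g j).2).coeFn_toLp]
      with z h1 h2
    exact congrArg₂ (inner ℂ) h1 h2
  simp only [h1]
  rw [← integral_fintype_prod_eq_prod (μ := fun _ => stripMeasure ι k)
    (fun j z => inner ℂ (weighted k (f j) z) (weighted k (g j) z)), L2.inner_def]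
  refine integral_congr_ae ?_
  filter_upwards [(memLp_weightedTensor k fun j => (f j).2).coeFn_toLp,
    (memLp_weightedTensor k fun j => (g j).2).coeFn_toLp] with z h1 h2
  refine (congrArg₂ (inner ℂ) h1 h2).trans ?_
  simp [weightedTensor, RCLike.inner_apply, Finset.prod_mul_distrib]

lemma norm_tensorL2 (k : ℕ) (f : J → frakSubmodule ι) :
    ‖tensorL2 k f‖ = ∏ j, ‖toL2 k (f j)‖ := by
  have h := inner_tensorL2 k f f
  simp only [inner_self_eq_norm_sq_to_K] at h
  rw [Finset.prod_pow] at h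
  have h2 : ‖tensorL2 k f‖ ^ 2 = (∏ j, ‖toL2 k (f j)‖) ^ 2 := by exact_mod_cast h
  exact (pow_left_inj₀ (norm_nonneg _) (Finset.prod_nonneg fun _ _ => norm_nonneg _)
    two_ne_zero).1 h2

lemma orthonormal_tensorL2 {k : ℕ} {A : Type*} {e : A → frakSubmodule ι}
    (he : Orthonormal ℂ fun a => toL2 k (e a)) :
    Orthonormal ℂ fun a : J → A => tensorL2 k fun j => e (a j) := by
  refine ⟨fun a => ?_, fun a b hab => ?_⟩
  · rw [norm_tensorL2]
    exact Finset.prod_eq_one fun j _ => he.1 (a j)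
  · obtain ⟨j, hj⟩ := Function.ne_iff.1 hab
    rw [inner_tensorL2]
    exact Finset.prod_eq_zero (Finset.mem_univ j) (he.2 hj)

/-- A function on `ℂ^(J × ι)`, as a function on `(ℂ^ι)^J` with product weights. -/
def weightedUncurry (k : ℕ) (φ : (J × ι → ℂ) → ℂ) (z : J → ι → ℂ) : ℂ :=
  (∏ j, ((1 + ‖z j‖ : ℝ) : ℂ) ^ k) * φ fun p => z p.1 p.2

lemma weightedUncurry_tensor (k : ℕ) (f : J → (ι → ℂ) → ℂ) :
    weightedUncurry k (fun z : J × ι → ℂ => ∏ j, f j fun i => z (j, i)) = weightedTensor k f := by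
  ext z
  simp [weightedUncurry, weightedTensor, weighted, Finset.prod_mul_distrib]

variable (ι J) in
/-- Dominating function for product weights. -/
def prodDecay (z : J → ι → ℂ) : ℝ := ∏ j, (((1 + ‖z j‖) ^ decay ι)⁻¹) ^ 2

variable (ι J) in
lemma integrable_prodDecay (k : ℕ) : Integrable (prodDecay ι J) (stripPi ι J k) :=
  Integrable.fintype_prod fun _ => integrable_inv_pow.restrict

lemma continuous_weightedUncurry (k : ℕ) {φ : (J × ι → ℂ) → ℂ} (h : memFrakI φ) :
    Continuous (weightedUncurry k φ) := by
  have := h.continuous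
  unfold weightedUncurry
  fun_prop

lemma StripBound.norm_weightedUncurry_sq_le {k : ℕ} {φ : (J × ι → ℂ) → ℂ} {B : ℝ}
    (h : StripBound (k + (k + decay ι) * Fintype.card J) φ B) {z : J → ι → ℂ}
    (hz : ∀ j, z j ∈ hstrip ι k) :
    ‖weightedUncurry k φ z‖ ^ 2 ≤ B ^ 2 * prodDecay ι J z := by
  set w : J × ι → ℂ := fun p => z p.1 p.2 with hw
  have h1 := h w fun p => (hz p.1 p.2).trans (by exact_mod_cast Nat.le_add_right _ _)
  have h2 : ∀ j, ‖z j‖ ≤ ‖w‖ := fun j =>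
    (pi_norm_le_iff_of_nonneg (norm_nonneg _)).2 fun i => norm_le_pi_norm w (j, i)
  have h3 : ‖weightedUncurry k φ z‖ = (∏ j, (1 + ‖z j‖) ^ k) * ‖φ w‖ := by
    rw [weightedUncurry, norm_mul, norm_prod]
    congr 1
    refine Finset.prod_congr rfl fun j _ => ?_
    rw [norm_pow, Complex.norm_real, Real.norm_of_nonneg (by positivity)]
  have hP : 0 < ∏ j, (1 + ‖z j‖) ^ decay ι := Finset.prod_pos fun j _ => by positivity
  have h4 : ‖weightedUncurry k φ z‖ ≤ B * (∏ j, (1 + ‖z j‖) ^ decay ι)⁻¹ := by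
    rw [← div_eq_mul_inv, le_div_iff₀ hP, h3]
    calc (∏ j, (1 + ‖z j‖) ^ k) * ‖φ w‖ * ∏ j, (1 + ‖z j‖) ^ decay ι
        = (∏ j, (1 + ‖z j‖) ^ (k + decay ι)) * ‖φ w‖ := by
          simp only [pow_add, Finset.prod_mul_distrib]; ring
      _ ≤ (∏ _j : J, (1 + ‖w‖) ^ (k + decay ι)) * ‖φ w‖ := by
          gcongr with j
          exact h2 j
      _ = (1 + ‖w‖) ^ ((k + decay ι) * Fintype.card J) * ‖φ w‖ := by
          rw [Finset.prod_const, ← pow_mul, Finset.card_univ]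
      _ ≤ (1 + ‖w‖) ^ (k + (k + decay ι) * Fintype.card J) * ‖φ w‖ := by
          gcongr
          · linarith [norm_nonneg w]
          · omega
      _ ≤ B := h1
  calc _ ≤ (B * (∏ j, (1 + ‖z j‖) ^ decay ι)⁻¹) ^ 2 := by gcongr
    _ = _ := by rw [mul_pow, prodDecay, Finset.prod_pow _ 2, Finset.prod_inv_distrib]

variable (ι J) in
lemma ae_forall_mem_hstrip (k : ℕ) : ∀ᵐ z ∂stripPi ι J k, ∀ j, z j ∈ hstrip ι k := by
  rw [eventually_all]
  intro j
  exact Measure.tendsto_eval_ae_ae (μ := fun _ => stripMeasure ι k) (ae_mem_hstrip k)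

lemma StripBound.integrable_weightedUncurry_sq {k : ℕ} {φ : (J × ι → ℂ) → ℂ} {B : ℝ}
    (h : StripBound (k + (k + decay ι) * Fintype.card J) φ B) (hφ : memFrakI φ) :
    Integrable (fun z => ‖weightedUncurry k φ z‖ ^ 2) (stripPi ι J k) := by
  have hc := continuous_weightedUncurry k hφ
  refine ((integrable_prodDecay ι J k).const_mul (B ^ 2)).mono'
    (Continuous.aestronglyMeasurable (by fun_prop)) ?_
  filter_upwards [ae_forall_mem_hstrip ι J k] with z hz
  rw [Real.norm_of_nonneg (by positivity)]
  exact h.norm_weightedUncurry_sq_le hz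

lemma memLp_weightedUncurry (k : ℕ) {φ : (J × ι → ℂ) → ℂ} (hφ : memFrakI φ) :
    MemLp (weightedUncurry k φ) 2 (stripPi ι J k) := by
  rw [memLp_two_iff_integrable_sq_norm (continuous_weightedUncurry k hφ).aestronglyMeasurable]
  obtain ⟨B, hB⟩ := (memFrakI_iff.1 hφ).2 (k + (k + decay ι) * Fintype.card J)
  exact hB.integrable_weightedUncurry_sq hφ

lemma StripBound.norm_toLp_weightedUncurry_le {k : ℕ} {φ : (J × ι → ℂ) → ℂ} {B : ℝ}
    (h : StripBound (k + (k + decay ι) * Fintype.card J) φ B) (hφ : memFrakI φ) :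
    ‖(memLp_weightedUncurry k hφ).toLp‖ ≤
      Real.sqrt (∫ z, prodDecay ι J z ∂stripPi ι J k) * B := by
  have hB := h.nonneg
  have hI : 0 ≤ ∫ z, prodDecay ι J z ∂stripPi ι J k :=
    integral_nonneg fun z => Finset.prod_nonneg fun _ _ => sq_nonneg _
  refine le_of_sq_le_sq ?_ (by positivity)
  rw [norm_toLp_sq, mul_pow, Real.sq_sqrt hI, mul_comm, ← integral_const_mul]
  refine integral_mono_ae (h.integrable_weightedUncurry_sq hφ)
    ((integrable_prodDecay ι J k).const_mul _) ?_
  filter_upwards [ae_forall_mem_hstrip ι J k] with z hz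
  exact h.norm_weightedUncurry_sq_le hz

lemma exists_extension {T : MultilinearMap ℂ (fun _ : J => frakSubmodule ι) ℂ} {k : ℕ} {C C' : ℝ}
    (hT : ∀ f, ‖T f‖ ≤ C * ∏ i, ‖toL2 k (f i)‖)
    (hT' : ∀ f, ‖T f‖ ≤ C' * ∏ i, ‖toL2 (k + decay ι + 1) (f i)‖) :
    ∃ F : ((J × ι → ℂ) → ℂ) → ℂ,
      (∀ φ ψ, memFrakI φ → memFrakI ψ → F (φ + ψ) = F φ + F ψ) ∧
      (∀ (c : ℂ) (φ), memFrakI φ → F (c • φ) = c * F φ) ∧ contLinI F ∧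
      ∀ f : J → frakSubmodule ι,
        F (fun z => ∏ j, (f j : (ι → ℂ) → ℂ) fun i => z (j, i)) = T f := by
  classical
  set K := k + decay ι + 1
  obtain ⟨A, e, he, hspan⟩ := exists_orthonormal_toL2 (ι := ι) K
  obtain ⟨H, hH⟩ := exists_sum_norm_sq_le hT he
  obtain ⟨κ, hκ⟩ := exists_inner_eq (orthonormal_tensorL2 (J := J) he) hH
  set F : ((J × ι → ℂ) → ℂ) → ℂ := fun φ =>
    if h : MemLp (weightedUncurry K φ) 2 (stripPi ι J K) then inner ℂ κ h.toLp else 0 with hF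
  have hFφ : ∀ φ (h : MemLp (weightedUncurry K φ) 2 (stripPi ι J K)), F φ = inner ℂ κ h.toLp :=
    fun φ h => dif_pos h
  have hten : ∀ f : J → frakSubmodule ι,
      F (fun z => ∏ j, (f j : (ι → ℂ) → ℂ) fun i => z (j, i)) = inner ℂ κ (tensorL2 K f) := by
    intro f
    have h1 := weightedUncurry_tensor K fun j => (f j : (ι → ℂ) → ℂ)
    have h2 := memLp_weightedTensor K fun j => (f j).2
    rw [hFφ _ (h1 ▸ h2)]
    congr 1
    exact MemLp.toLp_congr _ _ (Eventually.of_forall fun z => congrFun h1 z)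
  refine ⟨F, fun φ ψ hφ hψ => ?_, fun c φ hφ => ?_, ?_, fun f => ?_⟩
  · have h1 := memLp_weightedUncurry K hφ
    have h2 := memLp_weightedUncurry K hψ
    rw [hFφ _ h1, hFφ _ h2, hFφ _ (memLp_weightedUncurry K ((frakSubmodule (J × ι)).add_mem hφ hψ)),
      ← inner_add_right, ← MemLp.toLp_add]
    congr 2
    ext z
    simp [weightedUncurry, mul_add]
  · have h1 := memLp_weightedUncurry K hφ
    rw [hFφ _ h1, hFφ _ (memLp_weightedUncurry K ((frakSubmodule (J × ι)).smul_mem c hφ)),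
      ← inner_smul_right, ← MemLp.toLp_const_smul]
    congr 2
    ext z
    simp [weightedUncurry, mul_left_comm]
  · refine contLinI_of_stripBound (n := K + (K + decay ι) * Fintype.card J)
      (C := ‖κ‖ * Real.sqrt (∫ z, prodDecay ι J z ∂stripPi ι J K)) fun φ hφ B hB => ?_
    rw [hFφ _ (memLp_weightedUncurry K hφ), mul_assoc]
    refine (norm_inner_le_norm _ _).trans ?_
    gcongr
    exact hB.norm_toLp_weightedUncurry_le hφ
  · rw [hten]
    have hpt : ∀ (z : J → ι → ℂ) (f : J → frakSubmodule ι),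
        weightedTensor K (fun j => (f j : (ι → ℂ) → ℂ)) z =
          (MultilinearMap.mkPiAlgebra ℂ J ℂ).compLinearMap (fun j =>
            ((((1 + ‖z j‖ : ℝ) : ℂ) ^ K) • (LinearMap.proj (z j) : ((ι → ℂ) → ℂ) →ₗ[ℂ] ℂ)) ∘ₗ
              (frakSubmodule ι).subtype) f := fun z f => by
      simp [weightedTensor, weighted]
    let Q : MultilinearMap ℂ (fun _ : J => frakSubmodule ι) ℂ :=
      { toFun := fun f => inner ℂ κ (tensorL2 K f)
        map_update_add' := fun f j x y => by
          rw [← inner_add_right]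
          simp only [tensorL2]
          rw [← MemLp.toLp_add]
          congr 2
          ext z
          simp only [Pi.add_apply, hpt, MultilinearMap.map_update_add]
        map_update_smul' := fun f j c x => by
          rw [smul_eq_mul, ← inner_smul_right]
          simp only [tensorL2]
          rw [← MemLp.toLp_const_smul]
          congr 2
          ext z
          simp only [Pi.smul_apply, hpt, MultilinearMap.map_update_smul] }
    have hQ : Q - T = 0 := by
      refine multilinear_eq_zero (k := K) (C := ‖κ‖ + C') (fun f => ?_) hspan fun a => ?_
      · rw [sub_apply, add_mul]
        refine (norm_sub_le _ _).trans (add_le_add ?_ (hT' f))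
        rw [← norm_tensorL2]
        exact norm_inner_le_norm (𝕜 := ℂ) κ (tensorL2 K f)
      · rw [sub_apply, sub_eq_zero]
        exact hκ a
    have h1 := congrArg (fun S => S f) (sub_eq_zero.1 hQ)
    exact h1

end Existence

section Gaussian

variable {ι : Type*}

/-- The inclusion `ℝ^ι ⊆ ℂ^ι`. -/
def realVec (x : ι → ℝ) : ι → ℂ := fun i => (x i : ℂ)

@[fun_prop]
lemma continuous_realVec : Continuous (realVec : (ι → ℝ) → ι → ℂ) := by
  unfold realVec
  fun_prop

lemma add_realVec_mem {k : ℕ} {z : ι → ℂ} (hz : z ∈ hstrip ι k) (x : ι → ℝ) :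
    z + realVec x ∈ hstrip ι k := fun i => by
  simpa [realVec] using hz i

lemma realVec_mem (k : ℕ) (x : ι → ℝ) : realVec x ∈ hstrip ι k := fun i => by
  simp [realVec]

variable [Fintype ι]

lemma one_add_norm_le_mul {E : Type*} [SeminormedAddCommGroup E] (z w : E) :
    1 + ‖z‖ ≤ (1 + ‖z + w‖) * (1 + ‖w‖) := by
  have : ‖z‖ ≤ ‖z + w‖ + ‖w‖ := by simpa using norm_sub_le (z + w) w
  nlinarith [norm_nonneg (z + w), norm_nonneg w, mul_nonneg (norm_nonneg (z + w)) (norm_nonneg w)]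

lemma memFrakI.mul {φ ψ : (ι → ℂ) → ℂ} (hφ : memFrakI φ) (hψ : memFrakI ψ) :
    memFrakI fun z => φ z * ψ z := by
  refine memFrakI_iff.2 ⟨hφ.1.mul hψ.1, fun k => ?_⟩
  obtain ⟨B, hB⟩ := (memFrakI_iff.1 hφ).2 k
  obtain ⟨B', hB'⟩ := (memFrakI_iff.1 hψ).2 k
  refine ⟨B * B', fun z hz => ?_⟩
  rw [norm_mul, ← mul_assoc]
  exact mul_le_mul (hB z hz) (hB'.norm_le hz) (norm_nonneg _) hB.nonneg

lemma memFrakI.comp_affine {φ : (ι → ℂ) → ℂ} (hφ : memFrakI φ) {a : ℝ} (ha : a ≠ 0) (b : ι → ℂ) :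
    memFrakI fun z => φ ((a : ℂ) • z + b) := by
  refine memFrakI_iff.2 ⟨hφ.1.comp (by fun_prop), fun k => ?_⟩
  obtain ⟨n, hn⟩ := exists_nat_ge (|a| * k + ‖b‖)
  obtain ⟨B, hB⟩ := (memFrakI_iff.1 hφ).2 (max n k)
  have ha' : 0 < |a| := abs_pos.2 ha
  refine ⟨((1 + |a|⁻¹) * (1 + ‖b‖)) ^ k * B, fun z hz => ?_⟩
  have hz' : (a : ℂ) • z + b ∈ hstrip ι (max n k) := by
    refine hstrip_mono (le_max_left _ _) fun i => ?_
    have h1 : |(b i).im| ≤ ‖b‖ := (Complex.abs_im_le_norm _).trans (norm_le_pi_norm b i)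
    have h2 : |a * (z i).im| ≤ |a| * k := by
      rw [abs_mul]
      exact mul_le_mul_of_nonneg_left (hz i) ha'.le
    simp only [Pi.add_apply, Pi.smul_apply, smul_eq_mul, Complex.add_im, Complex.mul_im,
      Complex.ofReal_re, Complex.ofReal_im, zero_mul, add_zero]
    exact (abs_add_le _ _).trans ((add_le_add h2 h1).trans hn)
  have h1 : 1 + ‖z‖ ≤ (1 + |a|⁻¹) * (1 + ‖b‖) * (1 + ‖(a : ℂ) • z + b‖) := by
    have h2 := one_add_norm_le_mul ((a : ℂ) • z) b
    have h3 : ‖z‖ = |a|⁻¹ * ‖(a : ℂ) • z‖ := by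
      rw [norm_smul, Complex.norm_real, Real.norm_eq_abs, inv_mul_cancel_left₀ ha'.ne']
    calc 1 + ‖z‖ ≤ (1 + |a|⁻¹) * (1 + ‖(a : ℂ) • z‖) := by
          rw [h3]
          nlinarith [norm_nonneg ((a : ℂ) • z), inv_pos.2 ha']
      _ ≤ (1 + |a|⁻¹) * ((1 + ‖(a : ℂ) • z + b‖) * (1 + ‖b‖)) := by gcongr
      _ = _ := by ring
  calc _ ≤ ((1 + |a|⁻¹) * (1 + ‖b‖) * (1 + ‖(a : ℂ) • z + b‖)) ^ k * ‖φ ((a : ℂ) • z + b)‖ := by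
        gcongr
    _ = ((1 + |a|⁻¹) * (1 + ‖b‖)) ^ k *
        ((1 + ‖(a : ℂ) • z + b‖) ^ k * ‖φ ((a : ℂ) • z + b)‖) := by rw [mul_pow]; ring
    _ ≤ _ := by
        gcongr
        refine le_trans ?_ (hB _ hz')
        gcongr
        · linarith [norm_nonneg ((a : ℂ) • z + b)]
        · exact le_max_right _ _

/-- The Gaussian `exp (- ∑ zᵢ²)`. -/
def gauss (z : ι → ℂ) : ℂ := Complex.exp (-∑ i, z i ^ 2)

lemma memFrakI_gauss : memFrakI (gauss : (ι → ℂ) → ℂ) := by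
  refine memFrakI_iff.2 ⟨by unfold gauss; fun_prop, fun k => ?_⟩
  refine ⟨k.factorial * Real.exp 2 * Real.exp (2 * (Fintype.card ι * k ^ 2)), fun z hz => ?_⟩
  have h1 : ‖gauss z‖ ≤ Real.exp (2 * (Fintype.card ι * k ^ 2)) * Real.exp (-‖z‖ ^ 2) := by
    rw [gauss, Complex.norm_exp, ← Real.exp_add, Real.exp_le_exp]
    have h2 : ‖z‖ ^ 2 ≤ ∑ i, ‖z i‖ ^ 2 := by
      have h3 := norm_le_cnormI z
      have h4 := pow_le_pow_left₀ (norm_nonneg z) h3 2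
      rwa [cnormI, Real.sq_sqrt (Finset.sum_nonneg fun _ _ => sq_nonneg _)] at h4
    have h5 : (-∑ i, z i ^ 2).re ≤ ∑ i, (2 * (k : ℝ) ^ 2 - ‖z i‖ ^ 2) := by
      rw [Complex.neg_re, Complex.re_sum, ← Finset.sum_neg_distrib]
      refine Finset.sum_le_sum fun i _ => ?_
      have h6 : (z i).im ^ 2 ≤ (k : ℝ) ^ 2 := sq_le_sq' (abs_le.1 (hz i)).1 (abs_le.1 (hz i)).2
      rw [Complex.sq_norm, Complex.normSq_apply]
      simp only [sq, Complex.mul_re] at h6 ⊢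
      linarith
    rw [Finset.sum_sub_distrib, Finset.sum_const, Finset.card_univ, nsmul_eq_mul] at h5
    linarith
  have h2 : (1 + ‖z‖) ^ k ≤ k.factorial * Real.exp (1 + ‖z‖) := by
    have := Real.pow_div_factorial_le_exp (1 + ‖z‖) (by positivity) k
    rwa [div_le_iff₀ (by positivity), mul_comm] at this
  calc _ ≤ (k.factorial * Real.exp (1 + ‖z‖)) *
        (Real.exp (2 * (Fintype.card ι * k ^ 2)) * Real.exp (-‖z‖ ^ 2)) := by gcongr
    _ = k.factorial * Real.exp (1 + ‖z‖ - ‖z‖ ^ 2) * Real.exp (2 * (Fintype.card ι * k ^ 2)) := by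
        rw [sub_eq_add_neg, Real.exp_add (1 + ‖z‖)]; ring
    _ ≤ _ := by
        gcongr
        nlinarith [sq_nonneg (‖z‖ - 1 / 2)]

lemma norm_realVec (x : ι → ℝ) : ‖realVec x‖ = ‖x‖ := by
  simp [Pi.norm_def, realVec]

lemma integrable_real_inv_pow : Integrable fun x : ι → ℝ => ((1 + ‖x‖) ^ decay ι)⁻¹ := by
  have h := integrable_one_add_norm (E := ι → ℝ) (μ := volume) (r := (decay ι : ℕ)) (by
    rw [Module.finrank_pi]
    exact_mod_cast by simp [decay])
  refine h.congr (Eventually.of_forall fun z => ?_)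
  simp only
  rw [Real.rpow_neg (by positivity), Real.rpow_natCast]

lemma StripBound.norm_le_inv {m n : ℕ} {φ : (ι → ℂ) → ℂ} {B : ℝ} (h : StripBound (m + n) φ B)
    {z : ι → ℂ} (hz : z ∈ hstrip ι (m + n)) : ‖φ z‖ ≤ B * ((1 + ‖z‖) ^ n)⁻¹ := by
  rw [← div_eq_mul_inv, le_div_iff₀ (by positivity), mul_comm]
  refine le_trans ?_ (h z hz)
  gcongr
  · linarith [norm_nonneg z]
  · omega

/-- The integral of a function in `𝔥` along a horizontal real subspace does not depend on the
subspace. -/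
lemma integral_add_realVec {Φ : (ι → ℂ) → ℂ} (hΦ : memFrakI Φ) (z : ι → ℂ) :
    ∫ u, Φ (z + realVec u) = ∫ u, Φ (realVec u) := by
  set y : ι → ℝ := fun i => (z i).im with hy
  set h : ℂ → ℂ := fun ζ => ∫ u, Φ (realVec u + ζ • realVec y) with hh
  have hc := hΦ.continuous
  have hd : Differentiable ℂ h := by
    refine differentiable_integral_of_dominated
      (Φ := fun u ζ => Φ (realVec u + ζ • realVec y)) ?_ ?_ ?_
    · exact hc.comp (by fun_prop)
    · exact fun u => hΦ.1.comp (by fun_prop)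
    · intro R
      obtain ⟨n, hn⟩ := exists_nat_ge (R * ‖y‖)
      obtain ⟨B, hB⟩ := (memFrakI_iff.1 hΦ).2 (n + decay ι)
      refine ⟨_, integrable_real_inv_pow.const_mul (B * (1 + n) ^ decay ι), ?_⟩
      refine Eventually.of_forall fun u ζ hζ => ?_
      have h1 : ‖ζ • realVec y‖ ≤ n := by
        rw [norm_smul, norm_realVec]
        exact (mul_le_mul_of_nonneg_right hζ (norm_nonneg _)).trans hn
      have h2 := add_mem_hstrip (realVec_mem 0 u) h1
      rw [zero_add] at h2
      refine (hB.norm_le_inv (hstrip_mono (Nat.le_add_right _ _) h2)).trans ?_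
      rw [mul_assoc]
      refine mul_le_mul_of_nonneg_left ?_ hB.nonneg
      rw [← div_eq_mul_inv, le_div_iff₀ (by positivity), ← div_eq_inv_mul,
        div_le_iff₀ (by positivity), ← mul_pow]
      gcongr
      have h3 := one_add_norm_le_mul (realVec u) (ζ • realVec y)
      rw [norm_realVec] at h3
      refine h3.trans ?_
      rw [mul_comm]
      gcongr
  have hreal : ∀ t : ℝ, h t = h 0 := by
    intro t
    have h1 := integral_add_right_eq_self (μ := volume) (fun u : ι → ℝ => Φ (realVec u)) (t • y)
    simp only [hh, zero_smul, add_zero]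
    rw [← h1]
    congr 1
    ext u
    congr 1
    ext i
    simp [realVec]
  have hconst : h = fun _ => h 0 := by
    refine AnalyticOnNhd.eq_of_frequently_eq (z₀ := 0) (𝕜 := ℂ)
      (fun w _ => hd.analyticAt w) (fun w _ => analyticAt_const) ?_
    have h1 : Tendsto (fun n : ℕ => (((1 / ((n : ℝ) + 1) : ℝ)) : ℂ)) atTop (𝓝[≠] 0) := by
      refine tendsto_nhdsWithin_iff.2 ⟨?_, Eventually.of_forall fun n => ?_⟩
      · exact (Complex.continuous_ofReal.tendsto 0).comp tendsto_one_div_add_atTop_nhds_zero_nat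
      · have : (1 / ((n : ℝ) + 1) : ℝ) ≠ 0 := by positivity
        exact Complex.ofReal_ne_zero.2 this
    exact h1.frequently (Frequently.of_forall fun n => hreal _)
  have h2 := integral_add_right_eq_self (μ := volume)
    (fun u : ι → ℝ => Φ (realVec u + Complex.I • realVec y)) (fun i => (z i).re)
  have h3 : h Complex.I = h 0 := congrFun hconst Complex.I
  simp only [hh, zero_smul, add_zero] at h3
  rw [← h3, ← h2]
  congr 1
  ext u
  congr 1
  ext i
  simp only [realVec, Pi.add_apply, Pi.smul_apply, smul_eq_mul, Complex.ofReal_add, hy]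
  conv_lhs => rw [← Complex.re_add_im (z i)]
  ring

end Gaussian

section Uniqueness

variable {ι : Type*} [Fintype ι]

lemma exists_norm_add_realVec_le {φ : (ι → ℂ) → ℂ} (hφ : memFrakI φ) (k m : ℕ) :
    ∃ B : ℝ, 0 ≤ B ∧ ∀ z ∈ hstrip ι k, ∀ y : ι → ℝ,
      ‖φ (z + realVec y)‖ ≤ B * (((1 + ‖z‖) ^ m)⁻¹ * (1 + ‖y‖) ^ m) := by
  obtain ⟨B, hB⟩ := (memFrakI_iff.1 hφ).2 (k + m)
  refine ⟨B, hB.nonneg, fun z hz y => ?_⟩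
  refine (hB.norm_le_inv (hstrip_mono (Nat.le_add_right _ _) (add_realVec_mem hz y))).trans ?_
  refine mul_le_mul_of_nonneg_left ?_ hB.nonneg
  rw [← div_eq_inv_mul, le_div_iff₀ (by positivity), ← div_eq_inv_mul,
    div_le_iff₀ (by positivity), ← mul_pow, mul_comm]
  have h := one_add_norm_le_mul z (realVec y)
  rw [norm_realVec] at h
  rw [mul_comm]
  gcongr
  linarith

lemma exists_norm_realVec_mul_le {φ : (ι → ℂ) → ℂ} (hφ : memFrakI φ) (m : ℕ) :
    ∃ B : ℝ, 0 ≤ B ∧ ∀ x : ι → ℝ,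
      ‖φ (realVec x)‖ * (1 + ‖x‖) ^ m ≤ B * ((1 + ‖x‖) ^ decay ι)⁻¹ := by
  obtain ⟨B, hB⟩ := (memFrakI_iff.1 hφ).2 (m + decay ι)
  refine ⟨B, hB.nonneg, fun x => ?_⟩
  have h := hB _ (realVec_mem _ x)
  rw [norm_realVec, pow_add] at h
  rw [← div_eq_mul_inv, le_div_iff₀ (by positivity)]
  linarith

lemma memFrakI.integrable_realVec {φ : (ι → ℂ) → ℂ} (hφ : memFrakI φ) :
    Integrable fun x => φ (realVec x) := by
  obtain ⟨B, -, hB⟩ := exists_norm_realVec_mul_le hφ 0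
  have hc := hφ.continuous
  refine (integrable_real_inv_pow.const_mul B).mono'
    (Continuous.aestronglyMeasurable (by fun_prop)) (Eventually.of_forall fun x => ?_)
  simpa using hB x

lemma integral_gauss_ne_zero : ∫ x : ι → ℝ, gauss (realVec x) ≠ 0 := by
  have h1 : ∀ x : ι → ℝ, gauss (realVec x) = ((Real.exp (-∑ i, x i ^ 2) : ℝ) : ℂ) := fun x => by
    simp [gauss, realVec]
  have h2 : Integrable fun x : ι → ℝ => Real.exp (-∑ i, x i ^ 2) := by
    have h3 := (memFrakI_gauss (ι := ι)).integrable_realVec.re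
    simpa only [h1, RCLike.re_to_complex, Complex.ofReal_re] using h3
  simp only [h1]
  rw [integral_complex_ofReal]
  exact Complex.ofReal_ne_zero.2 (ne_of_gt (integral_exp_pos h2))

/-- Convolution with a Gaussian: the real convolution integral can be recentred at a complex
point. -/
lemma integral_mul_gauss {φ : (ι → ℂ) → ℂ} (hφ : memFrakI φ) {c : ℝ} (hc : c ≠ 0) (z : ι → ℂ) :
    ∫ v : ι → ℝ, φ (z + realVec (c⁻¹ • v)) * gauss (realVec v) =
      ((|c ^ Fintype.card ι| : ℝ) : ℂ) *
        ∫ x : ι → ℝ, φ (realVec x) * gauss ((c : ℂ) • z + realVec (-c • x)) := by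
  have hg : memFrakI fun w : ι → ℂ => gauss (((-c : ℝ) : ℂ) • w + (c : ℂ) • z) :=
    memFrakI_gauss.comp_affine (neg_ne_zero.2 hc) _
  have h1 := integral_add_realVec (hφ.mul hg) z
  have h2 := Measure.integral_comp_smul (volume : Measure (ι → ℝ))
    (fun v : ι → ℝ => φ (z + realVec (c⁻¹ • v)) * gauss (realVec v)) c
  rw [Module.finrank_pi, abs_inv] at h2
  have h3 : ∫ v : ι → ℝ, φ (z + realVec (c⁻¹ • v)) * gauss (realVec v) =
      ((|c ^ Fintype.card ι| : ℝ) : ℂ) *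
        ∫ u : ι → ℝ, φ (z + realVec (c⁻¹ • c • u)) * gauss (realVec (c • u)) := by
    rw [h2, Complex.real_smul, ← mul_assoc, ← Complex.ofReal_mul, mul_inv_cancel₀, Complex.ofReal_one,
      one_mul]
    exact abs_ne_zero.2 (pow_ne_zero _ hc)
  rw [h3]
  congr 1
  refine Eq.trans ?_ (h1.trans ?_)
  · congr 1
    ext u
    rw [inv_smul_smul₀ hc]
    congr 1
    simp only [gauss]
    congr 2
    refine Finset.sum_congr rfl fun i _ => ?_
    simp [realVec]
  · congr 1
    ext x
    congr 2
    ext i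
    simp [realVec]
    ring

/-- Functionals bounded in a weighted `L²` norm are given by integration against a density. -/
lemma exists_density {k : ℕ} {D : frakSubmodule ι →ₗ[ℂ] ℂ} {C : ℝ}
    (hD : ∀ φ, ‖D φ‖ ≤ C * ‖toL2 k φ‖) :
    ∃ q : (ι → ℂ) → ℂ, StronglyMeasurable q ∧
      Integrable (fun z => ‖q z‖ * ((1 + ‖z‖) ^ (k + decay ι))⁻¹) (stripMeasure ι k) ∧
      ∀ φ : frakSubmodule ι, D φ = ∫ z, q z * (φ : (ι → ℂ) → ℂ) z ∂stripMeasure ι k := by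
  obtain ⟨A, e, he, hspan⟩ := exists_orthonormal_toL2 (ι := ι) k
  obtain ⟨κ, hκ⟩ := exists_inner_eq he (sum_norm_sq_le_of_orthonormal hD he)
  have hκm : StronglyMeasurable κ := Lp.stronglyMeasurable κ
  have hDκ : D - (innerSL ℂ κ : Lp ℂ 2 (stripMeasure ι k) →ₗ[ℂ] ℂ) ∘ₗ toL2 k = 0 := by
    refine eq_zero_of_forall_basis (k := k) (C := C + ‖κ‖) (fun φ => ?_) hspan fun a => ?_
    · rw [add_mul]
      exact (norm_sub_le _ _).trans (add_le_add (hD φ) (norm_inner_le_norm κ (toL2 k φ)))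
    · exact sub_eq_zero.2 (hκ a).symm
  refine ⟨fun z => starRingEnd ℂ (κ z) * ((1 + ‖z‖ : ℝ) : ℂ) ^ k, ?_, ?_, fun φ => ?_⟩
  · exact (Complex.continuous_conj.comp_stronglyMeasurable hκm).mul
      (Continuous.stronglyMeasurable (by fun_prop))
  · have h1 : MemLp (fun z : ι → ℂ => ((1 + ‖z‖) ^ decay ι)⁻¹) 2 (stripMeasure ι k) := by
      have hc : Continuous fun z : ι → ℂ => ((1 + ‖z‖) ^ decay ι)⁻¹ :=
        Continuous.inv₀ (by fun_prop) fun z => by positivity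
      rw [memLp_two_iff_integrable_sq_norm hc.aestronglyMeasurable]
      simp only [Real.norm_eq_abs, sq_abs]
      exact integrable_inv_pow.restrict
    refine ((Lp.memLp κ).norm.integrable_mul h1).congr (Eventually.of_forall fun z => ?_)
    simp only [Pi.mul_apply, norm_mul, norm_pow, Complex.norm_conj, Complex.norm_real]
    rw [Real.norm_of_nonneg (by positivity), pow_add]
    field_simp
  · have h1 := LinearMap.congr_fun (sub_eq_zero.1 hDκ) φ
    refine h1.trans ((L2.inner_def κ (toL2 k φ)).trans (integral_congr_ae ?_))
    filter_upwards [(memLp_weighted k φ.2).coeFn_toLp] with z hz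
    refine (congrArg (inner ℂ (κ z)) hz).trans ?_
    simp only [weighted, RCLike.inner_apply]
    ring

/-- Functionals that vanish on all real translates and dilates of a Gaussian vanish. -/
lemma eq_zero_of_gauss {k : ℕ} {D : frakSubmodule ι →ₗ[ℂ] ℂ} {C : ℝ}
    (hD : ∀ φ, ‖D φ‖ ≤ C * ‖toL2 k φ‖)
    (hG : ∀ (c : ℝ) (x : ι → ℝ) (ψ : frakSubmodule ι), c ≠ 0 →
      (ψ : (ι → ℂ) → ℂ) = (fun z => gauss ((c : ℂ) • z + realVec x)) → D ψ = 0) : D = 0 := by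
  obtain ⟨q, hqm, hqi, hq⟩ := exists_density hD
  ext φ
  have hφ : memFrakI (φ : (ι → ℂ) → ℂ) := φ.2
  have hφc := hφ.continuous
  have hgc : Continuous (gauss : (ι → ℂ) → ℂ) := memFrakI_gauss.continuous
  set μ := (stripMeasure ι k).prod (volume : Measure (ι → ℝ))
  have hmem : ∀ᵐ p ∂μ, p.1 ∈ hstrip ι k := Measure.quasiMeasurePreserving_fst.ae (ae_mem_hstrip k)
  have hdom := hqi.mul_prod (integrable_real_inv_pow (ι := ι))
  set bd : (ι → ℂ) × (ι → ℝ) → ℝ := fun p =>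
    ‖q p.1‖ * ((1 + ‖p.1‖) ^ (k + decay ι))⁻¹ * ((1 + ‖p.2‖) ^ decay ι)⁻¹ with hbd
  have hconv : ∀ c : ℝ, c ≠ 0 → ∫ z, q z * (∫ x : ι → ℝ, (φ : (ι → ℂ) → ℂ) (realVec x) *
      gauss ((c : ℂ) • z + realVec (-c • x))) ∂stripMeasure ι k = 0 := by
    intro c hc
    have hgauss : memFrakI fun z : ι → ℂ => gauss ((c : ℂ) • z + 0) :=
      memFrakI_gauss.comp_affine hc 0
    obtain ⟨B, hB0, hB⟩ := exists_norm_add_realVec_le hgauss k (k + decay ι)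
    obtain ⟨B', hB'0, hB'⟩ := exists_norm_realVec_mul_le hφ (k + decay ι)
    have hinteg : Integrable (fun p : (ι → ℂ) × (ι → ℝ) => q p.1 *
        ((φ : (ι → ℂ) → ℂ) (realVec p.2) * gauss ((c : ℂ) • p.1 + realVec (-c • p.2)))) μ := by
      refine (hdom.const_mul (B * B')).mono' ?_ ?_
      · refine (hqm.comp_measurable measurable_fst).aestronglyMeasurable.mul ?_
        exact Continuous.aestronglyMeasurable (by fun_prop)
      · filter_upwards [hmem] with p hp
        have h1 := hB p.1 hp (-p.2)
        have h2 : (c : ℂ) • (p.1 + realVec (-p.2)) + 0 = (c : ℂ) • p.1 + realVec (-c • p.2) := by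
          ext i
          simp [realVec]
        rw [h2, norm_neg] at h1
        rw [norm_mul, norm_mul]
        calc _ ≤ ‖q p.1‖ * (‖(φ : (ι → ℂ) → ℂ) (realVec p.2)‖ *
              (B * (((1 + ‖p.1‖) ^ (k + decay ι))⁻¹ * (1 + ‖p.2‖) ^ (k + decay ι)))) := by gcongr
          _ = ‖q p.1‖ * ((1 + ‖p.1‖) ^ (k + decay ι))⁻¹ * B *
              (‖(φ : (ι → ℂ) → ℂ) (realVec p.2)‖ * (1 + ‖p.2‖) ^ (k + decay ι)) := by ring
          _ ≤ ‖q p.1‖ * ((1 + ‖p.1‖) ^ (k + decay ι))⁻¹ * B *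
              (B' * ((1 + ‖p.2‖) ^ decay ι)⁻¹) := by
              exact mul_le_mul_of_nonneg_left (hB' p.2) (by positivity)
          _ = _ := by ring
    simp only [← integral_const_mul]
    rw [integral_integral_swap hinteg]
    refine integral_eq_zero_of_ae (Eventually.of_forall fun x => ?_)
    simp only [mul_left_comm (q _)]
    rw [integral_const_mul]
    have h3 := hG c (-c • x) ⟨_, memFrakI_gauss.comp_affine hc (realVec (-c • x))⟩ hc rfl
    rw [hq] at h3
    simp only at h3
    rw [h3, mul_zero, Pi.zero_apply]
  obtain ⟨B, hB0, hB⟩ := exists_norm_add_realVec_le hφ k (k + decay ι)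
  obtain ⟨B', hB'0, hB'⟩ := exists_norm_realVec_mul_le (memFrakI_gauss (ι := ι)) (k + decay ι)
  set Ψ : ℕ → (ι → ℂ) × (ι → ℝ) → ℂ := fun n p =>
    q p.1 * ((φ : (ι → ℂ) → ℂ) (p.1 + realVec (((n : ℝ) + 1)⁻¹ • p.2)) * gauss (realVec p.2))
    with hΨ
  have hmeas : ∀ n, AEStronglyMeasurable (Ψ n) μ := fun n => by
    refine (hqm.comp_measurable measurable_fst).aestronglyMeasurable.mul ?_
    exact Continuous.aestronglyMeasurable (by fun_prop)
  have hle : ∀ n, ∀ᵐ p ∂μ, ‖Ψ n p‖ ≤ B * B' * bd p := fun n => by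
    filter_upwards [hmem] with p hp
    have h1 := hB p.1 hp (((n : ℝ) + 1)⁻¹ • p.2)
    have h2 : ‖((n : ℝ) + 1)⁻¹ • p.2‖ ≤ ‖p.2‖ := by
      rw [norm_smul, Real.norm_of_nonneg (by positivity)]
      refine mul_le_of_le_one_left (norm_nonneg _) (inv_le_one_of_one_le₀ ?_)
      linarith [(Nat.cast_nonneg n : (0 : ℝ) ≤ n)]
    simp only [hΨ]
    rw [norm_mul, norm_mul]
    calc _ ≤ ‖q p.1‖ * ((B * (((1 + ‖p.1‖) ^ (k + decay ι))⁻¹ *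
            (1 + ‖((n : ℝ) + 1)⁻¹ • p.2‖) ^ (k + decay ι))) * ‖gauss (realVec p.2)‖) := by gcongr
      _ ≤ ‖q p.1‖ * ((B * (((1 + ‖p.1‖) ^ (k + decay ι))⁻¹ *
            (1 + ‖p.2‖) ^ (k + decay ι))) * ‖gauss (realVec p.2)‖) := by gcongr
      _ = ‖q p.1‖ * ((1 + ‖p.1‖) ^ (k + decay ι))⁻¹ * B *
          (‖gauss (realVec p.2)‖ * (1 + ‖p.2‖) ^ (k + decay ι)) := by ring
      _ ≤ ‖q p.1‖ * ((1 + ‖p.1‖) ^ (k + decay ι))⁻¹ * B *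
          (B' * ((1 + ‖p.2‖) ^ decay ι)⁻¹) := by
          exact mul_le_mul_of_nonneg_left (hB' p.2) (by positivity)
      _ = _ := by rw [hbd]; ring
  have hzero : ∀ n, ∫ p, Ψ n p ∂μ = 0 := fun n => by
    have hc : ((n : ℝ) + 1) ≠ 0 := by positivity
    rw [integral_prod _ ((hdom.const_mul (B * B')).mono' (hmeas n) (hle n))]
    simp only [hΨ]
    simp only [integral_const_mul, integral_mul_gauss hφ hc]
    simp only [mul_left_comm (q _)]
    rw [integral_const_mul, hconv _ hc, mul_zero]
  have hlim : Tendsto (fun n => ∫ p, Ψ n p ∂μ) atTop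
      (𝓝 (∫ p : (ι → ℂ) × (ι → ℝ), q p.1 * (φ : (ι → ℂ) → ℂ) p.1 * gauss (realVec p.2) ∂μ)) := by
    refine tendsto_integral_of_dominated_convergence _ hmeas (hdom.const_mul (B * B')) hle ?_
    refine Eventually.of_forall fun p => ?_
    simp only [mul_assoc]
    refine Tendsto.const_mul _ (Tendsto.mul_const _ ?_)
    have h1 : Tendsto (fun n : ℕ => ((n : ℝ) + 1)⁻¹) atTop (𝓝 0) := by
      simpa using tendsto_one_div_add_atTop_nhds_zero_nat (𝕜 := ℝ)
    have h2 : Continuous fun t : ℝ => (φ : (ι → ℂ) → ℂ) (p.1 + realVec (t • p.2)) := by fun_prop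
    have h3 := (h2.tendsto 0).comp h1
    have h4 : p.1 + realVec ((0 : ℝ) • p.2) = p.1 := by
      ext i
      simp [realVec]
    rw [h4] at h3
    exact h3
  simp only [hzero] at hlim
  have h5 := tendsto_nhds_unique hlim tendsto_const_nhds
  rw [integral_prod_mul (fun z => q z * (φ : (ι → ℂ) → ℂ) z) fun x => gauss (realVec x), ← hq φ] at h5
  simpa [integral_gauss_ne_zero] using h5

end Uniqueness

section KernelTheorem

variable {J ι : Type*} [Fintype J] [Fintype ι]

lemma gauss_prod (z : J × ι → ℂ) : gauss z = ∏ j, gauss fun i => z (j, i) := by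
  simp only [gauss]
  rw [← Complex.exp_sum, Finset.sum_neg_distrib, Fintype.sum_prod_type]

/-- Continuous linear functionals that agree on tensor products are equal. -/
lemma eq_of_eq_on_tensors {F F' : ((J × ι → ℂ) → ℂ) → ℂ}
    (hadd : ∀ φ ψ, memFrakI φ → memFrakI ψ → F (φ + ψ) = F φ + F ψ)
    (hsmul : ∀ (c : ℂ) (φ), memFrakI φ → F (c • φ) = c * F φ) (hF : contLinI F)
    (hadd' : ∀ φ ψ, memFrakI φ → memFrakI ψ → F' (φ + ψ) = F' φ + F' ψ)
    (hsmul' : ∀ (c : ℂ) (φ), memFrakI φ → F' (c • φ) = c * F' φ) (hF' : contLinI F')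
    (h : ∀ f : J → ((ι → ℂ) → ℂ), (∀ j, memFrakI (f j)) →
      F' (fun z => ∏ j, f j fun i => z (j, i)) = F (fun z => ∏ j, f j fun i => z (j, i)))
    {φ : (J × ι → ℂ) → ℂ} (hφ : memFrakI φ) : F' φ = F φ := by
  obtain ⟨n, C, hC, hb⟩ := hF.exists_stripBound
  obtain ⟨n', C', hC', hb'⟩ := hF'.exists_stripBound
  obtain ⟨E, hE, hbE⟩ := exists_stripBound_norm_toL2 (ι := J × ι) (max n n')
  let D : frakSubmodule (J × ι) →ₗ[ℂ] ℂ :=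
    { toFun := fun φ => F' φ - F φ
      map_add' := fun φ ψ => by
        rw [Submodule.coe_add, hadd _ _ φ.2 ψ.2, hadd' _ _ φ.2 ψ.2]
        ring
      map_smul' := fun c φ => by
        rw [Submodule.coe_smul, hsmul _ _ φ.2, hsmul' _ _ φ.2, RingHom.id_apply, smul_eq_mul]
        ring }
  have hD : D = 0 := by
    refine eq_zero_of_gauss (k := max n n' + 1) (C := (C' + C) * E) (fun φ => ?_) ?_
    · have h1 := hb φ φ.2 _ ((hbE φ).mono (le_max_left _ _) le_rfl)
      have h2 := hb' φ φ.2 _ ((hbE φ).mono (le_max_right _ _) le_rfl)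
      refine ((norm_sub_le _ _).trans (add_le_add h2 h1)).trans_eq ?_
      ring
    · intro c x ψ hc hψ
      have h1 := h (fun j w => gauss ((c : ℂ) • w + realVec fun i => x (j, i))) fun j =>
        memFrakI_gauss.comp_affine hc _
      have h2 : (ψ : (J × ι → ℂ) → ℂ) = fun z => ∏ j, gauss ((c : ℂ) • (fun i => z (j, i)) +
          realVec fun i => x (j, i)) := by
        rw [hψ]
        funext z
        exact gauss_prod _
      change F' ψ - F ψ = 0
      rw [h2, sub_eq_zero]
      exact h1
  exact sub_eq_zero.1 (LinearMap.congr_fun hD ⟨φ, hφ⟩)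

end KernelTheorem

/-- Kernel theorem for tempered ultrahyperfunctions: a separately
continuous multilinear functional `M` on `(𝔥(T(ℝ⁴)))ᵐ` extends to a unique continuous
linear functional `F` on `𝔥(T(ℝ^{4m}))` with `F(f₁ ⊗ ⋯ ⊗ f_m) = M(f₁,…,f_m)`. -/
theorem stmt_8 {m : ℕ} (M : (Fin m → ((Fin 4 → ℂ) → ℂ)) → ℂ)
    (hlin : ∀ (j : Fin m) (f : Fin m → ((Fin 4 → ℂ) → ℂ)),
      (∀ i, i ≠ j → memFrakI (f i)) →
      ∀ (c : ℂ) (φ ψ : (Fin 4 → ℂ) → ℂ), memFrakI φ → memFrakI ψ →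
        M (Function.update f j (c • φ + ψ)) =
          c * M (Function.update f j φ) + M (Function.update f j ψ))
    (hcont : ∀ (j : Fin m) (f : Fin m → ((Fin 4 → ℂ) → ℂ)),
      (∀ i, i ≠ j → memFrakI (f i)) →
      ∃ K : Set (Fin 4 → ℝ), IsCompact K ∧ Convex ℝ K ∧ ∃ (N : ℕ) (C : ℝ), 0 < C ∧
        ∀ φ, memFrakI φ → ∀ B : ℝ,
          (∀ z : Fin 4 → ℂ, imvI z ∈ K → (1 + cnormI z) ^ N * ‖φ z‖ ≤ B) →
          ‖M (Function.update f j φ)‖ ≤ C * B) :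
    ∃ F : ((Fin m × Fin 4 → ℂ) → ℂ) → ℂ, IsKernelExtension M F ∧
      ∀ F' : ((Fin m × Fin 4 → ℂ) → ℂ) → ℂ, IsKernelExtension M F' →
        ∀ φ, memFrakI φ → F' φ = F φ := by
  obtain ⟨k, C, hM⟩ := exists_joint_stripBound M hlin hcont Finset.univ 0
    fun _ => (frakSubmodule (Fin 4)).zero_mem
  have hT : ∀ (f : Fin m → frakSubmodule (Fin 4)) (B : Fin m → ℝ), (∀ i, 0 < B i) →
      (∀ i, StripBound k (f i : (Fin 4 → ℂ) → ℂ) (B i)) →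
      ‖frakMultilinear M hlin f‖ ≤ C * ∏ i, B i := fun f B hB hf =>
    hM _ B (fun i => (f i).2) (fun i hi => absurd (Finset.mem_univ i) hi) hB fun i _ => hf i
  obtain ⟨C₁, -, h₁⟩ := exists_norm_le_prod_toL2 hT le_rfl
  obtain ⟨C₂, -, h₂⟩ := exists_norm_le_prod_toL2 hT
    (show k ≤ k + 1 + decay (Fin 4) by omega)
  obtain ⟨F, hadd, hsmul, hF, htensor⟩ := exists_extension h₁ h₂
  have hFM : ∀ f : Fin m → ((Fin 4 → ℂ) → ℂ), (∀ i, memFrakI (f i)) →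
      F (fun z => ∏ j, f j (fun i => z (j, i))) = M f := fun f hf =>
    htensor fun j => ⟨f j, hf j⟩
  refine ⟨F, ⟨hadd, hsmul, hF, hFM⟩, fun F' ⟨hadd', hsmul', hF', hFM'⟩ φ hφ => ?_⟩
  exact eq_of_eq_on_tensors hadd hsmul hF hadd' hsmul' hF'
    (fun f hf => (hFM' f hf).trans (hFM f hf).symm) hφ
end
end
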